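/- arXiv:1506.00126 — 2 statements merged into one kernel-verified Lean document; each statement's English description precedes it below -/
import Mathlib

section
/- Existence and uniqueness of the semi-implicit JKO minimizer: Let ρ_0 = (ρ_{1,0},…,ρ_{l,0}) ∈ P₂^{ac}(ℝⁿ)^l with F_i(ρ_{i,0}) + V_i(ρ_{i,0}|ρ_0) < +∞ for each i, and let h > 0. Then for each i ∈ {1,…,l} there exists a unique ρ_{i,h}^1 ∈ P₂^{ac}(ℝⁿ) minimizing ρ ↦ E_{i,h}(ρ | ρ_0) := W₂²(ρ, ρ_{i,0}) + 2h (F_i(ρ) + V_i(ρ | ρ_0)) over P₂^{ac}(ℝⁿ). -/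
open MeasureTheory Filter Topology Set
open scoped ENNReal NNReal RealInnerProductSpace Classical

noncomputable section

abbrev Rn (n : ℕ) := EuclideanSpace ℝ (Fin n)

namespace Paper

variable {n l : ℕ}

/-- Second moment (extended-real valued). -/
def M2 (μ : Measure (Rn n)) : ℝ≥0∞ := ∫⁻ x, (‖x‖₊ : ℝ≥0∞) ^ 2 ∂μ

/-- Absolutely continuous probability measures with finite second moment. -/
def P2ac (n : ℕ) : Set (Measure (Rn n)) :=
  {μ | IsProbabilityMeasure μ ∧ μ ≪ (volume : Measure (Rn n)) ∧ M2 μ < ⊤}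

/-- Probability measures with finite second moment. -/
def P2 (n : ℕ) : Set (Measure (Rn n)) :=
  {μ | IsProbabilityMeasure μ ∧ M2 μ < ⊤}

/-- Couplings between two measures. -/
def couplings (ρ μ : Measure (Rn n)) : Set (Measure (Rn n × Rn n)) :=
  {γ | IsProbabilityMeasure γ ∧ γ.map Prod.fst = ρ ∧ γ.map Prod.snd = μ}

/-- Quadratic transport cost of a plan. -/
def transportCost (γ : Measure (Rn n × Rn n)) : ℝ≥0∞ :=
  ∫⁻ p, (‖p.1 - p.2‖₊ : ℝ≥0∞) ^ 2 ∂γ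

/-- Squared 2-Wasserstein distance (extended-real valued). -/
def W2e (ρ μ : Measure (Rn n)) : ℝ≥0∞ := ⨅ γ ∈ couplings ρ μ, transportCost γ

/-- 2-Wasserstein distance. -/
def W2 (ρ μ : Measure (Rn n)) : ℝ := Real.sqrt (W2e ρ μ).toReal

/-- 1-Wasserstein distance. -/
def W1 (ρ μ : Measure (Rn n)) : ℝ :=
  (⨅ γ ∈ couplings ρ μ, ∫⁻ p : Rn n × Rn n, (‖p.1 - p.2‖₊ : ℝ≥0∞) ∂γ).toReal

/-- A coupling is an optimal transport plan for the quadratic cost. -/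
def IsOptimalPlan (ρ μ : Measure (Rn n)) (γ : Measure (Rn n × Rn n)) : Prop :=
  γ ∈ couplings ρ μ ∧ transportCost γ = W2e ρ μ

/-- `T` is an optimal transport map from `ρ` to `μ` for the quadratic cost. -/
def IsOptimalMap (ρ μ : Measure (Rn n)) (T : Rn n → Rn n) : Prop :=
  Measurable T ∧ IsOptimalPlan ρ μ (ρ.map fun x => (x, T x))

/-- Lebesgue density of a measure. -/
def dens (μ : Measure (Rn n)) : Rn n → ℝ := fun x => (μ.rnDeriv volume x).toReal

/-- The pressure associated to an internal energy density `F`. -/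
def pressure (F : ℝ → ℝ) (x : ℝ) : ℝ := x * deriv F x - F x

/-- The class `H_m` of internal energy densities. -/
def HmClass (m : ℝ) (F : ℝ → ℝ) : Prop :=
  (m = 1 ∧ ∀ x, F x = x * Real.log x) ∨
  (1 < m ∧ StrictConvexOn ℝ (Set.Ici 0) F ∧
    Tendsto (fun x => F x / x) atTop atTop ∧
    F 0 = 0 ∧ deriv F 0 = 0 ∧
    (∃ C > 0, ∀ x : ℝ, 0 < x → C * x ^ (m - 2) ≤ deriv (deriv F) x) ∧
    (∃ C > 0, ∀ x : ℝ, 0 ≤ x → pressure F x ≤ C * (x + x ^ m)))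

/-- The internal energy functional `F(ρ) = ∫ F(ρ)` (`+∞` if `ρ` is not absolutely
continuous or the energy is not finite). -/
def FfuncE (F : ℝ → ℝ) (μ : Measure (Rn n)) : EReal :=
  if μ ≪ (volume : Measure (Rn n)) ∧ Integrable (fun x => F (dens μ x)) volume
  then ((∫ x, F (dens μ x) : ℝ) : EReal) else ⊤

/-- The potential energy functional `V(ρ|μ) = ∫ V[μ] ρ`. -/
def VfuncE (Vf : Rn n → ℝ) (μ : Measure (Rn n)) : EReal :=
  if Integrable Vf μ then ((∫ x, Vf x ∂μ : ℝ) : EReal) else ⊤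

/-- Tuples of probability measures. -/
def ProbTuple (l n : ℕ) : Set (Fin l → Measure (Rn n)) :=
  {ρ | ∀ j, IsProbabilityMeasure (ρ j)}

/-- `V[ρ]` is a `C²` function for every tuple of probability measures. -/
def VSmooth (V : (Fin l → Measure (Rn n)) → Rn n → ℝ) : Prop :=
  ∀ ρ ∈ ProbTuple l n, ContDiff ℝ 2 (V ρ)

/-- Hypothesis (H1): nonnegativity. -/
def VH1 (V : (Fin l → Measure (Rn n)) → Rn n → ℝ) : Prop :=
  ∀ ρ ∈ ProbTuple l n, ∀ x, 0 ≤ V ρ x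

/-- Hypothesis (H2): uniform bound on first and second derivatives. -/
def VH2 (C : ℝ) (V : (Fin l → Measure (Rn n)) → Rn n → ℝ) : Prop :=
  ∀ ρ ∈ ProbTuple l n, ∀ x,
    ‖gradient (V ρ) x‖ + ‖fderiv ℝ (fun y => gradient (V ρ) y) x‖ ≤ C

/-- Hypothesis (H3): Lipschitz dependence of `∇V[ρ]` on `ρ` w.r.t. `W₂`. -/
def VH3 (C : ℝ) (V : (Fin l → Measure (Rn n)) → Rn n → ℝ) : Prop :=
  ∀ ν ∈ ProbTuple l n, ∀ σ ∈ ProbTuple l n, ∀ x,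
    ‖gradient (V ν) x - gradient (V σ) x‖ ≤ C * ∑ j, W2 (ν j) (σ j)

/-- All the structural hypotheses on the interaction potentials. -/
def VHyp (V : Fin l → (Fin l → Measure (Rn n)) → Rn n → ℝ) : Prop :=
  (∀ i, VSmooth (V i)) ∧ (∀ i, VH1 (V i)) ∧
  (∃ C > 0, ∀ i, VH2 C (V i)) ∧ (∃ C > 0, ∀ i, VH3 C (V i))

/-- The semi-implicit JKO functional. -/
def JKOEnergy (h : ℝ) (F : ℝ → ℝ) (Vf : Rn n → ℝ) (μprev ρ : Measure (Rn n)) : EReal :=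
  ((W2 ρ μprev ^ 2 : ℝ) : EReal) + ((2 * h : ℝ) : EReal) * (FfuncE F ρ + VfuncE Vf ρ)

/-- The semi-implicit JKO scheme. -/
def JKOSeq (h : ℝ) (F : Fin l → ℝ → ℝ) (V : Fin l → (Fin l → Measure (Rn n)) → Rn n → ℝ)
    (ρ₀ : Fin l → Measure (Rn n)) (ρh : Fin l → ℕ → Measure (Rn n)) : Prop :=
  (∀ i, ρh i 0 = ρ₀ i) ∧
  ∀ i k, ρh i (k + 1) ∈ P2ac n ∧
    ∀ ρ ∈ P2ac n,
      JKOEnergy h (F i) (V i fun j => ρh j k) (ρh i k) (ρh i (k + 1)) ≤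
      JKOEnergy h (F i) (V i fun j => ρh j k) (ρh i k) ρ

/-- Piecewise-constant interpolation of the discrete scheme:
`ρ_h(t) = ρ_h^k` for `t ∈ ((k-1)h, kh]`. -/
def interp (h : ℝ) (ρh : ℕ → Measure (Rn n)) (t : ℝ) : Measure (Rn n) := ρh ⌈t / h⌉₊

/-- The Laplacian of a function on `ℝⁿ`. -/
def lap (f : Rn n → ℝ) (x : Rn n) : ℝ :=
  ∑ j : Fin n, iteratedFDeriv ℝ 2 f x
    ![EuclideanSpace.single j 1, EuclideanSpace.single j 1]

/-- Weak (distributional) gradient on `ℝⁿ`. -/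
def HasWeakGradient (f : Rn n → ℝ) (g : Rn n → Rn n) : Prop :=
  LocallyIntegrable f volume ∧ LocallyIntegrable g volume ∧
  ∀ φ : Rn n → ℝ, ContDiff ℝ (⊤ : ℕ∞) φ → HasCompactSupport φ → ∀ j : Fin n,
    ∫ x, f x * fderiv ℝ φ x (EuclideanSpace.single j 1) =
      - ∫ x, ⟪g x, EuclideanSpace.single j 1⟫ * φ x

/-- Spatial gradient of a space-time test function. -/
def spatialGrad (φ : ℝ × Rn n → ℝ) (t : ℝ) (x : Rn n) : Rn n :=
  gradient (fun y => φ (t, y)) x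

/-- Time derivative of a space-time test function. -/
def timeDeriv (φ : ℝ × Rn n → ℝ) (t : ℝ) (x : Rn n) : ℝ :=
  deriv (fun s => φ (s, x)) t

/-- Weak solution of the system on `ℝⁿ`. -/
def IsWeakSolution (F : Fin l → ℝ → ℝ) (α : Fin l → ℝ)
    (V : Fin l → (Fin l → Measure (Rn n)) → Rn n → ℝ)
    (ρ₀ : Fin l → Measure (Rn n)) (ρ : Fin l → ℝ → Measure (Rn n)) : Prop :=
  (∀ i t, 0 ≤ t → ρ i t ∈ P2ac n) ∧
  (∀ i, ρ i 0 = ρ₀ i) ∧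
  (∀ i t₀, 0 ≤ t₀ →
    Tendsto (fun t => W2 (ρ i t) (ρ i t₀)) (nhdsWithin t₀ (Ici 0)) (nhds 0)) ∧
  (∀ i T, 0 < T →
    ∫⁻ t in Ioo (0 : ℝ) T, ∫⁻ x, ENNReal.ofReal |pressure (F i) (dens (ρ i t) x)| < ⊤) ∧
  (∀ i, ∀ φ : ℝ × Rn n → ℝ, ContDiff ℝ (⊤ : ℕ∞) φ → HasCompactSupport φ →
    ∫ t in Ioi (0 : ℝ), ∫ x,
        ((timeDeriv φ t x -
            ⟪spatialGrad φ t x, gradient (V i fun j => ρ j t) x⟫) * dens (ρ i t) x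
          + α i * lap (fun y => φ (t, y)) x * pressure (F i) (dens (ρ i t) x)) =
      - ∫ x, φ (0, x) * dens (ρ₀ i) x)


/-! ### κ-flows and dissipation -/

/-- The curve `s ↦ S s ρ` is absolutely continuous on `ℝ⁺` w.r.t. `W₂`. -/
def ACCurve (S : ℝ → Measure (Rn n) → Measure (Rn n)) (ρ : Measure (Rn n)) : Prop :=
  ∃ g : ℝ → ℝ, (∀ a b : ℝ, 0 ≤ a → a ≤ b → IntervalIntegrable g volume a b) ∧
    ∀ a b : ℝ, 0 ≤ a → a ≤ b → W2 (S a ρ) (S b ρ) ≤ ∫ τ in a..b, g τ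

/-- Upper right Dini derivative (extended-real valued). -/
def dplus (f : ℝ → ℝ) (t : ℝ) : EReal :=
  limsup (fun s : ℝ => (((f s - f t) / (s - t) : ℝ) : EReal)) (nhdsWithin t (Ioi t))

/-- `S` is a `κ`-flow for the functional `Ψ` w.r.t. `W₂`. -/
def IsKappaFlow (κ : ℝ) (Ψ : Measure (Rn n) → EReal)
    (S : ℝ → Measure (Rn n) → Measure (Rn n)) : Prop :=
  (∀ ρ ∈ P2ac n, ∀ s : ℝ, 0 ≤ s → S s ρ ∈ P2ac n) ∧
  (∀ ρ ∈ P2ac n, S 0 ρ = ρ) ∧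
  (∀ ρ ∈ P2ac n, ∀ s t : ℝ, 0 ≤ s → 0 ≤ t → S (s + t) ρ = S s (S t ρ)) ∧
  (∀ ρ ∈ P2ac n, ACCurve S ρ) ∧
  (∀ ρ ∈ P2ac n, ∀ ρ' ∈ P2ac n, Ψ ρ' < ⊤ → ∀ s : ℝ, 0 < s →
    (((1 : ℝ) / 2 : ℝ) : EReal) * dplus (fun σ => W2 (S σ ρ) ρ' ^ 2) s
        + ((κ / 2 * W2 (S s ρ) ρ' ^ 2 : ℝ) : EReal) ≤ Ψ ρ' - Ψ (S s ρ))

/-- Dissipation of `F_i + V_i(·|μ)` along the flow `S`. -/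
def Diss (F : ℝ → ℝ) (Vf : Rn n → ℝ) (S : ℝ → Measure (Rn n) → Measure (Rn n))
    (ρ : Measure (Rn n)) : EReal :=
  limsup (fun s : ℝ => (((1 : ℝ) / s : ℝ) : EReal) *
      (FfuncE F ρ - FfuncE F (S s ρ) + (VfuncE Vf ρ - VfuncE Vf (S s ρ))))
    (nhdsWithin 0 (Ioi 0))

/-- Sequential lower semicontinuity w.r.t. `W₂` on `P₂^{ac}`. -/
def W2LSC (Ψ : Measure (Rn n) → EReal) : Prop :=
  ∀ ρ ∈ P2ac n, ∀ ρs : ℕ → Measure (Rn n), (∀ k, ρs k ∈ P2ac n) →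
    Tendsto (fun k => W2 (ρs k) ρ) atTop (nhds 0) →
    Ψ ρ ≤ liminf (fun k => Ψ (ρs k)) atTop

/-! ### Bounded domains -/

/-- Probability measures supported in `Ω`. -/
def POn (Ω : Set (Rn n)) : Set (Measure (Rn n)) :=
  {μ | IsProbabilityMeasure μ ∧ μ Ωᶜ = 0}

/-- Absolutely continuous probability measures supported in `Ω`. -/
def PacOn (Ω : Set (Rn n)) : Set (Measure (Rn n)) :=
  {μ | IsProbabilityMeasure μ ∧ μ ≪ (volume : Measure (Rn n)) ∧ μ Ωᶜ = 0}

/-- Internal energy on a domain `Ω`. -/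
def FfuncEOn (Ω : Set (Rn n)) (F : ℝ → ℝ) (μ : Measure (Rn n)) : EReal :=
  if μ ≪ (volume : Measure (Rn n)) ∧ IntegrableOn (fun x => F (dens μ x)) Ω volume
  then ((∫ x in Ω, F (dens μ x) : ℝ) : EReal) else ⊤

/-- The semi-implicit JKO functional on a domain `Ω`. -/
def JKOEnergyOn (Ω : Set (Rn n)) (h : ℝ) (F : ℝ → ℝ) (Vf : Rn n → ℝ)
    (μprev ρ : Measure (Rn n)) : EReal :=
  ((1 / (2 * h) * W2 ρ μprev ^ 2 : ℝ) : EReal) + FfuncEOn Ω F ρ + VfuncE Vf ρ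

/-- The semi-implicit JKO scheme on a domain `Ω` (single species). -/
def JKOSeqOn (Ω : Set (Rn n)) (h : ℝ) (F : ℝ → ℝ) (V : Measure (Rn n) → Rn n → ℝ)
    (ρ₀ : Measure (Rn n)) (ρh : ℕ → Measure (Rn n)) : Prop :=
  ρh 0 = ρ₀ ∧
  ∀ k, ρh (k + 1) ∈ POn Ω ∧
    ∀ ρ ∈ POn Ω,
      JKOEnergyOn Ω h F (V (ρh k)) (ρh k) (ρh (k + 1)) ≤
      JKOEnergyOn Ω h F (V (ρh k)) (ρh k) ρ

/-- Hypotheses (H1), (H2), (H3) for a single interaction potential on `Ω`. -/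
def VHypOn (Ω : Set (Rn n)) (V : Measure (Rn n) → Rn n → ℝ) : Prop :=
  (∀ μ ∈ POn Ω, ContDiff ℝ 2 (V μ)) ∧
  (∀ μ ∈ POn Ω, ∀ x, 0 ≤ V μ x) ∧
  (∃ C > 0, ∀ μ ∈ POn Ω, ∀ x,
    ‖gradient (V μ) x‖ + ‖fderiv ℝ (fun y => gradient (V μ) y) x‖ ≤ C) ∧
  (∃ C > 0, ∀ μ ∈ POn Ω, ∀ ν ∈ POn Ω, ∀ x,
    ‖gradient (V μ) x - gradient (V ν) x‖ ≤ C * W2 μ ν)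

/-- Weak (distributional) gradient on an open set `Ω`, together with `W^{1,1}`
integrability of the function and its gradient. -/
def HasWeakGradientOn (Ω : Set (Rn n)) (f : Rn n → ℝ) (g : Rn n → Rn n) : Prop :=
  IntegrableOn f Ω volume ∧ IntegrableOn g Ω volume ∧
  ∀ φ : Rn n → ℝ, ContDiff ℝ (⊤ : ℕ∞) φ → HasCompactSupport φ → tsupport φ ⊆ Ω →
    ∀ j : Fin n,
      ∫ x in Ω, f x * fderiv ℝ φ x (EuclideanSpace.single j 1) =
        - ∫ x in Ω, ⟪g x, EuclideanSpace.single j 1⟫ * φ x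


/-! ### Internal energy densities -/

/-- The properties of an internal energy density used by the direct method. -/
structure InternalDensity (F : ℝ → ℝ) : Prop where
  strictConvexOn : StrictConvexOn ℝ (Ici 0) F
  continuousOn : ContinuousOn F (Ici 0)
  superlinear : Tendsto (fun x => F x / x) atTop atTop
  entropy_le : ∃ A ≥ (0 : ℝ), ∃ B ≥ (0 : ℝ), ∀ t, 0 ≤ t →
    -A * t + B * min (t * Real.log t) 0 ≤ F t

/-- Where `deriv F` has a positive derivative, `F` is differentiable near the origin: the junk
value `0` of `deriv F` can be attained at one point at most. -/
lemma exists_deriv_ne_zero_of_deriv_deriv_pos {F : ℝ → ℝ}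
    (hF : ∀ x, 0 < x → 0 < deriv (deriv F) x) :
    ∃ ε : ℝ, 0 < ε ∧ ε ≤ 1 ∧ ∀ x, 0 < x → x < ε → deriv F x ≠ 0 := by
  have hmono : StrictMonoOn (deriv F) (Ioi 0) := by
    apply strictMonoOn_of_deriv_pos (convex_Ioi 0)
    · intro x hx
      exact (differentiableAt_of_deriv_ne_zero (hF x hx).ne').continuousAt.continuousWithinAt
    · intro x hx
      rw [interior_Ioi] at hx
      exact hF x hx
  by_cases hz : ∃ x₀, 0 < x₀ ∧ deriv F x₀ = 0
  · obtain ⟨x₀, h0, hx₀⟩ := hz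
    refine ⟨min x₀ 1, by positivity, min_le_right _ _, fun x hx hlt => ?_⟩
    have := hmono (mem_Ioi.2 hx) (mem_Ioi.2 h0) (hlt.trans_le (min_le_left _ _))
    rw [hx₀] at this
    exact this.ne
  · push Not at hz
    exact ⟨1, one_pos, le_rfl, fun x hx _ => hz x hx⟩

lemma mul_div_le_of_convexOn {F : ℝ → ℝ} (hF : ConvexOn ℝ (Ici 0) F) (h0 : F 0 = 0) {a x : ℝ}
    (ha : 0 < a) (hax : a ≤ x) : x * (F a / a) ≤ F x := by
  have := hF.secant_mono (a := 0) (x := a) (y := x) (by simp) (mem_Ici.2 ha.le)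
    (mem_Ici.2 (ha.le.trans hax)) ha.ne' (ha.trans_le hax).ne' hax
  rw [h0, sub_zero, sub_zero, sub_zero, sub_zero, le_div_iff₀ (ha.trans_le hax)] at this
  linarith

lemma entropy_le_of_pressure_le {m : ℝ} (hm : 1 < m) {F : ℝ → ℝ} (hconv : ConvexOn ℝ (Ici 0) F)
    (h0 : F 0 = 0) (hdd : ∀ x, 0 < x → 0 < deriv (deriv F) x) {C : ℝ} (hC : 0 < C)
    (hP : ∀ x : ℝ, 0 ≤ x → pressure F x ≤ C * (x + x ^ m)) :
    ∃ A ≥ (0 : ℝ), ∃ B ≥ (0 : ℝ), ∀ t, 0 ≤ t → -A * t + B * min (t * Real.log t) 0 ≤ F t := by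
  obtain ⟨ε, hε, hε1, hne⟩ := exists_deriv_ne_zero_of_deriv_deriv_pos hdd
  have hder : ∀ x, 0 < x → x < ε → HasDerivAt (fun x => F x / x - 2 * C * Real.log x)
      ((deriv F x * x - F x * 1) / x ^ 2 - 2 * C * x⁻¹) x := by
    intro x hx hxε
    exact ((differentiableAt_of_deriv_ne_zero (hne x hx hxε)).hasDerivAt.div
      (hasDerivAt_id' x) hx.ne').sub ((Real.hasDerivAt_log hx.ne').const_mul _)
  have hanti : AntitoneOn (fun x => F x / x - 2 * C * Real.log x) (Ioo 0 ε) := by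
    apply antitoneOn_of_deriv_nonpos (convex_Ioo 0 ε)
    · exact fun x hx => (hder x hx.1 hx.2).continuousAt.continuousWithinAt
    · rw [interior_Ioo]
      exact fun x hx => (hder x hx.1 hx.2).differentiableAt.differentiableWithinAt
    · rw [interior_Ioo]
      intro x hx
      rw [(hder x hx.1 hx.2).deriv]
      have hx0 := hx.1
      have hp : x ^ m ≤ x := by
        simpa using Real.rpow_le_rpow_of_exponent_ge hx.1 (hx.2.le.trans hε1) hm.le
      have h1 := hP x hx.1.le
      unfold pressure at h1
      have h2 : deriv F x * x - F x * 1 ≤ 2 * C * x := by nlinarith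
      rw [sub_nonpos, div_le_iff₀ (by positivity)]
      calc _ ≤ 2 * C * x := h2
        _ = 2 * C * x⁻¹ * x ^ 2 := by field_simp
  set a := ε / 2 with ha
  have ha0 : 0 < a := by positivity
  refine ⟨|F a / a| + |F a / a - 2 * C * Real.log a|, by positivity, 2 * C, by positivity,
    fun t ht => ?_⟩
  rcases ht.eq_or_lt with rfl | ht
  · simp [h0]
  have e1 := neg_abs_le (F a / a)
  have e2 := neg_abs_le (F a / a - 2 * C * Real.log a)
  have e3 := abs_nonneg (F a / a)
  have e4 := abs_nonneg (F a / a - 2 * C * Real.log a)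
  rcases le_total a t with hat | hta
  · have h1 := mul_div_le_of_convexOn hconv h0 ha0 hat
    have h2 : min (t * Real.log t) 0 ≤ 0 := min_le_right _ _
    nlinarith
  · have h1 := hanti ⟨ht, by linarith⟩ ⟨ha0, by linarith⟩ hta
    have h2 : min (t * Real.log t) 0 ≤ t * Real.log t := min_le_left _ _
    simp only at h1
    have h3 : F t = t * (F t / t) := by field_simp
    rw [h3]
    nlinarith

lemma continuousOn_of_entropy_le {F : ℝ → ℝ} (hconv : ConvexOn ℝ (Ici 0) F) (h0 : F 0 = 0)
    {A B : ℝ} (hlow : ∀ t, 0 ≤ t → -A * t + B * min (t * Real.log t) 0 ≤ F t) :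
    ContinuousOn F (Ici 0) := by
  intro x hx
  rcases (mem_Ici.1 hx).eq_or_lt with rfl | hx
  · unfold ContinuousWithinAt
    rw [h0]
    have hlo : Tendsto (fun t : ℝ => -A * t + B * min (t * Real.log t) 0) (𝓝[Ici 0] 0) (𝓝 0) := by
      have : Continuous (fun t : ℝ => -A * t + B * min (t * Real.log t) 0) := by
        have := Real.continuous_mul_log
        fun_prop
      simpa using (this.tendsto 0).mono_left nhdsWithin_le_nhds
    have hup : Tendsto (fun t : ℝ => t * F 1) (𝓝[Ici 0] 0) (𝓝 0) := by
      have : Continuous (fun t : ℝ => t * F 1) := by fun_prop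
      simpa using (this.tendsto 0).mono_left nhdsWithin_le_nhds
    refine tendsto_of_tendsto_of_tendsto_of_le_of_le' hlo hup ?_ ?_
    · filter_upwards [self_mem_nhdsWithin] with t ht using hlow t ht
    · filter_upwards [self_mem_nhdsWithin, nhdsWithin_le_nhds (Iio_mem_nhds one_pos)] with t ht ht1
      rcases (mem_Ici.1 ht).eq_or_lt with rfl | ht0
      · simp [h0]
      have h1 := mul_div_le_of_convexOn hconv h0 ht0 (le_of_lt ht1)
      rw [one_mul, div_le_iff₀ ht0] at h1
      linarith
  · have := hconv.continuousOn_interior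
    rw [interior_Ici] at this
    exact (this.continuousAt (Ioi_mem_nhds hx)).continuousWithinAt

lemma HmClass.internalDensity {m : ℝ} {F : ℝ → ℝ} (hF : HmClass m F) : InternalDensity F := by
  rcases hF with ⟨-, hF⟩ | ⟨hm, hconv, hsup, h0, -, ⟨c, hc, hdd⟩, C, hC, hP⟩
  · obtain rfl : F = fun x => x * Real.log x := funext hF
    refine ⟨Real.strictConvexOn_mul_log, Real.continuous_mul_log.continuousOn, ?_, 0, le_rfl, 1,
      zero_le_one, fun t _ => by simp⟩
    refine Real.tendsto_log_atTop.congr' ?_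
    filter_upwards [eventually_gt_atTop 0] with x hx
    field_simp
  · have hdd' : ∀ x, 0 < x → 0 < deriv (deriv F) x := fun x hx =>
      (by positivity : 0 < c * x ^ (m - 2)).trans_le (hdd x hx)
    have hlow := entropy_le_of_pressure_le hm hconv.convexOn h0 hdd' hC hP
    obtain ⟨A, -, B, -, hAB⟩ := id hlow
    exact ⟨hconv, continuousOn_of_entropy_le hconv.convexOn h0 hAB, hsup, hlow⟩

/-- An integrable positive weight on `ℝⁿ`. -/
def decayWeight (n : ℕ) (x : Rn n) : ℝ := (1 + ‖x‖) ^ (-((n : ℝ) + 1))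

lemma decayWeight_nonneg (x : Rn n) : 0 ≤ decayWeight n x := by
  unfold decayWeight; positivity

lemma integrable_decayWeight : Integrable (decayWeight n) volume :=
  integrable_one_add_norm (by simp)

lemma neg_mul_sub_decayWeight_le_mul_log (x : Rn n) {t : ℝ} (ht : 0 ≤ t) :
    -((n : ℝ) + 1) * ‖x‖ * t - decayWeight n x ≤ t * Real.log t := by
  rcases ht.eq_or_lt with rfl | ht
  · simpa using decayWeight_nonneg x
  have hx : 0 < 1 + ‖x‖ := by positivity
  have hw : decayWeight n x = Real.exp (-((n : ℝ) + 1) * Real.log (1 + ‖x‖)) := by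
    unfold decayWeight; rw [Real.rpow_def_of_pos hx]; congr 1; ring
  have h1 := Real.add_one_le_exp (-((n : ℝ) + 1) * Real.log (1 + ‖x‖) - Real.log t)
  rw [Real.exp_sub, Real.exp_log ht, ← hw, le_div_iff₀ ht] at h1
  have h2 : Real.log (1 + ‖x‖) ≤ ‖x‖ := by
    have := Real.log_le_sub_one_of_pos hx; linarith
  have h3 : ((n : ℝ) + 1) * t * Real.log (1 + ‖x‖) ≤ ((n : ℝ) + 1) * t * ‖x‖ := by gcongr
  nlinarith

/-- The affine function of the density that compensates the negative part of the internal
energy. -/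
def compensator (x : Rn n) (t : ℝ) : ℝ := (1 + ‖x‖) * t + decayWeight n x

lemma InternalDensity.exists_add_compensator_nonneg {F : ℝ → ℝ} (hF : InternalDensity F) (n : ℕ) :
    ∃ K : ℝ, 0 ≤ K ∧ ∀ (x : Rn n) t, 0 ≤ t → 0 ≤ F t + K * compensator x t := by
  obtain ⟨A, hA, B, hB, hlow⟩ := hF.entropy_le
  refine ⟨A + B * (n + 1), by positivity, fun x t ht => ?_⟩
  have hw := decayWeight_nonneg x
  have h1 : -((n : ℝ) + 1) * ‖x‖ * t - decayWeight n x ≤ min (t * Real.log t) 0 := by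
    refine le_min (neg_mul_sub_decayWeight_le_mul_log x ht) ?_
    have : 0 ≤ ((n : ℝ) + 1) * ‖x‖ * t := by positivity
    linarith
  have h2 := mul_le_mul_of_nonneg_left h1 hB
  have h3 := hlow t ht
  have e1 : 0 ≤ A * (‖x‖ * t) := by positivity
  have e2 : 0 ≤ A * decayWeight n x := by positivity
  have e3 : 0 ≤ B * n * t := by positivity
  have e4 : 0 ≤ B * n * decayWeight n x := by positivity
  have e5 : 0 ≤ B * t := by positivity
  unfold compensator
  nlinarith

/-! ### The midpoint convexity gap -/

/-- The midpoint convexity gap of `F`. -/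
def convexGap (F : ℝ → ℝ) (s t : ℝ) : ℝ := (F s + F t) / 2 - F ((s + t) / 2)

lemma InternalDensity.midpoint_le {F : ℝ → ℝ} (hF : InternalDensity F) {s t : ℝ} (hs : 0 ≤ s)
    (ht : 0 ≤ t) : F ((s + t) / 2) ≤ (F s + F t) / 2 := by
  have := hF.strictConvexOn.convexOn.2 (mem_Ici.2 hs) (mem_Ici.2 ht)
    (show (0 : ℝ) ≤ 1 / 2 by norm_num) (show (0 : ℝ) ≤ 1 / 2 by norm_num) (by norm_num)
  simp only [smul_eq_mul] at this
  rw [show (s + t) / 2 = 1 / 2 * s + 1 / 2 * t by ring]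
  linarith

lemma InternalDensity.convexGap_nonneg {F : ℝ → ℝ} (hF : InternalDensity F) {s t : ℝ} (hs : 0 ≤ s)
    (ht : 0 ≤ t) : 0 ≤ convexGap F s t :=
  sub_nonneg.2 (hF.midpoint_le hs ht)

lemma InternalDensity.convexGap_pos {F : ℝ → ℝ} (hF : InternalDensity F) {s t : ℝ} (hs : 0 ≤ s)
    (ht : 0 ≤ t) (hst : s ≠ t) : 0 < convexGap F s t := by
  have := hF.strictConvexOn.2 (mem_Ici.2 hs) (mem_Ici.2 ht) hst
    (show (0 : ℝ) < 1 / 2 by norm_num) (show (0 : ℝ) < 1 / 2 by norm_num) (by norm_num)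
  simp only [smul_eq_mul] at this
  unfold convexGap
  rw [show (s + t) / 2 = 1 / 2 * s + 1 / 2 * t by ring]
  linarith

lemma InternalDensity.abs_sub_le_of_le {F : ℝ → ℝ} (hF : InternalDensity F) (L : ℝ) {ε : ℝ}
    (hε : 0 < ε) : ∃ c : ℝ, 0 ≤ c ∧ ∀ s t, 0 ≤ s → s ≤ L → 0 ≤ t → t ≤ L →
      |s - t| ≤ ε + c * convexGap F s t := by
  set S : Set (ℝ × ℝ) := (Icc 0 L ×ˢ Icc 0 L) ∩ {p | ε ≤ |p.1 - p.2|} with hS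
  have hcomp : IsCompact S := (isCompact_Icc.prod isCompact_Icc).inter_right
    (isClosed_le continuous_const (by fun_prop))
  have hcont : ContinuousOn (fun p : ℝ × ℝ => convexGap F p.1 p.2) S := by
    unfold convexGap
    refine ContinuousOn.sub (ContinuousOn.div_const (ContinuousOn.add ?_ ?_) _) ?_
    · exact hF.continuousOn.comp continuous_fst.continuousOn fun p hp => hp.1.1.1
    · exact hF.continuousOn.comp continuous_snd.continuousOn fun p hp => hp.1.2.1
    · refine hF.continuousOn.comp (f := fun p : ℝ × ℝ => (p.1 + p.2) / 2) (by fun_prop)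
        fun p hp => ?_
      have h1 := hp.1.1.1
      have h2 := hp.1.2.1
      simp only [mem_Ici]
      positivity
  rcases S.eq_empty_or_nonempty with hem | hne
  · refine ⟨0, le_rfl, fun s t hs hsL ht htL => ?_⟩
    by_contra! hlt
    have : (s, t) ∈ S := ⟨⟨⟨hs, hsL⟩, ht, htL⟩, by simp only [mem_ofPred_eq]; linarith⟩
    simp [hem] at this
  · obtain ⟨p, hp, hmin⟩ := hcomp.exists_isMinOn hne hcont
    have hpos : 0 < convexGap F p.1 p.2 := by
      refine hF.convexGap_pos hp.1.1.1 hp.1.2.1 fun heq => ?_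
      have := hp.2
      simp only [mem_ofPred_eq, heq, sub_self, abs_zero] at this
      linarith
    have hL : 0 ≤ L := hp.1.1.1.trans hp.1.1.2
    refine ⟨L / convexGap F p.1 p.2, by positivity, fun s t hs hsL ht htL => ?_⟩
    have hg := hF.convexGap_nonneg hs ht
    by_cases hst : ε ≤ |s - t|
    · have h1 : convexGap F p.1 p.2 ≤ convexGap F s t :=
        hmin (show (s, t) ∈ S from ⟨⟨⟨hs, hsL⟩, ht, htL⟩, hst⟩)
      have h2 : |s - t| ≤ L := abs_le.2 ⟨by linarith, by linarith⟩
      have h3 : L ≤ L / convexGap F p.1 p.2 * convexGap F s t := by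
        rw [div_mul_eq_mul_div, le_div_iff₀ hpos]
        gcongr
      linarith
    · have : 0 ≤ L / convexGap F p.1 p.2 * convexGap F s t := by positivity
      linarith

/-- The distance of two densities is controlled by their energies and the convexity gap. -/
lemma InternalDensity.abs_sub_le {F : ℝ → ℝ} (hF : InternalDensity F) {η ε : ℝ} (hη : 0 < η)
    (hε : 0 < ε) : ∃ c : ℝ, 0 ≤ c ∧ ∀ s t a b, 0 ≤ s → 0 ≤ t → 0 ≤ a → 0 ≤ b → F s ≤ a → F t ≤ b →
      |s - t| ≤ η * (a + b) + ε + c * convexGap F s t := by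
  obtain ⟨L, hL⟩ := (hF.superlinear.eventually_ge_atTop (1 / η)).exists_forall_of_atTop
  obtain ⟨c, hc, h⟩ := hF.abs_sub_le_of_le (max L 1) hε
  refine ⟨c, hc, fun s t a b hs ht ha hb hsa htb => ?_⟩
  have hg := mul_nonneg hc (hF.convexGap_nonneg hs ht)
  have hab : 0 ≤ η * (a + b) := by positivity
  have key : ∀ r d, max L 1 < r → F r ≤ d → r ≤ η * d := by
    intro r d hr hd
    have hr0 : 0 < r := lt_trans one_pos ((le_max_right L 1).trans_lt hr)
    have := hL r ((le_max_left L 1).trans hr.le)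
    rw [div_le_div_iff₀ hη hr0] at this
    nlinarith
  have habs : |s - t| ≤ max s t := abs_le.2
    ⟨by linarith [le_max_right s t], by linarith [le_max_left s t]⟩
  by_cases h1 : max L 1 < s
  · have h2 := key s a h1 hsa
    rcases le_total t s with hts | hst
    · rw [max_eq_left hts] at habs
      nlinarith
    · have h3 := key t b (h1.trans_le hst) htb
      rw [max_eq_right hst] at habs
      nlinarith
  · by_cases h2 : max L 1 < t
    · have h3 := key t b h2 htb
      rw [max_eq_right ((not_lt.1 h1).trans h2.le)] at habs
      nlinarith
    · have := h s t hs (not_lt.1 h1) ht (not_lt.1 h2)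
      linarith

/-! ### Convergence in weighted `L¹` -/

lemma one_add_norm_le_sq_add_indicator (x : Rn n) {R z : ℝ} (hR : 1 ≤ R) (hz : 0 ≤ z) :
    (1 + ‖x‖) * z ≤ 2 / R * (‖x‖ ^ 2 * z) +
      (Metric.closedBall (0 : Rn n) R).indicator (fun _ => (1 + R) * z) x := by
  have hR0 : 0 < R := by linarith
  by_cases hx : x ∈ Metric.closedBall (0 : Rn n) R
  · rw [indicator_of_mem hx]
    rw [mem_closedBall_zero_iff] at hx
    have : 0 ≤ 2 / R * (‖x‖ ^ 2 * z) := by positivity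
    nlinarith
  · rw [indicator_of_notMem hx, add_zero]
    rw [mem_closedBall_zero_iff, not_le] at hx
    rw [← mul_assoc]
    refine mul_le_mul_of_nonneg_right ?_ hz
    rw [div_mul_eq_mul_div, le_div_iff₀ hR0]
    nlinarith

lemma integral_one_add_norm_mul_abs_sub_le {F : ℝ → ℝ} (hF : InternalDensity F) {K : ℝ}
    (hK : ∀ (x : Rn n) t, 0 ≤ t → 0 ≤ F t + K * compensator x t) (hK0 : 0 ≤ K) {M ε : ℝ}
    (hM : 0 ≤ M) (hε : 0 < ε) : ∃ δ > 0, ∀ u v : Rn n → ℝ, (∀ x, 0 ≤ u x) → (∀ x, 0 ≤ v x) →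
      Integrable (fun x => ‖x‖ ^ 2 * u x) → Integrable (fun x => ‖x‖ ^ 2 * v x) →
      ∫ x, ‖x‖ ^ 2 * u x ≤ M → ∫ x, ‖x‖ ^ 2 * v x ≤ M →
      Integrable (fun x => F (u x) + K * compensator x (u x)) →
      Integrable (fun x => F (v x) + K * compensator x (v x)) →
      ∫ x, (F (u x) + K * compensator x (u x)) ≤ M →
      ∫ x, (F (v x) + K * compensator x (v x)) ≤ M →
      Integrable (fun x => convexGap F (u x) (v x)) → ∫ x, convexGap F (u x) (v x) ≤ δ →
      ∫ x, (1 + ‖x‖) * |u x - v x| ≤ ε := by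
  set R : ℝ := 16 * M / ε + 1 with hRdef
  have hR : 1 ≤ R := by rw [hRdef]; linarith [show 0 ≤ 16 * M / ε by positivity]
  have hR0 : 0 < R := by linarith
  set vol : ℝ := (volume (Metric.closedBall (0 : Rn n) R)).toReal with hvol
  have hvol0 : 0 ≤ vol := ENNReal.toReal_nonneg
  set η : ℝ := ε / (8 * (1 + R) * (M + 1)) with hη
  have hη0 : 0 < η := by positivity
  set ε' : ℝ := ε / (4 * (1 + R) * (vol + 1)) with hε'
  have hε'0 : 0 < ε' := by positivity
  obtain ⟨c, hc, hmain⟩ := hF.abs_sub_le hη0 hε'0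
  refine ⟨ε / (4 * (1 + R) * (c + 1)), by positivity, ?_⟩
  intro u v hu hv hu2 hv2 huM hvM hFu hFv hFuM hFvM hg hgδ
  have hcomp : ∀ (x : Rn n) t, 0 ≤ t → 0 ≤ K * compensator x t := fun x t ht => by
    have := decayWeight_nonneg x
    unfold compensator
    positivity
  have hpt : ∀ x, (1 + ‖x‖) * |u x - v x| ≤
      2 / R * (‖x‖ ^ 2 * u x + ‖x‖ ^ 2 * v x) +
      (((1 + R) * (η * ((F (u x) + K * compensator x (u x)) + (F (v x) + K * compensator x (v x))))
        + (Metric.closedBall (0 : Rn n) R).indicator (fun _ => (1 + R) * ε') x)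
        + (1 + R) * (c * convexGap F (u x) (v x))) := by
    intro x
    refine (one_add_norm_le_sq_add_indicator x hR (abs_nonneg _)).trans ?_
    have a1 := hK x _ (hu x)
    have a2 := hK x _ (hv x)
    have a3 := hF.convexGap_nonneg (hu x) (hv x)
    have a4 := hmain _ _ _ _ (hu x) (hv x) a1 a2
      (le_add_of_nonneg_right (hcomp x _ (hu x))) (le_add_of_nonneg_right (hcomp x _ (hv x)))
    have a5 : |u x - v x| ≤ u x + v x := abs_le.2
      ⟨by linarith [hu x, hv x], by linarith [hu x, hv x]⟩
    refine add_le_add ?_ ?_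
    · rw [← mul_add]
      gcongr
    · by_cases hx : x ∈ Metric.closedBall (0 : Rn n) R
      · rw [indicator_of_mem hx, indicator_of_mem hx, ← mul_add, ← mul_add]
        gcongr
      · rw [indicator_of_notMem hx, indicator_of_notMem hx]
        positivity
  have hball : Integrable ((Metric.closedBall (0 : Rn n) R).indicator fun _ => (1 + R) * ε')
      volume := by
    rw [integrable_indicator_iff measurableSet_closedBall]
    exact integrableOn_const (isCompact_closedBall _ _).measure_lt_top.ne
  have i1 := (hu2.add hv2).const_mul (2 / R)
  have i2 := ((hFu.add hFv).const_mul η).const_mul (1 + R)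
  have i3 := (hg.const_mul c).const_mul (1 + R)
  have i4 : Integrable (fun x => (1 + R) *
      (η * ((F (u x) + K * compensator x (u x)) + (F (v x) + K * compensator x (v x)))) +
      (Metric.closedBall (0 : Rn n) R).indicator (fun _ => (1 + R) * ε') x) := i2.add hball
  have i5 := i4.add i3
  refine (integral_mono_of_nonneg (Eventually.of_forall fun x => by positivity)
    (i1.add i5) (Eventually.of_forall hpt)).trans ?_
  simp only [Pi.add_def] at i1 i2 i5 ⊢
  rw [integral_add i1 i5, integral_add i4 i3,
    integral_add i2 hball, integral_const_mul, integral_const_mul, integral_const_mul,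
    integral_const_mul, integral_const_mul, integral_add hu2 hv2, integral_add hFu hFv,
    integral_indicator measurableSet_closedBall, setIntegral_const, smul_eq_mul, Measure.real,
    ← hvol]
  have b1 : 2 / R * ((∫ x, ‖x‖ ^ 2 * u x) + ∫ x, ‖x‖ ^ 2 * v x) ≤ ε / 4 := by
    calc _ ≤ 2 / R * (M + M) := by gcongr
      _ ≤ ε / 4 := by
        rw [div_mul_eq_mul_div, div_le_iff₀ hR0, hRdef]
        field_simp
        nlinarith
  have b2 : (1 + R) * (η * ((∫ x, F (u x) + K * compensator x (u x)) +
      ∫ x, F (v x) + K * compensator x (v x))) ≤ ε / 4 := by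
    calc _ ≤ (1 + R) * (η * (M + M)) := by gcongr
      _ ≤ (1 + R) * (η * (2 * (M + 1))) := by gcongr; linarith
      _ = ε / 4 := by rw [hη]; field_simp; norm_num
  have b3 : vol * ((1 + R) * ε') ≤ ε / 4 := by
    calc _ ≤ (vol + 1) * ((1 + R) * ε') := by gcongr; linarith
      _ = ε / 4 := by rw [hε']; field_simp
  have b4 : (1 + R) * (c * ∫ x, convexGap F (u x) (v x)) ≤ ε / 4 := by
    calc _ ≤ (1 + R) * ((c + 1) * (ε / (4 * (1 + R) * (c + 1)))) := by
          have : 0 ≤ ∫ x, convexGap F (u x) (v x) :=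
            integral_nonneg fun x => hF.convexGap_nonneg (hu x) (hv x)
          gcongr
          linarith
      _ = ε / 4 := by field_simp
  linarith

/-! ### The quadratic transport cost -/

lemma measurable_nnnorm_sq : Measurable fun x : Rn n => (‖x‖₊ : ℝ≥0∞) ^ 2 := by fun_prop

lemma nnnorm_sub_sq_le (x y : Rn n) :
    (‖x - y‖₊ : ℝ≥0∞) ^ 2 ≤ 2 * (‖x‖₊ : ℝ≥0∞) ^ 2 + 2 * (‖y‖₊ : ℝ≥0∞) ^ 2 := by
  have h : ‖x - y‖₊ ^ 2 ≤ 2 * ‖x‖₊ ^ 2 + 2 * ‖y‖₊ ^ 2 := by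
    rw [← NNReal.coe_le_coe]
    push_cast
    have := norm_sub_le x y
    have h0 := norm_nonneg (x - y)
    nlinarith [sq_nonneg (‖x‖ - ‖y‖)]
  exact_mod_cast h

lemma transportCost_le_two_mul_M2 (γ : Measure (Rn n × Rn n)) :
    transportCost γ ≤ 2 * M2 (γ.map Prod.fst) + 2 * M2 (γ.map Prod.snd) := by
  unfold transportCost M2
  rw [lintegral_map measurable_nnnorm_sq measurable_fst,
    lintegral_map measurable_nnnorm_sq measurable_snd, ← lintegral_const_mul _ (by fun_prop),
    ← lintegral_const_mul _ (by fun_prop), ← lintegral_add_left (by fun_prop)]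
  exact lintegral_mono fun p => nnnorm_sub_sq_le _ _

lemma M2_map_fst_le (γ : Measure (Rn n × Rn n)) :
    M2 (γ.map Prod.fst) ≤ 2 * transportCost γ + 2 * M2 (γ.map Prod.snd) := by
  unfold transportCost M2
  rw [lintegral_map measurable_nnnorm_sq measurable_fst,
    lintegral_map measurable_nnnorm_sq measurable_snd, ← lintegral_const_mul _ (by fun_prop),
    ← lintegral_const_mul _ (by fun_prop), ← lintegral_add_left (by fun_prop)]
  refine lintegral_mono fun p => ?_
  simpa using nnnorm_sub_sq_le (p.1 - p.2) (-p.2)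

lemma transportCost_add (γ γ' : Measure (Rn n × Rn n)) :
    transportCost (γ + γ') = transportCost γ + transportCost γ' :=
  lintegral_add_measure _ _ _

lemma prod_mem_couplings (ρ μ : Measure (Rn n)) [IsProbabilityMeasure ρ]
    [IsProbabilityMeasure μ] : ρ.prod μ ∈ couplings ρ μ :=
  ⟨inferInstance, by simp, by simp⟩

lemma W2e_lt_top {ρ μ : Measure (Rn n)} [IsProbabilityMeasure ρ] [IsProbabilityMeasure μ]
    (hρ : M2 ρ < ⊤) (hμ : M2 μ < ⊤) : W2e ρ μ < ⊤ := by
  refine (iInf₂_le _ (prod_mem_couplings ρ μ)).trans_lt ?_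
  refine (transportCost_le_two_mul_M2 _).trans_lt ?_
  simp only [Measure.map_fst_prod, Measure.map_snd_prod, measure_univ, one_smul]
  exact ENNReal.add_lt_top.2 ⟨ENNReal.mul_lt_top (by simp) hρ, ENNReal.mul_lt_top (by simp) hμ⟩

lemma M2_le_W2e (ρ μ : Measure (Rn n)) : M2 ρ ≤ 2 * W2e ρ μ + 2 * M2 μ := by
  rw [← tsub_le_iff_right, mul_comm 2 (W2e ρ μ), ← ENNReal.div_le_iff (by simp) (by simp)]
  refine le_iInf₂ fun γ hγ => ?_
  rw [ENNReal.div_le_iff (by simp) (by simp), tsub_le_iff_right, ← hγ.2.1, ← hγ.2.2, mul_comm _ 2]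
  exact M2_map_fst_le γ

lemma two_mul_W2e_midpoint_le (ρ σ μ : Measure (Rn n)) :
    2 * W2e ((2⁻¹ : ℝ≥0∞) • (ρ + σ)) μ ≤ W2e ρ μ + W2e σ μ := by
  have key : ∀ γ ∈ couplings ρ μ, ∀ γ' ∈ couplings σ μ,
      2 * W2e ((2⁻¹ : ℝ≥0∞) • (ρ + σ)) μ ≤ transportCost γ + transportCost γ' := by
    intro γ hγ γ' hγ'
    have := hγ.1
    have := hγ'.1
    have hmem : (2⁻¹ : ℝ≥0∞) • (γ + γ') ∈ couplings ((2⁻¹ : ℝ≥0∞) • (ρ + σ)) μ := by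
      refine ⟨⟨?_⟩, ?_, ?_⟩
      · simp [ENNReal.inv_two_add_inv_two]
      · rw [Measure.map_smul, Measure.map_add _ _ measurable_fst, hγ.2.1, hγ'.2.1]
      · rw [Measure.map_smul, Measure.map_add _ _ measurable_snd, hγ.2.2, hγ'.2.2, ← two_smul ℝ≥0∞,
          smul_smul, ENNReal.inv_mul_cancel (by simp) (by simp), one_smul]
    have hle : W2e ((2⁻¹ : ℝ≥0∞) • (ρ + σ)) μ ≤ transportCost ((2⁻¹ : ℝ≥0∞) • (γ + γ')) :=
      iInf₂_le _ hmem
    have heq : transportCost ((2⁻¹ : ℝ≥0∞) • (γ + γ')) =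
        2⁻¹ * (transportCost γ + transportCost γ') := by
      rw [← transportCost_add]
      exact lintegral_smul_measure _ _
    calc _ ≤ 2 * (2⁻¹ * (transportCost γ + transportCost γ')) := by rw [← heq]; gcongr
      _ = _ := by rw [← mul_assoc, ENNReal.mul_inv_cancel (by simp) (by simp), one_mul]
  rw [← tsub_le_iff_right]
  refine le_iInf₂ fun γ hγ => ?_
  rw [tsub_le_iff_left, ← tsub_le_iff_right]
  refine le_iInf₂ fun γ' hγ' => ?_
  rw [tsub_le_iff_left]
  exact key γ hγ γ' hγ'

/-- Replacing the first marginal `κ + β` by `κ + α` costs at most the transport of `α` onto a part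
of the second marginal. -/
lemma exists_W2e_le_transportCost_add {κ α β μ : Measure (Rn n)} [IsProbabilityMeasure (κ + α)]
    {γ : Measure (Rn n × Rn n)} (hγ : γ ∈ couplings (κ + β) μ) :
    ∃ ν ≤ μ, ν univ = α univ ∧
      W2e (κ + α) μ ≤ transportCost γ + (2 * M2 α + 2 * M2 ν) := by
  obtain ⟨hγp, hγ1, hγ2⟩ := hγ
  have hκβ : IsProbabilityMeasure (κ + β) := by
    rw [← hγ1]; exact Measure.isProbabilityMeasure_map measurable_fst.aemeasurable
  have hμ : IsProbabilityMeasure μ := by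
    rw [← hγ2]; exact Measure.isProbabilityMeasure_map measurable_snd.aemeasurable
  have hκf : IsFiniteMeasure κ := isFiniteMeasure_of_le (κ + α) (Measure.le_add_right le_rfl)
  have hαf : IsFiniteMeasure α := isFiniteMeasure_of_le (κ + α) (Measure.le_add_left le_rfl)
  have hβf : IsFiniteMeasure β := isFiniteMeasure_of_le (κ + β) (Measure.le_add_left le_rfl)
  have hσ : SigmaFinite (κ + β) := IsFiniteMeasure.toSigmaFinite _
  have hκle : κ ≤ κ + β := Measure.le_add_right le_rfl
  set θ : Rn n → ℝ≥0∞ := κ.rnDeriv (κ + β) with hθ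
  have hθm : Measurable θ := Measure.measurable_rnDeriv _ _
  have hθκ : (κ + β).withDensity θ = κ :=
    Measure.withDensity_rnDeriv_eq κ (κ + β) (Measure.absolutelyContinuous_of_le hκle)
  have hθ1 : ∀ᵐ x ∂(κ + β), θ x ≤ 1 := Measure.rnDeriv_le_one_of_le hκle
  set γ₁ : Measure (Rn n × Rn n) := γ.withDensity fun p => θ p.1 with hγ₁
  have hγ₁le : γ₁ ≤ γ := by
    conv_rhs => rw [← withDensity_one (μ := γ)]
    refine withDensity_mono ?_
    rw [← hγ1] at hθ1
    exact ae_of_ae_map measurable_fst.aemeasurable hθ1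
  have hγ₁f : IsFiniteMeasure γ₁ := isFiniteMeasure_of_le γ hγ₁le
  have hfst : γ₁.map Prod.fst = κ := by
    rw [← hθκ, ← hγ1]
    ext s hs
    rw [Measure.map_apply measurable_fst hs, withDensity_apply _ (measurable_fst hs),
      withDensity_apply _ hs, setLIntegral_map hs hθm measurable_fst]
  set ν : Measure (Rn n) := (γ - γ₁).map Prod.snd with hν
  have hsum : ν + γ₁.map Prod.snd = μ := by
    rw [hν, ← Measure.map_add _ _ measurable_snd, Measure.sub_add_cancel_of_le hγ₁le, hγ2]
  have hνle : ν ≤ μ := by rw [← hsum]; exact Measure.le_add_right le_rfl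
  have hνf : IsFiniteMeasure ν := isFiniteMeasure_of_le μ hνle
  have hmass : ν univ = α univ := by
    have h1 : κ univ + α univ = 1 := by rw [← Measure.add_apply]; exact measure_univ
    have h2 : ν univ + γ₁.map Prod.snd univ = 1 := by
      rw [← Measure.add_apply, hsum]; exact measure_univ
    have h3 : γ₁.map Prod.snd univ = κ univ := by
      rw [← hfst, Measure.map_apply measurable_snd .univ, Measure.map_apply measurable_fst .univ]
      simp
    rw [h3, add_comm] at h2
    exact (ENNReal.add_right_inj (measure_ne_top κ univ)).1 (h2.trans h1.symm)
  refine ⟨ν, hνle, hmass, ?_⟩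
  obtain ⟨τ, hτ1, hτ2⟩ : ∃ τ : Measure (Rn n × Rn n), τ.map Prod.fst = α ∧ τ.map Prod.snd = ν := by
    by_cases h0 : α univ = 0
    · refine ⟨0, ?_, ?_⟩
      · rw [Measure.map_zero, Measure.measure_univ_eq_zero.1 h0]
      · rw [Measure.map_zero, Measure.measure_univ_eq_zero.1 (hmass.trans h0)]
    · refine ⟨(α univ)⁻¹ • α.prod ν, ?_, ?_⟩
      · rw [Measure.map_smul, Measure.map_fst_prod, hmass, smul_smul,
          ENNReal.inv_mul_cancel h0 (measure_ne_top _ _), one_smul]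
      · rw [Measure.map_smul, Measure.map_snd_prod, smul_smul,
          ENNReal.inv_mul_cancel h0 (measure_ne_top _ _), one_smul]
  have h1 : (γ₁ + τ).map Prod.fst = κ + α := by
    rw [Measure.map_add _ _ measurable_fst, hfst, hτ1]
  have hmem : γ₁ + τ ∈ couplings (κ + α) μ := by
    refine ⟨?_, h1, ?_⟩
    · constructor
      rw [← measure_univ (μ := κ + α), ← h1, Measure.map_apply measurable_fst .univ, preimage_univ]
    · rw [Measure.map_add _ _ measurable_snd, hτ2, add_comm, hsum]
  refine (iInf₂_le _ hmem).trans ?_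
  rw [transportCost_add]
  refine add_le_add (lintegral_mono' hγ₁le le_rfl) ?_
  rw [← hτ1, ← hτ2]
  exact transportCost_le_two_mul_M2 τ

/-- Uniform integrability of the second moment among the measures dominated by `μ`. -/
lemma exists_M2_le_of_le {μ : Measure (Rn n)} (hμ : M2 μ < ⊤) {ε : ℝ≥0∞} (hε : ε ≠ 0) :
    ∃ δ > 0, ∀ ν ≤ μ, ν univ ≤ δ → M2 ν ≤ ε := by
  have hlim : Tendsto (fun N : ℕ => ∫⁻ x, ((‖x‖₊ : ℝ≥0∞) ^ 2 - (N : ℝ≥0∞)) ∂μ) atTop (𝓝 0) := by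
    have := tendsto_lintegral_of_dominated_convergence (μ := μ)
      (F := fun (N : ℕ) (x : Rn n) => (‖x‖₊ : ℝ≥0∞) ^ 2 - (N : ℝ≥0∞)) (f := fun _ => 0)
      (fun x => (‖x‖₊ : ℝ≥0∞) ^ 2) (fun N => by fun_prop)
      (fun N => Eventually.of_forall fun x => tsub_le_self) hμ.ne
      (Eventually.of_forall fun x => by
        obtain ⟨N, hN⟩ := ENNReal.exists_nat_gt (r := (‖x‖₊ : ℝ≥0∞) ^ 2) (by simp)
        refine tendsto_const_nhds.congr' ?_
        filter_upwards [eventually_ge_atTop N] with k hk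
        exact (tsub_eq_zero_of_le (hN.le.trans (by exact_mod_cast hk))).symm)
    simpa using this
  have hε2 : 0 < ε / 2 := (ENNReal.half_pos hε)
  obtain ⟨N, hN⟩ := (hlim.eventually_lt_const hε2).exists
  refine ⟨ε / 2 / (N + 1), ENNReal.div_pos hε2.ne' (by finiteness), fun ν hν hνδ => ?_⟩
  calc M2 ν ≤ ∫⁻ x, ((N : ℝ≥0∞) + ((‖x‖₊ : ℝ≥0∞) ^ 2 - (N : ℝ≥0∞))) ∂ν :=
        lintegral_mono fun x => le_add_tsub
    _ = N * ν univ + ∫⁻ x, ((‖x‖₊ : ℝ≥0∞) ^ 2 - (N : ℝ≥0∞)) ∂ν := by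
        rw [lintegral_add_left measurable_const, lintegral_const]
    _ ≤ (N + 1) * (ε / 2 / (N + 1)) + ε / 2 := by
        gcongr
        · exact le_self_add
        · exact (lintegral_mono' hν le_rfl).trans hN.le
    _ = ε := by
        rw [ENNReal.mul_div_cancel (by simp) (by finiteness), ENNReal.add_halves]

/-- Lower semicontinuity of the transport cost with respect to total variation. -/
lemma exists_W2e_le_add {ρ μ : Measure (Rn n)} [IsProbabilityMeasure ρ] (hρ : M2 ρ < ⊤)
    (hμ : M2 μ < ⊤) {ε : ℝ≥0∞} (hε : ε ≠ 0) :
    ∃ δ > 0, ∀ κ α β : Measure (Rn n), ρ = κ + α → α univ ≤ δ →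
      W2e ρ μ ≤ W2e (κ + β) μ + ε := by
  have hε4 : ε / 2 / 2 ≠ 0 := (ENNReal.half_pos (ENNReal.half_pos hε).ne').ne'
  obtain ⟨δ₁, hδ₁, h₁⟩ := exists_M2_le_of_le hρ hε4
  obtain ⟨δ₂, hδ₂, h₂⟩ := exists_M2_le_of_le hμ hε4
  refine ⟨min δ₁ δ₂, lt_min hδ₁ hδ₂, ?_⟩
  rintro κ α β rfl hα
  rw [← tsub_le_iff_right]
  refine le_iInf₂ fun γ hγ => ?_
  rw [tsub_le_iff_right]
  obtain ⟨ν, hν, hνα, hle⟩ := exists_W2e_le_transportCost_add (α := α) hγ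
  refine hle.trans (add_le_add_right ?_ _)
  calc 2 * M2 α + 2 * M2 ν ≤ 2 * (ε / 2 / 2) + 2 * (ε / 2 / 2) := by
        gcongr
        · exact h₁ α (Measure.le_add_left le_rfl) (hα.trans (min_le_left _ _))
        · exact h₂ ν hν (hνα.trans_le (hα.trans (min_le_right _ _)))
    _ = ε := by
        rw [ENNReal.mul_div_cancel (by simp) (by simp), ENNReal.add_halves]

/-! ### Densities -/

lemma measurable_dens (μ : Measure (Rn n)) : Measurable (dens μ) :=
  (Measure.measurable_rnDeriv _ _).ennreal_toReal

lemma dens_nonneg (μ : Measure (Rn n)) (x : Rn n) : 0 ≤ dens μ x := ENNReal.toReal_nonneg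

lemma withDensity_dens {μ : Measure (Rn n)} [IsFiniteMeasure μ] (hμ : μ ≪ volume) :
    volume.withDensity (fun x => ENNReal.ofReal (dens μ x)) = μ := by
  conv_rhs => rw [← Measure.withDensity_rnDeriv_eq μ volume hμ]
  refine withDensity_congr_ae ?_
  filter_upwards [μ.rnDeriv_lt_top volume] with x hx
  exact ENNReal.ofReal_toReal hx.ne

lemma dens_withDensity {u : Rn n → ℝ} (hu : Measurable u) (h0 : ∀ x, 0 ≤ u x) :
    dens (volume.withDensity fun x => ENNReal.ofReal (u x)) =ᵐ[volume] u := by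
  filter_upwards [Measure.rnDeriv_withDensity volume hu.ennreal_ofReal] with x hx
  rw [dens, hx, ENNReal.toReal_ofReal (h0 x)]

lemma integrable_iff_dens {μ : Measure (Rn n)} [IsFiniteMeasure μ] (hμ : μ ≪ volume)
    {f : Rn n → ℝ} : Integrable f μ ↔ Integrable (fun x => f x * dens μ x) volume := by
  rw [← integrable_rnDeriv_smul_iff hμ]
  simp only [smul_eq_mul, dens, mul_comm]

lemma integral_eq_dens {μ : Measure (Rn n)} [IsFiniteMeasure μ] (hμ : μ ≪ volume)
    (f : Rn n → ℝ) : ∫ x, f x ∂μ = ∫ x, f x * dens μ x := by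
  rw [← integral_rnDeriv_smul hμ]
  simp only [smul_eq_mul, dens, mul_comm]

lemma integrable_dens {μ : Measure (Rn n)} (hμ : μ ∈ P2ac n) :
    Integrable (dens μ) volume := by
  have := hμ.1
  simpa using (integrable_iff_dens hμ.2.1 (f := fun _ => 1)).1 (integrable_const _)

lemma integral_dens {μ : Measure (Rn n)} (hμ : μ ∈ P2ac n) : ∫ x, dens μ x = 1 := by
  have := hμ.1
  simpa using (integral_eq_dens hμ.2.1 (fun _ => 1)).symm

lemma integrable_norm_sq {μ : Measure (Rn n)} (hμ : M2 μ < ⊤) :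
    Integrable (fun x => ‖x‖ ^ 2) μ := by
  refine ⟨by fun_prop, ?_⟩
  rw [hasFiniteIntegral_iff_enorm]
  simpa [M2, enorm_eq_nnnorm] using hμ

lemma integral_norm_sq (μ : Measure (Rn n)) : ∫ x, ‖x‖ ^ 2 ∂μ = (M2 μ).toReal := by
  rw [integral_eq_lintegral_of_nonneg_ae (Eventually.of_forall fun x => by positivity)
    (by fun_prop)]
  congr 1
  refine lintegral_congr fun x => ?_
  rw [ENNReal.ofReal_pow (norm_nonneg _), ofReal_norm, enorm_eq_nnnorm]

lemma integrable_norm_sq_mul_dens {μ : Measure (Rn n)} (hμ : μ ∈ P2ac n) :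
    Integrable (fun x => ‖x‖ ^ 2 * dens μ x) volume := by
  have := hμ.1
  exact (integrable_iff_dens hμ.2.1).1 (integrable_norm_sq hμ.2.2)

lemma integral_norm_sq_mul_dens {μ : Measure (Rn n)} (hμ : μ ∈ P2ac n) :
    ∫ x, ‖x‖ ^ 2 * dens μ x = (M2 μ).toReal := by
  have := hμ.1
  rw [← integral_eq_dens hμ.2.1, integral_norm_sq]

lemma integrable_one_add_norm_mul_dens {μ : Measure (Rn n)} (hμ : μ ∈ P2ac n) :
    Integrable (fun x => (1 + ‖x‖) * dens μ x) volume := by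
  refine (((integrable_dens hμ).const_mul 2).add (integrable_norm_sq_mul_dens hμ)).mono'
    (((measurable_const.add measurable_norm).mul (measurable_dens μ)).aestronglyMeasurable)
    (Eventually.of_forall fun x => ?_)
  have := dens_nonneg μ x
  rw [Real.norm_of_nonneg (by positivity)]
  simp only [Pi.add_apply]
  nlinarith [sq_nonneg (‖x‖ - 1), norm_nonneg x]

lemma integrable_compensator {μ : Measure (Rn n)} (hμ : μ ∈ P2ac n) :
    Integrable (fun x => compensator x (dens μ x)) volume :=
  (integrable_one_add_norm_mul_dens hμ).add integrable_decayWeight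

/-- The midpoint of two measures. -/
def midMeasure (ρ σ : Measure (Rn n)) : Measure (Rn n) := (2⁻¹ : ℝ≥0∞) • (ρ + σ)

lemma midMeasure_mem {ρ σ : Measure (Rn n)} (hρ : ρ ∈ P2ac n) (hσ : σ ∈ P2ac n) :
    midMeasure ρ σ ∈ P2ac n := by
  have := hρ.1
  have := hσ.1
  refine ⟨⟨?_⟩, ?_, ?_⟩
  · simp [midMeasure, ENNReal.inv_two_add_inv_two]
  · exact Measure.AbsolutelyContinuous.smul_left (hρ.2.1.add_left hσ.2.1) _
  · unfold M2 midMeasure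
    rw [lintegral_smul_measure, lintegral_add_measure]
    exact ENNReal.mul_lt_top (by simp) (ENNReal.add_lt_top.2 ⟨hρ.2.2, hσ.2.2⟩)

lemma dens_midMeasure {ρ σ : Measure (Rn n)} (hρ : ρ ∈ P2ac n) (hσ : σ ∈ P2ac n) :
    dens (midMeasure ρ σ) =ᵐ[volume] fun x => (dens ρ x + dens σ x) / 2 := by
  have := hρ.1
  have := hσ.1
  have hρm := measurable_dens ρ
  have hσm := measurable_dens σ
  have heq : midMeasure ρ σ =
      volume.withDensity fun x => ENNReal.ofReal ((dens ρ x + dens σ x) / 2) := by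
    unfold midMeasure
    conv_lhs => rw [← withDensity_dens hρ.2.1, ← withDensity_dens hσ.2.1]
    rw [← withDensity_add_left hρm.ennreal_ofReal, ← withDensity_smul _
      (hρm.ennreal_ofReal.add hσm.ennreal_ofReal)]
    congr 1
    ext x
    simp only [Pi.smul_apply, Pi.add_apply, smul_eq_mul]
    rw [← ENNReal.ofReal_add (dens_nonneg ρ x) (dens_nonneg σ x), div_eq_inv_mul,
      ENNReal.ofReal_mul (by norm_num), ENNReal.ofReal_inv_of_pos (by norm_num)]
    norm_num
  rw [heq]
  exact dens_withDensity (by fun_prop)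
    fun x => by have := dens_nonneg ρ x; have := dens_nonneg σ x; positivity

/-- A Cauchy sequence of densities in weighted `L¹` converges, and a subsequence converges almost
everywhere. -/
lemma exists_tendsto_of_cauchy_weighted {u : ℕ → Rn n → ℝ} (h0 : ∀ k x, 0 ≤ u k x)
    (hwi : ∀ k, Integrable (fun x => (1 + ‖x‖) * u k x) volume)
    (hc : ∀ ε > 0, ∃ N, ∀ j ≥ N, ∀ k ≥ N, ∫ x, (1 + ‖x‖) * |u j x - u k x| ≤ ε) :
    ∃ v : Rn n → ℝ, Measurable v ∧ (∀ x, 0 ≤ v x) ∧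
      Integrable (fun x => (1 + ‖x‖) * v x) volume ∧
      Tendsto (fun k => ∫ x, (1 + ‖x‖) * |u k x - v x|) atTop (𝓝 0) ∧
      ∃ φ : ℕ → ℕ, StrictMono φ ∧
        ∀ᵐ x, Tendsto (fun k => u (φ k) x) atTop (𝓝 (v x)) := by
  set g : ℕ → (Rn n →₁[volume] ℝ) := fun k => (hwi k).toL1 _ with hg
  have hnorm : ∀ k (w : Rn n → ℝ) (hw : Integrable w volume),
      ‖g k - hw.toL1 w‖ = ∫ x, |(1 + ‖x‖) * u k x - w x| := by
    intro k w hw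
    rw [hg, ← Integrable.toL1_sub, L1.norm_of_fun_eq_integral_norm]
    rfl
  have hcauchy : CauchySeq g := by
    rw [Metric.cauchySeq_iff]
    intro ε hε
    obtain ⟨N, hN⟩ := hc (ε / 2) (by positivity)
    refine ⟨N, fun j hj k hk => ?_⟩
    rw [dist_eq_norm, hnorm j _ (hwi k)]
    refine lt_of_le_of_lt (le_of_eq ?_) ((hN j hj k hk).trans_lt (by linarith))
    congr 1 with x
    rw [← mul_sub, abs_mul, abs_of_pos (by positivity)]
  obtain ⟨G, hG⟩ := cauchySeq_tendsto_of_complete hcauchy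
  have hGint : Integrable G volume := L1.integrable_coeFn G
  have hGm : Measurable G := (Lp.stronglyMeasurable G).measurable
  have hdist : Tendsto (fun k => ∫ x, |(1 + ‖x‖) * u k x - G x|) atTop (𝓝 0) := by
    have := tendsto_iff_norm_sub_tendsto_zero.1 hG
    refine this.congr fun k => ?_
    rw [← hnorm k G hGint, Integrable.toL1_coeFn]
  have hvm : Measurable fun x : Rn n => max (G x / (1 + ‖x‖)) 0 :=
    (hGm.div (by fun_prop)).max measurable_const
  have hpt : ∀ k x, (1 + ‖x‖) * |u k x - max (G x / (1 + ‖x‖)) 0| ≤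
      |(1 + ‖x‖) * u k x - G x| := by
    intro k x
    have hx : 0 < 1 + ‖x‖ := by positivity
    have h1 : |u k x - max (G x / (1 + ‖x‖)) 0| ≤ |u k x - G x / (1 + ‖x‖)| := by
      have := abs_max_sub_max_le_abs (u k x) (G x / (1 + ‖x‖)) 0
      rwa [max_eq_left (h0 k x)] at this
    calc _ ≤ (1 + ‖x‖) * |u k x - G x / (1 + ‖x‖)| := by gcongr
      _ = |(1 + ‖x‖) * u k x - G x| := by
        conv_lhs => rw [← abs_of_pos hx, ← abs_mul, mul_sub, abs_of_pos hx]
        rw [mul_div_cancel₀ _ hx.ne']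
  refine ⟨fun x => max (G x / (1 + ‖x‖)) 0, hvm, fun x => le_max_right _ _, ?_, ?_, ?_⟩
  · refine hGint.mono (((by fun_prop : Measurable fun x : Rn n => 1 + ‖x‖).mul
      hvm).aestronglyMeasurable) (Eventually.of_forall fun x => ?_)
    have hx : 0 < 1 + ‖x‖ := by positivity
    rw [norm_mul, Real.norm_of_nonneg hx.le, Real.norm_eq_abs, Real.norm_eq_abs]
    have h1 : |max (G x / (1 + ‖x‖)) 0| ≤ |G x / (1 + ‖x‖)| := by
      simpa using abs_max_sub_max_le_abs (G x / (1 + ‖x‖)) 0 0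
    calc _ ≤ (1 + ‖x‖) * |G x / (1 + ‖x‖)| := by gcongr
      _ = |G x| := by rw [abs_div, abs_of_pos hx, mul_div_cancel₀ _ hx.ne']
  · refine squeeze_zero (fun k => integral_nonneg fun x => by positivity) (fun k => ?_) hdist
    exact integral_mono_of_nonneg (Eventually.of_forall fun x => by positivity)
      ((hwi k).sub hGint).abs (Eventually.of_forall (hpt k))
  · have hmeas : TendstoInMeasure volume (fun k x => g k x) atTop G :=
      tendstoInMeasure_of_tendsto_Lp hG
    obtain ⟨φ, hφ, hae⟩ := hmeas.exists_seq_tendsto_ae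
    refine ⟨φ, hφ, ?_⟩
    have hall : ∀ᵐ x, ∀ k, g k x = (1 + ‖x‖) * u k x :=
      ae_all_iff.2 fun k => (hwi k).coeFn_toL1
    filter_upwards [hae, hall] with x hx hgx
    have hx0 : 0 < 1 + ‖x‖ := by positivity
    have h1 : Tendsto (fun k => max (g (φ k) x / (1 + ‖x‖)) 0) atTop
        (𝓝 (max (G x / (1 + ‖x‖)) 0)) := (hx.div_const _).max tendsto_const_nhds
    refine h1.congr fun k => ?_
    rw [hgx, mul_div_cancel_left₀ _ hx0.ne', max_eq_left (h0 _ _)]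

/-! ### The semi-implicit energy -/

/-- Absolutely continuous measures with finite second moment, internal and potential energy. -/
def FiniteEnergy (F : ℝ → ℝ) (Vf : Rn n → ℝ) (ρ : Measure (Rn n)) : Prop :=
  ρ ∈ P2ac n ∧ Integrable (fun x => F (dens ρ x)) volume ∧
    Integrable (fun x => Vf x * dens ρ x) volume

/-- The semi-implicit energy as a real number. -/
def realEnergy (h : ℝ) (F : ℝ → ℝ) (Vf : Rn n → ℝ) (μ ρ : Measure (Rn n)) : ℝ :=
  W2 ρ μ ^ 2 + 2 * h * ((∫ x, F (dens ρ x)) + ∫ x, Vf x * dens ρ x)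

lemma finiteEnergy_of_lt_top {F : ℝ → ℝ} {Vf : Rn n → ℝ} {ρ : Measure (Rn n)} (hρ : ρ ∈ P2ac n)
    (hfin : FfuncE F ρ + VfuncE Vf ρ < ⊤) : FiniteEnergy F Vf ρ := by
  have := hρ.1
  have hF : Integrable (fun x => F (dens ρ x)) volume := by
    by_contra hF
    rw [FfuncE, if_neg fun h' => hF h'.2, EReal.top_add_of_ne_bot] at hfin
    · exact hfin.false
    · unfold VfuncE
      split_ifs <;> simp
  have hV : Integrable Vf ρ := by
    by_contra hV
    rw [VfuncE, if_neg hV, EReal.add_top_of_ne_bot] at hfin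
    · exact hfin.false
    · unfold FfuncE
      split_ifs <;> simp
  exact ⟨hρ, hF, (integrable_iff_dens hρ.2.1).1 hV⟩

lemma JKOEnergy_eq_realEnergy {F : ℝ → ℝ} {Vf : Rn n → ℝ} {ρ : Measure (Rn n)}
    (hρ : FiniteEnergy F Vf ρ) (h : ℝ) (μ : Measure (Rn n)) :
    JKOEnergy h F Vf μ ρ = (realEnergy h F Vf μ ρ : EReal) := by
  have := hρ.1.1
  rw [JKOEnergy, FfuncE, VfuncE, if_pos ⟨hρ.1.2.1, hρ.2.1⟩,
    if_pos ((integrable_iff_dens hρ.1.2.1).2 hρ.2.2), integral_eq_dens hρ.1.2.1, realEnergy]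
  norm_cast

lemma JKOEnergy_eq_top {F : ℝ → ℝ} {Vf : Rn n → ℝ} {ρ : Measure (Rn n)} (hρ : ρ ∈ P2ac n)
    (hfin : ¬ FiniteEnergy F Vf ρ) {h : ℝ} (hh : 0 < h) (μ : Measure (Rn n)) :
    JKOEnergy h F Vf μ ρ = ⊤ := by
  have htop : FfuncE F ρ + VfuncE Vf ρ = ⊤ := by
    by_contra hne
    exact hfin (finiteEnergy_of_lt_top hρ (lt_top_iff_ne_top.2 hne))
  rw [JKOEnergy, htop, EReal.coe_mul_top_of_pos (by positivity), EReal.coe_add_top]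

lemma W2_sq (ρ μ : Measure (Rn n)) : W2 ρ μ ^ 2 = (W2e ρ μ).toReal :=
  Real.sq_sqrt ENNReal.toReal_nonneg

lemma W2e_lt_top_of_mem {ρ μ : Measure (Rn n)} (hρ : ρ ∈ P2ac n) (hμ : μ ∈ P2ac n) :
    W2e ρ μ < ⊤ := by
  have := hρ.1
  have := hμ.1
  exact W2e_lt_top hρ.2.2 hμ.2.2

lemma toReal_M2_le {ρ μ : Measure (Rn n)} (hρ : ρ ∈ P2ac n) (hμ : μ ∈ P2ac n) :
    (M2 ρ).toReal ≤ 2 * W2 ρ μ ^ 2 + 2 * (M2 μ).toReal := by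
  have hW := W2e_lt_top_of_mem hρ hμ
  have h1 : 2 * W2e ρ μ ≠ ⊤ := ENNReal.mul_ne_top (by simp) hW.ne
  have h2 : 2 * M2 μ ≠ ⊤ := ENNReal.mul_ne_top (by simp) hμ.2.2.ne
  have := ENNReal.toReal_mono (ENNReal.add_ne_top.2 ⟨h1, h2⟩) (M2_le_W2e ρ μ)
  rw [ENNReal.toReal_add h1 h2, ENNReal.toReal_mul, ENNReal.toReal_mul] at this
  simpa [W2_sq] using this

lemma W2_sq_midMeasure_le {ρ σ μ : Measure (Rn n)} (hρ : ρ ∈ P2ac n) (hσ : σ ∈ P2ac n)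
    (hμ : μ ∈ P2ac n) : W2 (midMeasure ρ σ) μ ^ 2 ≤ (W2 ρ μ ^ 2 + W2 σ μ ^ 2) / 2 := by
  have h1 := (W2e_lt_top_of_mem hρ hμ).ne
  have h2 := (W2e_lt_top_of_mem hσ hμ).ne
  have := ENNReal.toReal_mono (ENNReal.add_ne_top.2 ⟨h1, h2⟩) (two_mul_W2e_midpoint_le ρ σ μ)
  rw [ENNReal.toReal_add h1 h2, ENNReal.toReal_mul] at this
  simp only [W2_sq, midMeasure]
  simp only [ENNReal.toReal_ofNat] at this
  linarith

lemma integral_compensator_le {ρ : Measure (Rn n)} (hρ : ρ ∈ P2ac n) {η : ℝ} (hη : 0 < η) :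
    ∫ x, compensator x (dens ρ x) ≤
      η * (M2 ρ).toReal + (1 + 1 / (4 * η)) + ∫ x, decayWeight n x := by
  unfold compensator
  rw [integral_add (integrable_one_add_norm_mul_dens hρ) integrable_decayWeight]
  gcongr
  have h1 := (integrable_norm_sq_mul_dens hρ).const_mul η
  have h2 := (integrable_dens hρ).const_mul (1 + 1 / (4 * η))
  calc ∫ x, (1 + ‖x‖) * dens ρ x
      ≤ ∫ x, (η * (‖x‖ ^ 2 * dens ρ x) + (1 + 1 / (4 * η)) * dens ρ x) := by
        refine integral_mono (integrable_one_add_norm_mul_dens hρ) (h1.add h2) fun x => ?_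
        have hx : 1 + ‖x‖ ≤ η * ‖x‖ ^ 2 + (1 + 1 / (4 * η)) := by
          have h3 : η * ‖x‖ ^ 2 + 1 / (4 * η) - ‖x‖ = η * (‖x‖ - 1 / (2 * η)) ^ 2 := by
            field_simp
            ring
          have h4 : 0 ≤ η * (‖x‖ - 1 / (2 * η)) ^ 2 := by positivity
          linarith
        have := mul_le_mul_of_nonneg_right hx (dens_nonneg ρ x)
        simp only
        linarith
    _ = _ := by
        rw [integral_add h1 h2, integral_const_mul, integral_const_mul,
          integral_norm_sq_mul_dens hρ, integral_dens hρ, mul_one]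

lemma exists_integral_compensator_le {h K : ℝ} (hh : 0 < h) (hK : 0 ≤ K) {μ : Measure (Rn n)}
    (hμ : μ ∈ P2ac n) : ∃ c, 0 ≤ c ∧ ∀ ρ ∈ P2ac n,
      2 * h * K * ∫ x, compensator x (dens ρ x) ≤ W2 ρ μ ^ 2 / 2 + c := by
  have hhK : 0 ≤ h * K := by positivity
  set η : ℝ := 1 / (8 * (h * K + 1)) with hη
  have hη0 : 0 < η := by positivity
  have hw : 0 ≤ ∫ x, decayWeight n x := integral_nonneg decayWeight_nonneg
  set d : ℝ := 2 * η * (M2 μ).toReal + (1 + 1 / (4 * η)) + ∫ x, decayWeight n x with hd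
  have hd0 : 0 ≤ d := by positivity
  refine ⟨2 * h * K * d, by positivity, fun ρ hρ => ?_⟩
  have h1 := integral_compensator_le hρ hη0
  have h2 := mul_le_mul_of_nonneg_left (toReal_M2_le hρ hμ) hη0.le
  have h3 : ∫ x, compensator x (dens ρ x) ≤ 2 * η * W2 ρ μ ^ 2 + d := by
    rw [hd]; linarith
  have h4 := mul_le_mul_of_nonneg_left h3 (by positivity : 0 ≤ 2 * h * K)
  have h5 : h * K * η * 8 ≤ 1 := by
    rw [hη]
    rw [mul_one_div, div_mul_eq_mul_div, div_le_one (by positivity)]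
    linarith
  nlinarith [mul_le_mul_of_nonneg_right h5 (sq_nonneg (W2 ρ μ))]

section Direct

variable {F : ℝ → ℝ} {Vf : Rn n → ℝ} {ρ σ μ : Measure (Rn n)} {h K : ℝ}

lemma FiniteEnergy.integrable_add_compensator (hρ : FiniteEnergy F Vf ρ) (K : ℝ) :
    Integrable (fun x => F (dens ρ x) + K * compensator x (dens ρ x)) volume :=
  hρ.2.1.add ((integrable_compensator hρ.1).const_mul K)

lemma FiniteEnergy.integral_add_compensator (hρ : FiniteEnergy F Vf ρ) (K : ℝ) :
    ∫ x, (F (dens ρ x) + K * compensator x (dens ρ x)) =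
      (∫ x, F (dens ρ x)) + K * ∫ x, compensator x (dens ρ x) := by
  rw [integral_add hρ.2.1 ((integrable_compensator hρ.1).const_mul K), integral_const_mul]

lemma exists_energy_bound (hK0 : 0 ≤ K) (hV : ∀ x, 0 ≤ Vf x) (hμ : μ ∈ P2ac n) (hh : 0 < h) :
    ∃ c, 0 ≤ c ∧ ∀ ρ, FiniteEnergy F Vf ρ →
      W2 ρ μ ^ 2 / 2 + 2 * h * ∫ x, (F (dens ρ x) + K * compensator x (dens ρ x)) ≤
        realEnergy h F Vf μ ρ + c := by
  obtain ⟨c, hc, hcomp⟩ := exists_integral_compensator_le hh hK0 hμ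
  refine ⟨c, hc, fun ρ hρ => ?_⟩
  have h1 := hcomp ρ hρ.1
  have h2 : 0 ≤ ∫ x, Vf x * dens ρ x :=
    integral_nonneg fun x => mul_nonneg (hV x) (dens_nonneg ρ x)
  have h3 := mul_nonneg hh.le h2
  rw [hρ.integral_add_compensator, realEnergy]
  linarith

lemma integral_add_compensator_nonneg
    (hK : ∀ (x : Rn n) t, 0 ≤ t → 0 ≤ F t + K * compensator x t) (ρ : Measure (Rn n)) :
    0 ≤ ∫ x, (F (dens ρ x) + K * compensator x (dens ρ x)) :=
  integral_nonneg fun x => hK x _ (dens_nonneg ρ x)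

lemma InternalDensity.aestronglyMeasurable_comp (hF : InternalDensity F) {u : Rn n → ℝ}
    (hu : Measurable u) (h0 : ∀ x, 0 ≤ u x) :
    AEStronglyMeasurable (fun x => F (u x)) volume := by
  have h1 : Measurable ((Ici (0 : ℝ)).domRestrict F) :=
    (continuousOn_iff_continuous_domRestrict.1 hF.continuousOn).measurable
  have h2 : Measurable fun x => (⟨u x, h0 x⟩ : Ici (0 : ℝ)) := hu.subtype_mk
  exact (h1.comp h2).aestronglyMeasurable

lemma InternalDensity.finiteEnergy_midMeasure (hF : InternalDensity F)
    (hK : ∀ (x : Rn n) t, 0 ≤ t → 0 ≤ F t + K * compensator x t)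
    (hρ : FiniteEnergy F Vf ρ) (hσ : FiniteEnergy F Vf σ) :
    FiniteEnergy F Vf (midMeasure ρ σ) ∧
      Integrable (fun x => convexGap F (dens ρ x) (dens σ x)) volume := by
  have hd := dens_midMeasure hρ.1 hσ.1
  have hmem := midMeasure_mem hρ.1 hσ.1
  have hsum : Integrable (fun x => (F (dens ρ x) + F (dens σ x)) / 2) volume :=
    (hρ.2.1.add hσ.2.1).div_const 2
  have hFmid : Integrable (fun x => F (dens (midMeasure ρ σ) x)) volume := by
    refine (hsum.abs.add ((integrable_compensator hmem).const_mul K).abs).mono'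
      (hF.aestronglyMeasurable_comp (measurable_dens _) (dens_nonneg _)) ?_
    filter_upwards [hd] with x hx
    have h1 := hK x _ (dens_nonneg (midMeasure ρ σ) x)
    have h2 := hF.midpoint_le (dens_nonneg ρ x) (dens_nonneg σ x)
    rw [← hx] at h2
    have h3 := le_abs_self ((F (dens ρ x) + F (dens σ x)) / 2)
    have h4 := le_abs_self (K * compensator x (dens (midMeasure ρ σ) x))
    have h5 := abs_nonneg ((F (dens ρ x) + F (dens σ x)) / 2)
    have h6 := abs_nonneg (K * compensator x (dens (midMeasure ρ σ) x))
    rw [Real.norm_eq_abs, abs_le]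
    simp only [Pi.add_apply]
    constructor <;> linarith
  refine ⟨⟨hmem, hFmid, ?_⟩, ?_⟩
  · refine ((hρ.2.2.add hσ.2.2).div_const 2).congr ?_
    filter_upwards [hd] with x hx
    rw [hx]
    simp only [Pi.add_apply]
    ring
  · refine (hsum.sub hFmid).congr ?_
    filter_upwards [hd] with x hx
    simp only [Pi.sub_apply, convexGap, hx]

lemma InternalDensity.realEnergy_midMeasure_le (hF : InternalDensity F)
    (hK : ∀ (x : Rn n) t, 0 ≤ t → 0 ≤ F t + K * compensator x t) (hμ : μ ∈ P2ac n)
    (hρ : FiniteEnergy F Vf ρ) (hσ : FiniteEnergy F Vf σ) :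
    realEnergy h F Vf μ (midMeasure ρ σ) +
        2 * h * ∫ x, convexGap F (dens ρ x) (dens σ x) ≤
      (realEnergy h F Vf μ ρ + realEnergy h F Vf μ σ) / 2 := by
  have hd := dens_midMeasure hρ.1 hσ.1
  obtain ⟨hmid, -⟩ := hF.finiteEnergy_midMeasure hK hρ hσ
  have hgap : ∫ x, convexGap F (dens ρ x) (dens σ x) =
      ((∫ x, F (dens ρ x)) + ∫ x, F (dens σ x)) / 2 - ∫ x, F (dens (midMeasure ρ σ) x) := by
    have hsum : Integrable (fun x => (F (dens ρ x) + F (dens σ x)) / 2) volume :=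
      (hρ.2.1.add hσ.2.1).div_const 2
    rw [← integral_add hρ.2.1 hσ.2.1, ← integral_div, ← integral_sub hsum hmid.2.1]
    refine integral_congr_ae ?_
    filter_upwards [hd] with x hx
    simp only [convexGap, hx]
  have hpot : ∫ x, Vf x * dens (midMeasure ρ σ) x =
      ((∫ x, Vf x * dens ρ x) + ∫ x, Vf x * dens σ x) / 2 := by
    rw [← integral_add hρ.2.2 hσ.2.2, ← integral_div]
    refine integral_congr_ae ?_
    filter_upwards [hd] with x hx
    simp only [hx]
    ring
  have hW := W2_sq_midMeasure_le hρ.1 hσ.1 hμ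
  unfold realEnergy
  rw [hgap, hpot]
  linarith

/-- Fatou's lemma for real functions. -/
lemma integrable_and_integral_le_of_tendsto {α : Type*} [MeasurableSpace α] {ν : Measure α}
    {f : ℕ → α → ℝ} {g : α → ℝ} (hf : ∀ k, Integrable (f k) ν) (h0 : ∀ k x, 0 ≤ f k x)
    (hlim : ∀ᵐ x ∂ν, Tendsto (fun k => f k x) atTop (𝓝 (g x))) {c : ℝ}
    (hc : ∀ᶠ k in atTop, ∫ x, f k x ∂ν ≤ c) : Integrable g ν ∧ ∫ x, g x ∂ν ≤ c := by
  have hgm : AEStronglyMeasurable g ν :=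
    aestronglyMeasurable_of_tendsto_ae atTop (fun k => (hf k).aestronglyMeasurable) hlim
  have hg0 : 0 ≤ᵐ[ν] g := by
    filter_upwards [hlim] with x hx using ge_of_tendsto' hx fun k => h0 k x
  have hc0 : 0 ≤ c := by
    obtain ⟨k, hk⟩ := hc.exists
    exact (integral_nonneg (h0 k)).trans hk
  have hle : ∫⁻ x, ENNReal.ofReal (g x) ∂ν ≤ ENNReal.ofReal c := by
    calc ∫⁻ x, ENNReal.ofReal (g x) ∂ν
        = ∫⁻ x, liminf (fun k => ENNReal.ofReal (f k x)) atTop ∂ν := by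
          refine lintegral_congr_ae ?_
          filter_upwards [hlim] with x hx
          exact ((ENNReal.continuous_ofReal.tendsto _).comp hx).liminf_eq.symm
      _ ≤ liminf (fun k => ∫⁻ x, ENNReal.ofReal (f k x) ∂ν) atTop :=
          lintegral_liminf_le' fun k => (hf k).aestronglyMeasurable.aemeasurable.ennreal_ofReal
      _ ≤ ENNReal.ofReal c := by
          refine liminf_le_of_frequently_le' (Eventually.frequently ?_)
          filter_upwards [hc] with k hk
          rw [← ofReal_integral_eq_lintegral_ofReal (hf k) (Eventually.of_forall (h0 k))]
          exact ENNReal.ofReal_le_ofReal hk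
  refine ⟨⟨hgm, ?_⟩, ?_⟩
  · rw [hasFiniteIntegral_iff_ofReal hg0]
    exact hle.trans_lt ENNReal.ofReal_lt_top
  · rw [integral_eq_lintegral_of_nonneg_ae hg0 hgm]
    exact ENNReal.toReal_le_of_le_ofReal hc0 hle

/-- Completeness of `P₂^{ac}` for the weighted `L¹` distance of densities. -/
lemma exists_limit_of_cauchy {ρs : ℕ → Measure (Rn n)} (hρs : ∀ k, ρs k ∈ P2ac n) {M : ℝ}
    (hM : ∀ k, (M2 (ρs k)).toReal ≤ M)
    (hc : ∀ ε > 0, ∃ N, ∀ j ≥ N, ∀ k ≥ N,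
      ∫ x, (1 + ‖x‖) * |dens (ρs j) x - dens (ρs k) x| ≤ ε) :
    ∃ ρ ∈ P2ac n,
      Tendsto (fun k => ∫ x, (1 + ‖x‖) * |dens (ρs k) x - dens ρ x|) atTop (𝓝 0) ∧
      ∃ φ : ℕ → ℕ, StrictMono φ ∧
        ∀ᵐ x, Tendsto (fun k => dens (ρs (φ k)) x) atTop (𝓝 (dens ρ x)) := by
  obtain ⟨v, hvm, hv0, hvi, hvt, φ, hφ, hae⟩ := exists_tendsto_of_cauchy_weighted
    (fun k => dens_nonneg (ρs k)) (fun k => integrable_one_add_norm_mul_dens (hρs k)) hc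
  have hvi1 : Integrable v volume := by
    refine hvi.mono' hvm.aestronglyMeasurable (Eventually.of_forall fun x => ?_)
    rw [Real.norm_of_nonneg (hv0 x)]
    nlinarith [norm_nonneg x, mul_nonneg (norm_nonneg x) (hv0 x)]
  have hwi : ∀ k, Integrable (fun x => (1 + ‖x‖) * |dens (ρs k) x - v x|) volume := fun k => by
    refine ((integrable_one_add_norm_mul_dens (hρs k)).sub hvi).abs.congr
      (Eventually.of_forall fun x => ?_)
    simp only [Pi.sub_apply]
    rw [← mul_sub, abs_mul, abs_of_pos (by positivity)]
  have hone : ∫ x, v x = 1 := by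
    have hle : ∀ k, |1 - ∫ x, v x| ≤ ∫ x, (1 + ‖x‖) * |dens (ρs k) x - v x| := fun k => by
      have hsub : 1 - ∫ x, v x = ∫ x, (dens (ρs k) x - v x) := by
        rw [integral_sub (integrable_dens (hρs k)) hvi1, integral_dens (hρs k)]
      rw [hsub]
      refine abs_integral_le_integral_abs.trans ?_
      refine integral_mono ((integrable_dens (hρs k)).sub hvi1).abs (hwi k) fun x => ?_
      have := abs_nonneg (dens (ρs k) x - v x)
      simp only
      nlinarith [norm_nonneg x, mul_nonneg (norm_nonneg x) this]
    have := abs_nonpos_iff.1 (ge_of_tendsto' hvt hle)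
    linarith
  obtain ⟨hv2, -⟩ := integrable_and_integral_le_of_tendsto
    (f := fun k x => ‖x‖ ^ 2 * dens (ρs (φ k)) x) (g := fun x => ‖x‖ ^ 2 * v x) (c := M)
    (fun k => integrable_norm_sq_mul_dens (hρs (φ k)))
    (fun k x => mul_nonneg (by positivity) (dens_nonneg _ x))
    (by filter_upwards [hae] with x hx using hx.const_mul _)
    (Eventually.of_forall fun k => by
      rw [integral_norm_sq_mul_dens (hρs (φ k))]
      exact hM (φ k))
  have hdens := dens_withDensity hvm hv0
  refine ⟨volume.withDensity fun x => ENNReal.ofReal (v x), ⟨⟨?_⟩,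
    withDensity_absolutelyContinuous _ _, ?_⟩, ?_, φ, hφ, ?_⟩
  · rw [withDensity_apply _ MeasurableSet.univ, Measure.restrict_univ,
      ← ofReal_integral_eq_lintegral_ofReal hvi1 (Eventually.of_forall hv0), hone,
      ENNReal.ofReal_one]
  · unfold M2
    rw [lintegral_withDensity_eq_lintegral_mul _ hvm.ennreal_ofReal (by fun_prop)]
    have := hv2.2
    rw [hasFiniteIntegral_iff_ofReal
      (Eventually.of_forall fun x => mul_nonneg (by positivity) (hv0 x))] at this
    refine lt_of_eq_of_lt (lintegral_congr fun x => ?_) this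
    rw [Pi.mul_apply, mul_comm, ENNReal.ofReal_mul (by positivity),
      ENNReal.ofReal_pow (norm_nonneg _), ofReal_norm, enorm_eq_nnnorm]
  · refine hvt.congr fun k => integral_congr_ae ?_
    filter_upwards [hdens] with x hx
    rw [hx]
  · filter_upwards [hae, hdens] with x hx hd
    rwa [hd]

/-- Lower semicontinuity of the Wasserstein distance along densities converging in `L¹`. -/
lemma eventually_W2_sq_le {ρs : ℕ → Measure (Rn n)} {ρ μ : Measure (Rn n)}
    (hρs : ∀ k, ρs k ∈ P2ac n) (hρ : ρ ∈ P2ac n) (hμ : μ ∈ P2ac n)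
    (hlim : Tendsto (fun k => ∫ x, (1 + ‖x‖) * |dens (ρs k) x - dens ρ x|) atTop (𝓝 0))
    {ε : ℝ} (hε : 0 < ε) : ∀ᶠ k in atTop, W2 ρ μ ^ 2 ≤ W2 (ρs k) μ ^ 2 + ε := by
  have := hρ.1
  obtain ⟨δ, hδ, hmain⟩ := exists_W2e_le_add hρ.2.2 hμ.2.2 (ENNReal.ofReal_pos.2 hε).ne'
  have hlim' := (ENNReal.continuous_ofReal.tendsto _).comp hlim
  rw [ENNReal.ofReal_zero] at hlim'
  filter_upwards [hlim'.eventually (ge_mem_nhds hδ)] with k hk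
  have hm := measurable_dens ρ
  have hmk := measurable_dens (ρs k)
  have := (hρs k).1
  have hsplit : ∀ (u v : Rn n → ℝ), Measurable u → Measurable v → (∀ x, 0 ≤ u x) →
      (∀ x, 0 ≤ v x) → volume.withDensity (fun x => ENNReal.ofReal (u x)) =
        volume.withDensity (fun x => ENNReal.ofReal (min (u x) (v x))) +
          volume.withDensity (fun x => ENNReal.ofReal (u x - min (u x) (v x))) := by
    intro u v hu hv hu0 hv0
    rw [← withDensity_add_left (by fun_prop)]
    congr 1
    ext x
    rw [Pi.add_apply, ← ENNReal.ofReal_add (le_min (hu0 x) (hv0 x))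
      (sub_nonneg.2 (min_le_left _ _)), add_sub_cancel]
  have h1 := hsplit (dens ρ) (dens (ρs k)) hm hmk (dens_nonneg ρ) (dens_nonneg _)
  have h2 := hsplit (dens (ρs k)) (dens ρ) hmk hm (dens_nonneg _) (dens_nonneg ρ)
  simp only [min_comm (dens (ρs k) _)] at h2
  rw [withDensity_dens hρ.2.1] at h1
  rw [withDensity_dens (hρs k).2.1] at h2
  have hwi : Integrable (fun x => (1 + ‖x‖) * |dens (ρs k) x - dens ρ x|) volume := by
    refine ((integrable_one_add_norm_mul_dens (hρs k)).sub
      (integrable_one_add_norm_mul_dens hρ)).abs.congr (Eventually.of_forall fun x => ?_)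
    simp only [Pi.sub_apply]
    rw [← mul_sub, abs_mul, abs_of_pos (by positivity)]
  have h3 := hmain _ _
    (volume.withDensity fun x =>
      ENNReal.ofReal (dens (ρs k) x - min (dens ρ x) (dens (ρs k) x))) h1 (by
    refine le_trans ?_ hk
    rw [withDensity_apply _ MeasurableSet.univ, Measure.restrict_univ, Function.comp_apply,
      ofReal_integral_eq_lintegral_ofReal hwi (Eventually.of_forall fun x => by positivity)]
    refine lintegral_mono fun x => ENNReal.ofReal_le_ofReal ?_
    have h4 : dens ρ x - min (dens ρ x) (dens (ρs k) x) ≤ |dens (ρs k) x - dens ρ x| := by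
      rcases min_cases (dens ρ x) (dens (ρs k) x) with ⟨h, -⟩ | ⟨h, -⟩ <;> rw [h]
      · simp
      · rw [abs_sub_comm]
        exact le_abs_self _
    nlinarith [norm_nonneg x, mul_nonneg (norm_nonneg x) (abs_nonneg (dens (ρs k) x - dens ρ x))])
  rw [← h2] at h3
  have hW := (W2e_lt_top_of_mem (hρs k) hμ).ne
  have h5 := ENNReal.toReal_mono (ENNReal.add_ne_top.2 ⟨hW, ENNReal.ofReal_ne_top⟩) h3
  rw [ENNReal.toReal_add hW ENNReal.ofReal_ne_top, ENNReal.toReal_ofReal hε.le] at h5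
  rwa [W2_sq, W2_sq]

lemma tendsto_integral_compensator {ρs : ℕ → Measure (Rn n)} {ρ : Measure (Rn n)}
    (hρs : ∀ k, ρs k ∈ P2ac n) (hρ : ρ ∈ P2ac n)
    (hlim : Tendsto (fun k => ∫ x, (1 + ‖x‖) * |dens (ρs k) x - dens ρ x|) atTop (𝓝 0)) :
    Tendsto (fun k => ∫ x, compensator x (dens (ρs k) x)) atTop
      (𝓝 (∫ x, compensator x (dens ρ x))) := by
  rw [tendsto_iff_norm_sub_tendsto_zero]
  refine squeeze_zero (fun k => norm_nonneg _) (fun k => ?_) hlim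
  rw [← integral_sub (integrable_compensator (hρs k)) (integrable_compensator hρ)]
  refine (norm_integral_le_integral_norm _).trans (le_of_eq (integral_congr_ae ?_))
  refine Eventually.of_forall fun x => ?_
  simp only [compensator, Real.norm_eq_abs]
  rw [add_sub_add_right_eq_sub, ← mul_sub, abs_mul, abs_of_pos (by positivity)]

lemma InternalDensity.realEnergy_le_of_tendsto (hF : InternalDensity F)
    (hK : ∀ (x : Rn n) t, 0 ≤ t → 0 ≤ F t + K * compensator x t) (hVc : Continuous Vf)
    (hV : ∀ x, 0 ≤ Vf x) (hμ : μ ∈ P2ac n) (hh : 0 < h) {ρs : ℕ → Measure (Rn n)}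
    (hρs : ∀ k, FiniteEnergy F Vf (ρs k)) (hρ : ρ ∈ P2ac n)
    (hlim : Tendsto (fun k => ∫ x, (1 + ‖x‖) * |dens (ρs k) x - dens ρ x|) atTop (𝓝 0))
    {φ : ℕ → ℕ} (hφ : StrictMono φ)
    (hae : ∀ᵐ x, Tendsto (fun k => dens (ρs (φ k)) x) atTop (𝓝 (dens ρ x))) {J : ℝ}
    (hJ : Tendsto (fun k => realEnergy h F Vf μ (ρs k)) atTop (𝓝 J)) :
    FiniteEnergy F Vf ρ ∧ realEnergy h F Vf μ ρ ≤ J := by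
  have hcomp := (tendsto_integral_compensator (fun k => (hρs k).1) hρ hlim).const_mul K
  have hfi : ∀ k, Integrable (fun x => F (dens (ρs k) x) + K * compensator x (dens (ρs k) x) +
      Vf x * dens (ρs k) x) volume := fun k => ((hρs k).integrable_add_compensator K).add (hρs k).2.2
  have hfatou : ∀ ε > 0,
      Integrable (fun x => F (dens ρ x) + K * compensator x (dens ρ x) + Vf x * dens ρ x) volume ∧
      ∫ x, (F (dens ρ x) + K * compensator x (dens ρ x) + Vf x * dens ρ x) ≤
        (J - W2 ρ μ ^ 2 + 2 * ε) / (2 * h) + (K * (∫ x, compensator x (dens ρ x)) + ε) := by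
    intro ε hε
    refine integrable_and_integral_le_of_tendsto (fun k => hfi (φ k))
      (fun k x => add_nonneg (hK x _ (dens_nonneg _ x)) (mul_nonneg (hV x) (dens_nonneg _ x))) ?_ ?_
    · filter_upwards [hae] with x hx
      have h1 : Tendsto (fun k => F (dens (ρs (φ k)) x)) atTop (𝓝 (F (dens ρ x))) :=
        (hF.continuousOn _ (dens_nonneg ρ x)).tendsto.comp
          (tendsto_nhdsWithin_iff.2 ⟨hx, Eventually.of_forall fun k => dens_nonneg _ x⟩)
      exact (h1.add (((hx.const_mul _).add_const _).const_mul K)).add (hx.const_mul _)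
    · refine hφ.tendsto_atTop.eventually (p := fun k => ∫ x, (F (dens (ρs k) x) +
        K * compensator x (dens (ρs k) x) + Vf x * dens (ρs k) x) ≤ _) ?_
      filter_upwards [hJ.eventually (ge_mem_nhds (lt_add_of_pos_right J hε)),
        eventually_W2_sq_le (fun k => (hρs k).1) hρ hμ hlim hε,
        hcomp.eventually (ge_mem_nhds (lt_add_of_pos_right _ hε))] with k h1 h2 h3
      rw [integral_add ((hρs k).integrable_add_compensator K) (hρs k).2.2,
        (hρs k).integral_add_compensator K]
      unfold realEnergy at h1
      have h4 : (∫ x, F (dens (ρs k) x)) + ∫ x, Vf x * dens (ρs k) x ≤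
          (J - W2 ρ μ ^ 2 + 2 * ε) / (2 * h) := by
        rw [le_div_iff₀ (by positivity)]
        linarith
      linarith
  have hGi := (hfatou 1 one_pos).1
  have hci := (integrable_compensator hρ).const_mul K
  have hVi : Integrable (fun x => Vf x * dens ρ x) volume := by
    refine hGi.mono' (hVc.measurable.mul (measurable_dens ρ)).aestronglyMeasurable
      (Eventually.of_forall fun x => ?_)
    rw [Real.norm_of_nonneg (mul_nonneg (hV x) (dens_nonneg ρ x))]
    linarith [hK x _ (dens_nonneg ρ x)]
  have hFi : Integrable (fun x => F (dens ρ x)) volume := by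
    refine ((hGi.sub hVi).sub hci).congr (Eventually.of_forall fun x => ?_)
    simp only [Pi.sub_apply]
    ring
  have hfin : FiniteEnergy F Vf ρ := ⟨hρ, hFi, hVi⟩
  refine ⟨hfin, le_of_forall_pos_le_add fun η hη => ?_⟩
  have h1 := (hfatou (η / (2 + 2 * h)) (by positivity)).2
  rw [integral_add (hfin.integrable_add_compensator K) hVi, hfin.integral_add_compensator K] at h1
  have h2 : (∫ x, F (dens ρ x)) + (∫ x, Vf x * dens ρ x) - η / (2 + 2 * h) ≤
      (J - W2 ρ μ ^ 2 + 2 * (η / (2 + 2 * h))) / (2 * h) := by linarith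
  rw [le_div_iff₀ (by positivity)] at h2
  have h3 : η / (2 + 2 * h) * (2 + 2 * h) = η := by field_simp
  unfold realEnergy
  linarith

lemma InternalDensity.exists_minimizer (hF : InternalDensity F) (hVc : Continuous Vf)
    (hV : ∀ x, 0 ≤ Vf x) (hμ : μ ∈ P2ac n) (hh : 0 < h) (hσ : FiniteEnergy F Vf σ) :
    ∃ ρ, FiniteEnergy F Vf ρ ∧
      ∀ ρ', FiniteEnergy F Vf ρ' → realEnergy h F Vf μ ρ ≤ realEnergy h F Vf μ ρ' := by
  obtain ⟨K, hK0, hK⟩ := hF.exists_add_compensator_nonneg n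
  obtain ⟨c, hc, hbound⟩ := exists_energy_bound (F := F) hK0 hV hμ hh
  set S : Set ℝ := realEnergy h F Vf μ '' {ρ | FiniteEnergy F Vf ρ} with hS
  have hbdd : BddBelow S := by
    refine ⟨-c, ?_⟩
    rintro _ ⟨ρ, hρ, rfl⟩
    have h1 := hbound ρ hρ
    have h2 := mul_nonneg hh.le (integral_add_compensator_nonneg hK ρ)
    linarith [sq_nonneg (W2 ρ μ)]
  obtain ⟨a, ha, hat, haS⟩ := exists_seq_tendsto_sInf (S := S) ⟨_, σ, hσ, rfl⟩ hbdd
  choose ρs hρs hρa using haS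
  have hinf : ∀ ρ', FiniteEnergy F Vf ρ' → sInf S ≤ realEnergy h F Vf μ ρ' :=
    fun ρ' hρ' => csInf_le hbdd ⟨ρ', hρ', rfl⟩
  have hB : ∀ k, W2 (ρs k) μ ^ 2 / 2 +
      2 * h * ∫ x, (F (dens (ρs k) x) + K * compensator x (dens (ρs k) x)) ≤ a 0 + c := fun k => by
    have := hbound _ (hρs k)
    rw [hρa] at this
    linarith [ha (Nat.zero_le k)]
  have hac : 0 ≤ a 0 + c := by
    have := mul_nonneg hh.le (integral_add_compensator_nonneg hK (ρs 0))
    linarith [hB 0, sq_nonneg (W2 (ρs 0) μ)]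
  set M : ℝ := 4 * (a 0 + c) + 2 * (M2 μ).toReal + (a 0 + c) / (2 * h) with hM
  have hM0 : 0 ≤ M := by positivity
  have hM2 : ∀ k, (M2 (ρs k)).toReal ≤ M := fun k => by
    have h1 := toReal_M2_le (hρs k).1 hμ
    have h2 := mul_nonneg hh.le (integral_add_compensator_nonneg hK (ρs k))
    have h3 : 0 ≤ (a 0 + c) / (2 * h) := by positivity
    linarith [hB k]
  have hMF : ∀ k, ∫ x, (F (dens (ρs k) x) + K * compensator x (dens (ρs k) x)) ≤ M := fun k => by
    have h3 : ∫ x, (F (dens (ρs k) x) + K * compensator x (dens (ρs k) x)) ≤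
        (a 0 + c) / (2 * h) := by
      rw [le_div_iff₀ (by positivity)]
      linarith [hB k, sq_nonneg (W2 (ρs k) μ)]
    have h4 : 0 ≤ 4 * (a 0 + c) + 2 * (M2 μ).toReal := by positivity
    linarith
  have hcauchy : ∀ ε > 0, ∃ N, ∀ j ≥ N, ∀ k ≥ N,
      ∫ x, (1 + ‖x‖) * |dens (ρs j) x - dens (ρs k) x| ≤ ε := by
    intro ε hε
    obtain ⟨δ, hδ, hmain⟩ := integral_one_add_norm_mul_abs_sub_le hF hK hK0 hM0 hε
    have hev := hat.eventually (ge_mem_nhds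
      (lt_add_of_pos_right (sInf S) (by positivity : 0 < 2 * h * δ)))
    obtain ⟨N, hN⟩ := eventually_atTop.1 hev
    refine ⟨N, fun j hj k hk => ?_⟩
    obtain ⟨hmid, hgap⟩ := hF.finiteEnergy_midMeasure hK (hρs j) (hρs k)
    refine hmain _ _ (dens_nonneg _) (dens_nonneg _) (integrable_norm_sq_mul_dens (hρs j).1)
      (integrable_norm_sq_mul_dens (hρs k).1) ?_ ?_ ((hρs j).integrable_add_compensator K)
      ((hρs k).integrable_add_compensator K) (hMF j) (hMF k) hgap ?_
    · rw [integral_norm_sq_mul_dens (hρs j).1]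
      exact hM2 j
    · rw [integral_norm_sq_mul_dens (hρs k).1]
      exact hM2 k
    · have h1 := hF.realEnergy_midMeasure_le (h := h) hK hμ (hρs j) (hρs k)
      rw [hρa, hρa] at h1
      have h2 := hinf _ hmid
      refine le_of_mul_le_mul_left ?_ (by positivity : 0 < 2 * h)
      linarith [hN j hj, hN k hk]
  obtain ⟨ρ, hρ, hlim, φ, hφ, hae⟩ := exists_limit_of_cauchy (fun k => (hρs k).1) hM2 hcauchy
  obtain ⟨hfin, hle⟩ := hF.realEnergy_le_of_tendsto hK hVc hV hμ hh hρs hρ hlim hφ hae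
    (hat.congr fun k => (hρa k).symm)
  exact ⟨ρ, hfin, fun ρ' hρ' => hle.trans (hinf ρ' hρ')⟩

lemma InternalDensity.minimizer_unique (hF : InternalDensity F) (hμ : μ ∈ P2ac n) (hh : 0 < h)
    (hρ : FiniteEnergy F Vf ρ) (hσ : FiniteEnergy F Vf σ)
    (hρmin : ∀ ρ', FiniteEnergy F Vf ρ' → realEnergy h F Vf μ ρ ≤ realEnergy h F Vf μ ρ')
    (hσmin : ∀ ρ', FiniteEnergy F Vf ρ' → realEnergy h F Vf μ σ ≤ realEnergy h F Vf μ ρ') :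
    ρ = σ := by
  have := hρ.1.1
  have := hσ.1.1
  obtain ⟨K, -, hK⟩ := hF.exists_add_compensator_nonneg n
  obtain ⟨hmid, hgap⟩ := hF.finiteEnergy_midMeasure hK hρ hσ
  have h1 := hF.realEnergy_midMeasure_le (h := h) hK hμ hρ hσ
  have h0 : ∀ x, 0 ≤ convexGap F (dens ρ x) (dens σ x) := fun x =>
    hF.convexGap_nonneg (dens_nonneg ρ x) (dens_nonneg σ x)
  have hzero : ∫ x, convexGap F (dens ρ x) (dens σ x) = 0 := by
    refine le_antisymm (le_of_mul_le_mul_left ?_ (by positivity : 0 < 2 * h)) (integral_nonneg h0)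
    linarith [hρmin _ hmid, hσmin _ hmid]
  have hae := (integral_eq_zero_iff_of_nonneg h0 hgap).1 hzero
  rw [← withDensity_dens hρ.1.2.1, ← withDensity_dens hσ.1.2.1]
  refine withDensity_congr_ae ?_
  filter_upwards [hae] with x hx
  by_contra hne
  exact (hF.convexGap_pos (dens_nonneg ρ x) (dens_nonneg σ x) fun heq => hne (by rw [heq])).ne' hx

end Direct

/-- Proposition 3.1: existence and uniqueness of the
semi-implicit JKO minimizer for one step. -/
theorem jko_step_exists_unique (n l : ℕ) (hl : 0 < l)
    (m : Fin l → ℝ) (hm : ∀ i, 1 ≤ m i)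
    (F : Fin l → ℝ → ℝ) (hF : ∀ i, HmClass (m i) (F i))
    (V : Fin l → (Fin l → Measure (Rn n)) → Rn n → ℝ) (hV : VHyp V)
    (ρ₀ : Fin l → Measure (Rn n)) (hρ₀ : ∀ i, ρ₀ i ∈ P2ac n)
    (hinit : ∀ i, FfuncE (F i) (ρ₀ i) + VfuncE (V i ρ₀) (ρ₀ i) < ⊤)
    (h : ℝ) (hh : 0 < h) (i : Fin l) :
    ∃ ρ1 ∈ P2ac n,
      (∀ ρ ∈ P2ac n,
        JKOEnergy h (F i) (V i ρ₀) (ρ₀ i) ρ1 ≤ JKOEnergy h (F i) (V i ρ₀) (ρ₀ i) ρ) ∧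
      ∀ ρ1' ∈ P2ac n,
        (∀ ρ ∈ P2ac n,
          JKOEnergy h (F i) (V i ρ₀) (ρ₀ i) ρ1' ≤ JKOEnergy h (F i) (V i ρ₀) (ρ₀ i) ρ) →
        ρ1' = ρ1 := by
  have hdens := (hF i).internalDensity
  have hprob : ρ₀ ∈ ProbTuple l n := fun j => (hρ₀ j).1
  have hVc : Continuous (V i ρ₀) := (hV.1 i ρ₀ hprob).continuous
  have hV0 : ∀ x, 0 ≤ V i ρ₀ x := hV.2.1 i ρ₀ hprob
  have hfin := finiteEnergy_of_lt_top (hρ₀ i) (hinit i)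
  obtain ⟨ρ1, hρ1, hmin⟩ := hdens.exists_minimizer hVc hV0 (hρ₀ i) hh hfin
  refine ⟨ρ1, hρ1.1, fun ρ hρ => ?_, fun ρ1' hρ1' hmin' => ?_⟩
  · by_cases hρfin : FiniteEnergy (F i) (V i ρ₀) ρ
    · rw [JKOEnergy_eq_realEnergy hρ1, JKOEnergy_eq_realEnergy hρfin]
      exact EReal.coe_le_coe_iff.2 (hmin ρ hρfin)
    · rw [JKOEnergy_eq_top hρ hρfin hh]
      exact le_top
  · have hρ1fin : FiniteEnergy (F i) (V i ρ₀) ρ1' := by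
      by_contra hne
      have h1 := hmin' ρ1 hρ1.1
      rw [JKOEnergy_eq_top hρ1' hne hh, JKOEnergy_eq_realEnergy hρ1] at h1
      exact EReal.coe_ne_top _ (top_le_iff.1 h1)
    refine hdens.minimizer_unique (hρ₀ i) hh hρ1fin hρ1 (fun ρ hρ => ?_) hmin
    have h1 := hmin' ρ hρ.1
    rw [JKOEnergy_eq_realEnergy hρ1fin, JKOEnergy_eq_realEnergy hρ] at h1
    exact EReal.coe_le_coe_iff.1 h1

end Paper
end
end

section
/- Coercivity of the Sobolev–moment functional on ℝⁿ: For m > 1, define G : L^m(ℝⁿ) → [0,+∞] by G(ρ) := ‖ρ^{m/2}‖_{H¹(ℝⁿ)} + M(ρ) if ρ ∈ P₂^{ac}(ℝⁿ) and ρ^{m/2} ∈ H¹(ℝⁿ), and G(ρ) := +∞ otherwise. Then G is lower semicontinuous on L^m(ℝⁿ) and its sublevel sets {ρ : G(ρ) ≤ c} are relatively compact in L^m(ℝⁿ). -/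
open MeasureTheory Filter Topology Set
open scoped ENNReal NNReal RealInnerProductSpace Classical

noncomputable section

namespace Paper

variable {n l : ℕ}

/-- The Sobolev–moment functional `G(ρ) = ‖ρ^{m/2}‖_{H¹(ℝⁿ)} + M(ρ)` on
`L^m(ℝⁿ)` (`+∞` unless `ρ` is a probability density with `ρ^{m/2} ∈ H¹`;
an infinite second moment or a non-`L²` weak gradient also gives `+∞`). -/
def sobolevMomentG (n : ℕ) (m : ℝ)
    (ρ : Lp ℝ (ENNReal.ofReal m) (volume : Measure (Rn n))) : ℝ≥0∞ :=
  if (0 ≤ᵐ[volume] fun x => ρ x) ∧ (∫⁻ x, ENNReal.ofReal (ρ x) = 1)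
  then
    ⨅ g ∈ {g : Rn n → Rn n | HasWeakGradient (fun x => (ρ x) ^ (m / 2)) g},
      (((∫⁻ x, ENNReal.ofReal (((ρ x) ^ (m / 2)) ^ 2))
          + ∫⁻ x, ENNReal.ofReal (‖g x‖ ^ 2)) ^ ((1 : ℝ) / 2)
        + ∫⁻ x, (‖x‖₊ : ℝ≥0∞) ^ 2 * ENNReal.ofReal (ρ x))
  else ⊤

theorem exists_subseq_tendsto_inner {H : Type*} [NormedAddCommGroup H] [InnerProductSpace ℝ H]
    [CompleteSpace H] [TopologicalSpace.SeparableSpace H] {g : ℕ → H} {C : ℝ}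
    (hg : ∀ k, ‖g k‖ ≤ C) :
    ∃ (a : H) (φ : ℕ → ℕ), StrictMono φ ∧
      ∀ h, Tendsto (fun k => ⟪g (φ k), h⟫) atTop (𝓝 ⟪a, h⟫) := by
  have hmem : ∀ k, StrongDual.toWeakDual (InnerProductSpace.toDual ℝ H (g k)) ∈
      WeakDual.toStrongDual ⁻¹' Metric.closedBall (0 : StrongDual ℝ H) C := by
    intro k
    simpa using hg k
  obtain ⟨a, -, φ, hφ, ha⟩ := WeakDual.isSeqCompact_closedBall ℝ H 0 C hmem
  refine ⟨(InnerProductSpace.toDual ℝ H).symm (WeakDual.toStrongDual a), φ, hφ, fun h => ?_⟩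
  have := ((WeakDual.eval_continuous h).tendsto a).comp ha
  simpa [Function.comp_def] using this

theorem abs_sub_rpow_le {p q δ : ℝ} (hp : 0 < p) (hq : 0 < q) (hδ : 0 < δ) :
    ∃ C : ℝ, 0 ≤ C ∧ ∀ a b : ℝ, 0 ≤ a → 0 ≤ b →
      |a - b| ^ p ≤ δ * (a ^ p + b ^ p) + C * |a ^ (p / q) - b ^ (p / q)| ^ q := by
  set s := min (δ ^ (1 / p)) (1 / 2)
  have hs0 : 0 < s := lt_min (by positivity) (by norm_num)
  have hs1 : s ≤ 1 / 2 := min_le_right _ _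
  have hsδ : s ^ p ≤ δ := by
    calc s ^ p ≤ (δ ^ (1 / p)) ^ p := by gcongr; exact min_le_left _ _
      _ = δ := by rw [← Real.rpow_mul hδ.le]; simp [hp.ne']
  have hr : 0 < p / q := by positivity
  set c := 1 - (1 - s) ^ (p / q)
  have hc : 0 < c := sub_pos.2 (Real.rpow_lt_one (by linarith) (by linarith) hr)
  have key : ∀ a b : ℝ, 0 ≤ b → b ≤ a →
      |a - b| ^ p ≤ δ * (a ^ p + b ^ p) + (c ^ q)⁻¹ * |a ^ (p / q) - b ^ (p / q)| ^ q := by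
    intro a b hb hab
    have ha : 0 ≤ a := hb.trans hab
    rw [abs_of_nonneg (sub_nonneg.2 hab)]
    by_cases h : (1 - s) * a ≤ b
    · calc (a - b) ^ p ≤ (s * a) ^ p := by
            apply Real.rpow_le_rpow <;> linarith
        _ = s ^ p * a ^ p := Real.mul_rpow hs0.le ha
        _ ≤ δ * a ^ p := by gcongr
        _ ≤ δ * (a ^ p + b ^ p) := by
            gcongr; linarith [Real.rpow_nonneg hb p]
        _ ≤ _ := le_add_of_nonneg_right (by positivity)
    · have h1 : c * a ^ (p / q) ≤ |a ^ (p / q) - b ^ (p / q)| := by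
        refine le_trans ?_ (le_abs_self _)
        have : b ^ (p / q) ≤ ((1 - s) * a) ^ (p / q) := by
          gcongr; exact (not_le.1 h).le
        rw [Real.mul_rpow (by linarith) ha] at this
        simp only [c]; linarith
      calc (a - b) ^ p ≤ a ^ p := by apply Real.rpow_le_rpow <;> linarith
        _ = (c ^ q)⁻¹ * (c * a ^ (p / q)) ^ q := by
            rw [Real.mul_rpow hc.le (by positivity), ← Real.rpow_mul ha,
              div_mul_cancel₀ _ hq.ne', inv_mul_cancel_left₀ (by positivity)]
        _ ≤ (c ^ q)⁻¹ * |a ^ (p / q) - b ^ (p / q)| ^ q := by gcongr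
        _ ≤ _ := le_add_of_nonneg_left (by positivity)
  refine ⟨(c ^ q)⁻¹, by positivity, fun a b ha hb => ?_⟩
  rcases le_total b a with h | h
  · exact key a b hb h
  · have := key b a ha h
    rwa [abs_sub_comm, add_comm (b ^ p), abs_sub_comm (b ^ (p / q))] at this

theorem tendsto_lintegral_sub_of_tendsto_rpow_sub {α ι : Type*} [MeasurableSpace α] {μ : Measure α}
    {l : Filter ι} {p q : ℝ} (hp : 0 < p) (hq : 0 < q) {f g : ι → α → ℝ} {M : ℝ≥0∞} (hM : M ≠ ⊤)
    (hfm : ∀ i, AEMeasurable (f i) μ) (hgm : ∀ i, AEMeasurable (g i) μ)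
    (hf : ∀ i, 0 ≤ᵐ[μ] f i) (hg : ∀ i, 0 ≤ᵐ[μ] g i)
    (hfM : ∀ i, ∫⁻ x, ‖f i x‖ₑ ^ p ∂μ ≤ M) (hgM : ∀ i, ∫⁻ x, ‖g i x‖ₑ ^ p ∂μ ≤ M)
    (h : Tendsto (fun i => ∫⁻ x, ‖f i x ^ (p / q) - g i x ^ (p / q)‖ₑ ^ q ∂μ) l (𝓝 0)) :
    Tendsto (fun i => ∫⁻ x, ‖f i x - g i x‖ₑ ^ p ∂μ) l (𝓝 0) := by
  have key : ∀ δ : ℝ≥0, 0 < δ → ∃ C : ℝ≥0, ∀ i, ∫⁻ x, ‖f i x - g i x‖ₑ ^ p ∂μ ≤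
      δ * (M + M) + C * ∫⁻ x, ‖f i x ^ (p / q) - g i x ^ (p / q)‖ₑ ^ q ∂μ := by
    intro δ hδ
    obtain ⟨C, hC, hab⟩ := abs_sub_rpow_le hp hq (NNReal.coe_pos.2 hδ)
    lift C to ℝ≥0 using hC
    refine ⟨C, fun i => ?_⟩
    calc ∫⁻ x, ‖f i x - g i x‖ₑ ^ p ∂μ
        ≤ ∫⁻ x, (δ * (‖f i x‖ₑ ^ p + ‖g i x‖ₑ ^ p) +
            C * ‖f i x ^ (p / q) - g i x ^ (p / q)‖ₑ ^ q) ∂μ := by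
          apply lintegral_mono_ae
          filter_upwards [hf i, hg i] with x hx hy
          have := hab _ _ hx hy
          rw [← enorm_norm (f i x - g i x), ← enorm_norm (f i x ^ (p / q) - g i x ^ (p / q))]
          simp only [Real.norm_eq_abs]
          rw [Real.enorm_of_nonneg (abs_nonneg _), Real.enorm_of_nonneg (abs_nonneg _),
            Real.enorm_of_nonneg hx, Real.enorm_of_nonneg hy,
            ENNReal.ofReal_rpow_of_nonneg (abs_nonneg _) hp.le,
            ENNReal.ofReal_rpow_of_nonneg (abs_nonneg _) hq.le,
            ENNReal.ofReal_rpow_of_nonneg hx hp.le, ENNReal.ofReal_rpow_of_nonneg hy hp.le,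
            ← ENNReal.ofReal_coe_nnreal, ← ENNReal.ofReal_coe_nnreal,
            ← ENNReal.ofReal_add (Real.rpow_nonneg hx _) (Real.rpow_nonneg hy _),
            ← ENNReal.ofReal_mul δ.coe_nonneg, ← ENNReal.ofReal_mul C.coe_nonneg, ← ENNReal.ofReal_add]
          · exact ENNReal.ofReal_le_ofReal this
          · exact mul_nonneg δ.coe_nonneg (add_nonneg (Real.rpow_nonneg hx _) (Real.rpow_nonneg hy _))
          · positivity
      _ = δ * (∫⁻ x, ‖f i x‖ₑ ^ p ∂μ + ∫⁻ x, ‖g i x‖ₑ ^ p ∂μ) +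
            C * ∫⁻ x, ‖f i x ^ (p / q) - g i x ^ (p / q)‖ₑ ^ q ∂μ := by
          have h1 := hfm i
          have h2 := hgm i
          rw [lintegral_add_left' (by fun_prop), lintegral_const_mul' _ _ (by simp),
            lintegral_const_mul' _ _ (by simp), lintegral_add_left' (by fun_prop)]
      _ ≤ _ := by gcongr <;> simp [hfM, hgM]
  rw [ENNReal.tendsto_nhds_zero]
  intro ε hε
  obtain ⟨δ, hδ, hδε⟩ : ∃ δ : ℝ≥0, 0 < δ ∧ δ * (M + M) < ε := by
    have : Tendsto (fun δ : ℝ≥0 => (δ : ℝ≥0∞) * (M + M)) (𝓝 0) (𝓝 0) := by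
      have := ENNReal.Tendsto.mul_const (b := M + M)
        (ENNReal.tendsto_coe.2 (tendsto_id (α := ℝ≥0) (x := 𝓝 0))) (Or.inr (by simp [hM]))
      simpa using this
    have h2 := (this.eventually (gt_mem_nhds hε)).filter_mono (nhdsWithin_le_nhds (s := Ioi 0))
    obtain ⟨δ, h3, h4⟩ := (h2.and self_mem_nhdsWithin).exists
    exact ⟨δ, h4, h3⟩
  obtain ⟨C, hC⟩ := key δ hδ
  have hlim : Tendsto (fun i => δ * (M + M) +
      C * ∫⁻ x, ‖f i x ^ (p / q) - g i x ^ (p / q)‖ₑ ^ q ∂μ) l (𝓝 (δ * (M + M))) := by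
    have := (ENNReal.Tendsto.const_mul h (Or.inr (ENNReal.coe_ne_top (r := C)))).const_add
      ((δ : ℝ≥0∞) * (M + M))
    simpa using this
  filter_upwards [hlim.eventually (gt_mem_nhds hδε)] with i hi
  exact (hC i).trans hi.le

theorem integral_inner_eq_inner_toLp {α E : Type*} [MeasurableSpace α] {μ : Measure α}
    [NormedAddCommGroup E] [InnerProductSpace ℝ E] {f g : α → E} (hf : MemLp f 2 μ)
    (hg : MemLp g 2 μ) : ∫ x, ⟪f x, g x⟫ ∂μ = ⟪hf.toLp f, hg.toLp g⟫ := by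
  rw [L2.inner_def]
  apply integral_congr_ae
  filter_upwards [hf.coeFn_toLp, hg.coeFn_toLp] with x h1 h2
  rw [h1, h2]

theorem abs_integral_inner_le {α E : Type*} [MeasurableSpace α] {μ : Measure α}
    [NormedAddCommGroup E] [InnerProductSpace ℝ E] {f g : α → E} (hf : MemLp f 2 μ)
    (hg : MemLp g 2 μ) :
    |∫ x, ⟪f x, g x⟫ ∂μ| ≤ (eLpNorm f 2 μ).toReal * (eLpNorm g 2 μ).toReal := by
  rw [integral_inner_eq_inner_toLp hf hg]
  simpa using abs_real_inner_le_norm (hf.toLp f) (hg.toLp g)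

theorem abs_integral_mul_le {α : Type*} [MeasurableSpace α] {μ : Measure α}
    {f g : α → ℝ} (hf : MemLp f 2 μ) (hg : MemLp g 2 μ) :
    |∫ x, f x * g x ∂μ| ≤ (eLpNorm f 2 μ).toReal * (eLpNorm g 2 μ).toReal := by
  simpa [mul_comm] using abs_integral_inner_le hf hg

theorem HasWeakGradient.integral_mul_fderiv {u : Rn n → ℝ} {g : Rn n → Rn n}
    (h : HasWeakGradient u g) (hu : MemLp u 2 volume) (hg : MemLp g 2 volume) {φ : Rn n → ℝ}
    (hφ : ContDiff ℝ (⊤ : ℕ∞) φ) (hφc : HasCompactSupport φ) (v : Rn n) :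
    ∫ x, u x * fderiv ℝ φ x v = - ∫ x, ⟪g x, v⟫ * φ x := by
  have hv : v = ∑ j, v j • EuclideanSpace.single j (1 : ℝ) := by
    simpa using ((EuclideanSpace.basisFun (Fin n) ℝ).sum_repr v).symm
  have hφ2 : MemLp φ 2 volume := hφ.continuous.memLp_of_hasCompactSupport hφc
  have hdφ : ∀ w : Rn n, MemLp (fun x => fderiv ℝ φ x w) 2 volume := fun w =>
    ((hφ.continuous_fderiv (by simp)).clm_apply continuous_const).memLp_of_hasCompactSupport
      (hφc.fderiv_apply ℝ w)
  have hgi : ∀ w : Rn n, MemLp (fun x => ⟪g x, w⟫) 2 volume := fun w => hg.inner_const w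
  conv_lhs => rw [hv]
  conv_rhs => rw [hv]
  simp only [map_sum, map_smul, smul_eq_mul, inner_sum, inner_smul_right, Finset.mul_sum,
    Finset.sum_mul]
  rw [integral_finsetSum, integral_finsetSum, ← Finset.sum_neg_distrib]
  · refine Finset.sum_congr rfl fun j _ => ?_
    have := h.2.2 φ hφ hφc j
    simp_rw [mul_left_comm _ (v j), mul_assoc, integral_const_mul]
    rw [this]; ring
  · intro j _
    simp_rw [mul_assoc]
    exact ((hgi _).integrable_mul hφ2).const_mul _
  · intro j _
    simp_rw [mul_left_comm _ (v j)]
    exact (hu.integrable_mul (hdφ _)).const_mul _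

theorem eLpNorm_two_le_of_forall_abs_integral_mul_le {w : Rn n → ℝ} (hw : MemLp w 2 volume)
    {K : ℝ} (hK : 0 ≤ K) (h : ∀ φ : Rn n → ℝ, ContDiff ℝ (⊤ : ℕ∞) φ → HasCompactSupport φ →
      |∫ x, w x * φ x| ≤ K * (eLpNorm φ 2 volume).toReal) :
    (eLpNorm w 2 volume).toReal ≤ K := by
  set N := (eLpNorm w 2 volume).toReal with hN
  have hN0 : 0 ≤ N := ENNReal.toReal_nonneg
  have hsq : ∫ x, w x * w x = N * N := by
    have := integral_inner_eq_inner_toLp hw hw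
    rw [real_inner_self_eq_norm_mul_norm, Lp.norm_toLp] at this
    exact this
  have key : ∀ ε : ℝ, 0 < ε → N * N ≤ K * (N + ε) + N * ε := by
    intro ε hε
    obtain ⟨φ, hφc, hφ, hle⟩ := hw.exist_eLpNorm_sub_le (by simp) (by simp) hε
    have hφ2 : MemLp φ 2 volume := hφ.continuous.memLp_of_hasCompactSupport hφc
    have hd : MemLp (w - φ) 2 volume := hw.sub hφ2
    have hle' : (eLpNorm (w - φ) 2 volume).toReal ≤ ε := ENNReal.toReal_le_of_le_ofReal hε.le hle
    have hφN : (eLpNorm φ 2 volume).toReal ≤ N + ε := by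
      have h1 : eLpNorm φ 2 volume ≤ eLpNorm w 2 volume + eLpNorm (w - φ) 2 volume := by
        have := eLpNorm_sub_le hw.1 hd.1 (p := 2) (by simp)
        simpa using this
      have h2 := ENNReal.toReal_mono (ENNReal.add_ne_top.2 ⟨hw.2.ne, hd.2.ne⟩) h1
      rw [ENNReal.toReal_add hw.2.ne hd.2.ne] at h2
      linarith
    have hsplit : ∫ x, w x * w x = (∫ x, w x * φ x) + ∫ x, w x * (w - φ) x := by
      have := integral_add (hw.integrable_mul hφ2) (hw.integrable_mul hd)
      simp only [Pi.mul_apply] at this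
      rw [← this]
      congr 1; ext x; simp only [Pi.sub_apply]; ring
    rw [← hsq, hsplit]
    have h1 := le_of_abs_le (h φ hφ hφc)
    have h2 := le_of_abs_le (abs_integral_mul_le hw hd)
    have h3 : K * (eLpNorm φ 2 volume).toReal ≤ K * (N + ε) := by gcongr
    have h4 : N * (eLpNorm (w - φ) 2 volume).toReal ≤ N * ε := by gcongr
    linarith
  have hlim : N * N ≤ K * N := by
    have ht : Tendsto (fun ε : ℝ => K * (N + ε) + N * ε) (𝓝[>] 0) (𝓝 (K * (N + 0) + N * 0)) :=
      tendsto_nhdsWithin_of_tendsto_nhds (by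
        have : Continuous fun ε : ℝ => K * (N + ε) + N * ε := by fun_prop
        exact this.tendsto 0)
    have := ge_of_tendsto ht (eventually_mem_nhdsWithin.mono fun ε hε => key ε hε)
    simpa using this
  by_contra! hlt
  have : 0 < N := hK.trans_lt hlt
  nlinarith

theorem hasDerivAt_integral_mul_comp_sub {u : Rn n → ℝ} (hu : LocallyIntegrable u volume)
    {φ : Rn n → ℝ} (hφ : ContDiff ℝ (⊤ : ℕ∞) φ) (hφc : HasCompactSupport φ) (v : Rn n) (t : ℝ) :
    HasDerivAt (fun t : ℝ => ∫ x, u x * φ (x - t • v))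
      (- ∫ x, u x * fderiv ℝ φ (x - t • v) v) t := by
  set ψ : Rn n → ℝ := fun z => φ (-z)
  have hψ : ContDiff ℝ 1 ψ := (hφ.comp contDiff_neg).of_le (by simp)
  have hψc : HasCompactSupport ψ := hφc.comp_homeomorph (Homeomorph.neg _)
  have hd : ∀ z, fderiv ℝ ψ z v = - fderiv ℝ φ (-z) v := by
    intro z
    have h1 : HasFDerivAt φ (fderiv ℝ φ (-z)) (-z) :=
      (hφ.differentiable (by simp)).differentiableAt.hasFDerivAt
    have h2 := (h1.comp z (hasFDerivAt_id z).neg).fderiv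
    change fderiv ℝ ψ z = _ at h2
    rw [h2]; simp
  have h1 := hψc.hasFDerivAt_convolution_right (ContinuousLinearMap.mul ℝ ℝ) hu hψ (t • v)
  have h2 : HasDerivAt (fun t : ℝ => t • v) v t := by
    simpa using (hasDerivAt_id t).smul_const v
  have h3 := h1.comp_hasDerivAt t h2
  rw [convolution_precompR_apply _ hu (hψc.fderiv ℝ) (hψ.continuous_fderiv one_ne_zero)] at h3
  simp only [convolution_def, Function.comp_def, ContinuousLinearMap.mul_apply', hd, ψ,
    neg_sub, mul_neg, integral_neg] at h3
  exact h3

theorem HasWeakGradient.eLpNorm_translate_sub_le {u : Rn n → ℝ} {g : Rn n → Rn n}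
    (h : HasWeakGradient u g) (hu : MemLp u 2 volume) (hg : MemLp g 2 volume) (v : Rn n) :
    eLpNorm (fun x => u (x + v) - u x) 2 volume ≤ ENNReal.ofReal ‖v‖ * eLpNorm g 2 volume := by
  have huv : MemLp (fun x => u (x + v)) 2 volume :=
    hu.comp_measurePreserving (measurePreserving_add_right volume v)
  have hw : MemLp (fun x => u (x + v) - u x) 2 volume := huv.sub hu
  have hK : (0 : ℝ) ≤ ‖v‖ * (eLpNorm g 2 volume).toReal := by positivity
  have main : (eLpNorm (fun x => u (x + v) - u x) 2 volume).toReal ≤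
      ‖v‖ * (eLpNorm g 2 volume).toReal := by
    refine eLpNorm_two_le_of_forall_abs_integral_mul_le hw hK fun φ hφ hφc => ?_
    have htrans : ∀ t : ℝ, ContDiff ℝ (⊤ : ℕ∞) (fun x => φ (x - t • v)) ∧
        HasCompactSupport (fun x => φ (x - t • v)) := fun t =>
      ⟨hφ.comp (contDiff_id.sub contDiff_const),
        hφc.comp_homeomorph (Homeomorph.subRight (t • v))⟩
    have hφ2 : ∀ t : ℝ, MemLp (fun x => φ (x - t • v)) 2 volume := fun t =>
      (htrans t).1.continuous.memLp_of_hasCompactSupport (htrans t).2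
    have hφn : ∀ t : ℝ, eLpNorm (fun x => φ (x - t • v)) 2 volume = eLpNorm φ 2 volume := fun t =>
      eLpNorm_comp_measurePreserving hφ.continuous.aestronglyMeasurable
        (measurePreserving_sub_right volume (t • v))
    have hbound : ∀ t : ℝ, |- ∫ x, u x * fderiv ℝ φ (x - t • v) v| ≤
        ‖v‖ * (eLpNorm g 2 volume).toReal * (eLpNorm φ 2 volume).toReal := by
      intro t
      have h1 := h.integral_mul_fderiv hu hg (htrans t).1 (htrans t).2 v
      simp_rw [fderiv_comp_sub] at h1
      rw [h1, neg_neg]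
      have h2 : ∀ x, ⟪g x, v⟫ * φ (x - t • v) = ⟪g x, φ (x - t • v) • v⟫ := fun x => by
        rw [inner_smul_right, mul_comm]
      simp_rw [h2]
      have hs : MemLp (fun x => φ (x - t • v) • v) 2 volume := 
        ((htrans t).1.continuous.smul continuous_const).memLp_of_hasCompactSupport
          (htrans t).2.smul_right
      refine (abs_integral_inner_le hg hs).trans ?_
      have h3 : (eLpNorm (fun x => φ (x - t • v) • v) 2 volume).toReal ≤
          ‖v‖ * (eLpNorm φ 2 volume).toReal := by
        have := eLpNorm_le_mul_eLpNorm_of_ae_le_mul (p := 2) (μ := volume) (c := ‖v‖)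
          (f := fun x => φ (x - t • v) • v) (g := fun x => φ (x - t • v))
          (Eventually.of_forall fun x => by rw [norm_smul, mul_comm])
        rw [hφn] at this
        have h4 := ENNReal.toReal_mono (ENNReal.mul_ne_top (by simp) (by
          rw [← hφn 0]; exact (hφ2 0).2.ne)) this
        simpa using h4
      calc (eLpNorm g 2 volume).toReal * (eLpNorm (fun x => φ (x - t • v) • v) 2 volume).toReal
          ≤ (eLpNorm g 2 volume).toReal * (‖v‖ * (eLpNorm φ 2 volume).toReal) := by gcongr
        _ = _ := by ring
    have hmv := norm_image_sub_le_of_norm_deriv_le_segment_01'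
      (f := fun t : ℝ => ∫ x, u x * φ (x - t • v))
      (fun t _ => (hasDerivAt_integral_mul_comp_sub h.1 hφ hφc v t).hasDerivWithinAt)
      (fun t _ => hbound t)
    have hshift : ∫ x, u (x + v) * φ x = ∫ x, u x * φ (x - v) := by
      rw [← integral_add_right_eq_self (fun x => u x * φ (x - v)) v]
      simp
    have hφ2' : MemLp φ 2 volume := by simpa using hφ2 0
    simp_rw [sub_mul]
    have hsub := integral_sub (huv.integrable_mul hφ2') (hu.integrable_mul hφ2')
    simp only [Pi.mul_apply] at hsub
    rw [hsub, hshift]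
    simpa using hmv
  rw [← ENNReal.ofReal_toReal hw.2.ne, ← ENNReal.ofReal_toReal hg.2.ne,
    ← ENNReal.ofReal_mul (norm_nonneg v)]
  exact ENNReal.ofReal_le_ofReal main

/-- The average of `u` over the ball of radius `ε` around `x`. -/
def ballAverage (ε : ℝ) (u : Rn n → ℝ) (x : Rn n) : ℝ :=
  ⨍ z in Metric.ball (0 : Rn n) ε, u (x + z)

theorem stronglyMeasurable_ballAverage (ε : ℝ) {u : Rn n → ℝ} (hu : StronglyMeasurable u) :
    StronglyMeasurable (ballAverage ε u) := by
  have h : StronglyMeasurable (fun p : Rn n × Rn n => u (p.1 + p.2)) :=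
    hu.comp_measurable measurable_add
  exact h.integral_prod_right

theorem exists_ballAverage_eq_inner (ε : ℝ) :
    ∃ (I : Rn n → Lp ℝ 2 (volume : Measure (Rn n))) (K : ℝ), (∀ x, ‖I x‖ ≤ K) ∧
      ∀ (u : Rn n → ℝ) (hu : MemLp u 2 volume) (x : Rn n),
        ballAverage ε u x = ⟪hu.toLp u, I x⟫ := by
  set c := volume.real (Metric.ball (0 : Rn n) ε)
  have hfin : ∀ x : Rn n, volume (Metric.ball x ε) ≠ ∞ := fun x => measure_ball_lt_top.ne
  refine ⟨fun x => c⁻¹ • indicatorConstLp 2 Metric.isOpen_ball.measurableSet (hfin x) (1 : ℝ),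
    c⁻¹ * c ^ ((1 : ℝ) / 2), fun x => ?_, fun u hu x => ?_⟩
  · rw [norm_smul, norm_indicatorConstLp (by simp) (by simp)]
    simp only [measureReal_def, Measure.addHaar_ball_center, c]
    simp
  · rw [inner_smul_right, real_inner_comm, L2.inner_indicatorConstLp_one,
      setIntegral_congr_ae Metric.isOpen_ball.measurableSet
        (hu.coeFn_toLp.mono fun y hy _ => hy), ballAverage, setAverage_eq, smul_eq_mul]
    congr 1
    have hmp : MeasurePreserving (fun z : Rn n => x + z) volume volume :=
      measurePreserving_add_left volume x
    have := hmp.setIntegral_preimage_emb (measurableEmbedding_addLeft x) u (Metric.ball x ε)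
    rw [← this]
    simp

theorem enorm_integral_sq_le {α : Type*} [MeasurableSpace α] {μ : Measure α}
    [IsProbabilityMeasure μ] {f : α → ℝ} (hf : AEStronglyMeasurable f μ) :
    ‖∫ x, f x ∂μ‖ₑ ^ 2 ≤ ∫⁻ x, ‖f x‖ₑ ^ 2 ∂μ := by
  have h1 : ‖∫ x, f x ∂μ‖ₑ ≤ eLpNorm f 1 μ :=
    (enorm_integral_le_lintegral_enorm f).trans_eq eLpNorm_one_eq_lintegral_enorm.symm
  have h2 := eLpNorm_le_eLpNorm_of_exponent_le (p := 1) (q := 2) (by norm_num) hf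
  have h3 := eLpNorm_nnreal_pow_eq_lintegral (f := f) (μ := μ) (p := 2) (by norm_num)
  calc ‖∫ x, f x ∂μ‖ₑ ^ 2 ≤ eLpNorm f 2 μ ^ 2 := by gcongr; exact h1.trans h2
    _ = _ := by simpa using h3

theorem eLpNorm_two_sq {α E : Type*} [MeasurableSpace α] [NormedAddCommGroup E] {μ : Measure α}
    (f : α → E) : eLpNorm f 2 μ ^ 2 = ∫⁻ x, ‖f x‖ₑ ^ 2 ∂μ := by
  simpa using eLpNorm_nnreal_pow_eq_lintegral (f := f) (μ := μ) (p := 2) (by norm_num)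

theorem HasWeakGradient.lintegral_sub_ballAverage_le {u : Rn n → ℝ} {g : Rn n → Rn n}
    (h : HasWeakGradient u g) (hum : StronglyMeasurable u) (hu : MemLp u 2 volume)
    (hg : MemLp g 2 volume) {ε : ℝ} (hε : 0 < ε) :
    ∫⁻ x, ‖u x - ballAverage ε u x‖ₑ ^ 2 ≤ (ENNReal.ofReal ε * eLpNorm g 2 volume) ^ 2 := by
  set B := Metric.ball (0 : Rn n) ε
  set ν : Measure (Rn n) := (volume B)⁻¹ • volume.restrict B
  have hν : IsProbabilityMeasure ν := ⟨by
    simp only [ν, Measure.smul_apply, Measure.restrict_apply MeasurableSet.univ, univ_inter,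
      smul_eq_mul]
    exact ENNReal.inv_mul_cancel (Metric.measure_ball_pos _ _ hε).ne' measure_ball_lt_top.ne⟩
  have hνB : ∀ᵐ z ∂ν, z ∈ B :=
    Measure.smul_absolutelyContinuous (ae_restrict_mem Metric.isOpen_ball.measurableSet)
  have hprod : StronglyMeasurable (fun p : Rn n × Rn n => u p.1 - u (p.1 + p.2)) :=
    (hum.comp_measurable measurable_fst).sub (hum.comp_measurable measurable_add)
  have hpt : ∀ x, ‖u x - ballAverage ε u x‖ₑ ^ 2 ≤ ∫⁻ z, ‖u x - u (x + z)‖ₑ ^ 2 ∂ν := by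
    intro x
    have hshift : Integrable (fun z => u (x + z)) ν := by
      have h1 : MemLp (fun z => u (x + z)) 2 volume :=
        hu.comp_measurePreserving (measurePreserving_add_left volume x)
      have h2 : MemLp (fun z => u (x + z)) 2 ν := (h1.restrict B).smul_measure
        (ENNReal.inv_ne_top.2 (Metric.measure_ball_pos _ _ hε).ne')
      exact h2.integrable (by norm_num)
    have havg : ballAverage ε u x = ∫ z, u (x + z) ∂ν := by
      simp [ballAverage, average, ν, B]
    have : u x - ballAverage ε u x = ∫ z, (u x - u (x + z)) ∂ν := by
      rw [integral_sub (integrable_const _) hshift, havg]; simp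
    rw [this]
    exact enorm_integral_sq_le
      (hprod.comp_measurable measurable_prodMk_left).aestronglyMeasurable
  calc ∫⁻ x, ‖u x - ballAverage ε u x‖ₑ ^ 2 ≤ ∫⁻ x, ∫⁻ z, ‖u x - u (x + z)‖ₑ ^ 2 ∂ν :=
        lintegral_mono hpt
    _ = ∫⁻ z, (∫⁻ x, ‖u x - u (x + z)‖ₑ ^ 2) ∂ν := by
        rw [lintegral_lintegral_swap]
        exact (hprod.enorm.pow_const 2).aemeasurable
    _ ≤ ∫⁻ z, (ENNReal.ofReal ε * eLpNorm g 2 volume) ^ 2 ∂ν := by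
        apply lintegral_mono_ae
        filter_upwards [hνB] with z hz
        have h1 := h.eLpNorm_translate_sub_le hu hg z
        calc ∫⁻ x, ‖u x - u (x + z)‖ₑ ^ 2 = eLpNorm (fun x => u (x + z) - u x) 2 volume ^ 2 := by
              rw [eLpNorm_two_sq]
              simp_rw [← edist_eq_enorm_sub, edist_comm]
          _ ≤ (ENNReal.ofReal ‖z‖ * eLpNorm g 2 volume) ^ 2 := by gcongr
          _ ≤ _ := by
              gcongr
              simpa [B] using (mem_ball_zero_iff.1 hz).le
    _ = _ := by simp

section Density

variable {m : ℝ} {ρ : Lp ℝ (ENNReal.ofReal m) (volume : Measure (Rn n))}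

theorem lintegral_enorm_rpow_eq {α : Type*} [MeasurableSpace α] {μ : Measure α} (hm : 0 < m)
    (f : α → ℝ) : ∫⁻ x, ‖f x‖ₑ ^ m ∂μ = eLpNorm f (ENNReal.ofReal m) μ ^ m := by
  rw [eLpNorm_eq_lintegral_rpow_enorm_toReal (by simpa using hm) (by simp),
    ENNReal.toReal_ofReal hm.le, ← ENNReal.rpow_mul]
  simp [hm.ne']

theorem stronglyMeasurable_rpow (ρ : Lp ℝ (ENNReal.ofReal m) (volume : Measure (Rn n))) (r : ℝ) :
    StronglyMeasurable (fun x => ρ x ^ r) :=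
  ((Lp.stronglyMeasurable ρ).measurable.pow_const r).stronglyMeasurable

theorem enorm_rpow_half_sq (hm : 0 < m) {t : ℝ} (ht : 0 ≤ t) :
    ‖t ^ (m / 2)‖ₑ ^ 2 = ‖t‖ₑ ^ m := by
  rw [Real.enorm_rpow_of_nonneg ht (by positivity), ← ENNReal.rpow_two, ← ENNReal.rpow_mul]
  simp

theorem eLpNorm_rpow_half_sq (hm : 0 < m) (hρ : 0 ≤ᵐ[volume] fun x => ρ x) :
    eLpNorm (fun x => ρ x ^ (m / 2)) 2 volume ^ 2 = ∫⁻ x, ‖ρ x‖ₑ ^ m := by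
  rw [eLpNorm_two_sq]
  apply lintegral_congr_ae
  filter_upwards [hρ] with x hx
  exact enorm_rpow_half_sq hm hx

theorem memLp_rpow_half (hm : 0 < m) (hρ : 0 ≤ᵐ[volume] fun x => ρ x) :
    MemLp (fun x => ρ x ^ (m / 2)) 2 volume := by
  refine ⟨(stronglyMeasurable_rpow ρ _).aestronglyMeasurable, ?_⟩
  have h := eLpNorm_rpow_half_sq hm hρ
  rw [lintegral_enorm_rpow_eq hm] at h
  have h2 : eLpNorm (fun x => ρ x ^ (m / 2)) 2 volume ^ 2 < ⊤ := by
    rw [h]; exact ENNReal.rpow_lt_top_of_nonneg hm.le (Lp.eLpNorm_ne_top ρ)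
  simpa using h2

/-- The value of the Sobolev–moment functional at `ρ` for a given weak gradient `g` of `ρ^{m/2}`. -/
def sobolevMomentValue (ρ : Lp ℝ (ENNReal.ofReal m) (volume : Measure (Rn n)))
    (g : Rn n → Rn n) : ℝ≥0∞ :=
  (eLpNorm (fun x => ρ x ^ (m / 2)) 2 volume ^ 2 + eLpNorm g 2 volume ^ 2) ^ ((1 : ℝ) / 2) +
    ∫⁻ x, ‖x‖ₑ ^ 2 * ENNReal.ofReal (ρ x)

theorem sobolevMomentG_eq (ρ : Lp ℝ (ENNReal.ofReal m) (volume : Measure (Rn n))) :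
    sobolevMomentG n m ρ =
      if (0 ≤ᵐ[volume] fun x => ρ x) ∧ (∫⁻ x, ENNReal.ofReal (ρ x) = 1) then
        ⨅ g ∈ {g : Rn n → Rn n | HasWeakGradient (fun x => (ρ x) ^ (m / 2)) g},
          sobolevMomentValue ρ g
      else ⊤ := by
  have h1 : ∀ t : ℝ, ENNReal.ofReal (t ^ 2) = ‖t‖ₑ ^ 2 := fun t => by
    rw [← ofReal_norm, ← ENNReal.ofReal_pow (norm_nonneg _), Real.norm_eq_abs, sq_abs]
  simp only [sobolevMomentG, sobolevMomentValue, eLpNorm_two_sq, h1, enorm_norm]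
  rfl

theorem exists_hasWeakGradient_of_sobolevMomentG_lt {y : ℝ≥0∞} (h : sobolevMomentG n m ρ < y) :
    (0 ≤ᵐ[volume] fun x => ρ x) ∧ ∫⁻ x, ENNReal.ofReal (ρ x) = 1 ∧
      ∃ g, HasWeakGradient (fun x => ρ x ^ (m / 2)) g ∧ sobolevMomentValue ρ g < y := by
  rw [sobolevMomentG_eq] at h
  split_ifs at h with hc
  · simp only [iInf_lt_iff] at h
    obtain ⟨g, hg, hlt⟩ := h
    exact ⟨hc.1, hc.2, g, hg, hlt⟩
  · simp at h

theorem sobolevMomentG_le_sobolevMomentValue (h0 : 0 ≤ᵐ[volume] fun x => ρ x)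
    (h1 : ∫⁻ x, ENNReal.ofReal (ρ x) = 1) {g : Rn n → Rn n}
    (hg : HasWeakGradient (fun x => ρ x ^ (m / 2)) g) :
    sobolevMomentG n m ρ ≤ sobolevMomentValue ρ g := by
  rw [sobolevMomentG_eq, if_pos ⟨h0, h1⟩]
  exact iInf₂_le g hg

theorem bounds_of_sobolevMomentValue_le {g : Rn n → Rn n} {C : ℝ≥0∞}
    (h : sobolevMomentValue ρ g ≤ C) :
    eLpNorm (fun x => ρ x ^ (m / 2)) 2 volume ≤ C ∧ eLpNorm g 2 volume ≤ C ∧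
      ∫⁻ x, ‖x‖ₑ ^ 2 * ENNReal.ofReal (ρ x) ≤ C := by
  have hs : ∀ a : ℝ≥0∞, (a ^ 2) ^ ((1 : ℝ) / 2) = a := fun a => by
    rw [← ENNReal.rpow_two, ← ENNReal.rpow_mul]; simp
  refine ⟨le_trans ?_ (le_self_add.trans h), le_trans ?_ (le_self_add.trans h),
    le_add_self.trans h⟩
  · conv_lhs => rw [← hs (eLpNorm (fun x => ρ x ^ (m / 2)) 2 volume)]
    gcongr
    exact le_self_add
  · conv_lhs => rw [← hs (eLpNorm g 2 volume)]
    gcongr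
    exact le_add_self

theorem HasWeakGradient.memLp {u : Rn n → ℝ} {g : Rn n → Rn n} (h : HasWeakGradient u g)
    {C : ℝ≥0∞} (hC : C ≠ ⊤) (hg : eLpNorm g 2 volume ≤ C) : MemLp g 2 volume :=
  ⟨h.2.1.aestronglyMeasurable, hg.trans_lt hC.lt_top⟩

theorem lintegral_compl_ball_le {f : Rn n → ℝ} {C : ℝ≥0∞}
    (hf : ∫⁻ x, ‖x‖ₑ ^ 2 * ENNReal.ofReal (f x) ≤ C) {R : ℝ} (hR : 0 < R) :
    ∫⁻ x in (Metric.ball (0 : Rn n) R)ᶜ, ENNReal.ofReal (f x) ≤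
      (ENNReal.ofReal R ^ 2)⁻¹ * C := by
  have hR' : ENNReal.ofReal R ^ 2 ≠ 0 := by simpa using hR
  calc ∫⁻ x in (Metric.ball (0 : Rn n) R)ᶜ, ENNReal.ofReal (f x)
      ≤ ∫⁻ x in (Metric.ball (0 : Rn n) R)ᶜ,
          (ENNReal.ofReal R ^ 2)⁻¹ * (‖x‖ₑ ^ 2 * ENNReal.ofReal (f x)) := by
        refine setLIntegral_mono' Metric.isOpen_ball.measurableSet.compl fun x hx => ?_
        have hx' : ENNReal.ofReal R ≤ ‖x‖ₑ := by
          rw [← ofReal_norm]; exact ENNReal.ofReal_le_ofReal (by simpa using hx)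
        calc ENNReal.ofReal (f x)
            = (ENNReal.ofReal R ^ 2)⁻¹ * (ENNReal.ofReal R ^ 2 * ENNReal.ofReal (f x)) := by
              rw [← mul_assoc, ENNReal.inv_mul_cancel hR' (by simp), one_mul]
          _ ≤ _ := by gcongr
    _ ≤ ∫⁻ x, (ENNReal.ofReal R ^ 2)⁻¹ * (‖x‖ₑ ^ 2 * ENNReal.ofReal (f x)) :=
        setLIntegral_le_lintegral _ _
    _ = (ENNReal.ofReal R ^ 2)⁻¹ * ∫⁻ x, ‖x‖ₑ ^ 2 * ENNReal.ofReal (f x) :=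
        lintegral_const_mul' _ _ (by simpa using hR')
    _ ≤ _ := by gcongr

theorem lintegral_eq_one_of_tendsto [Fact (1 ≤ ENNReal.ofReal m)]
    {ρs : ℕ → Lp ℝ (ENNReal.ofReal m) (volume : Measure (Rn n))}
    (hlim : Tendsto ρs atTop (𝓝 ρ)) (hae : ∀ᵐ x, Tendsto (fun k => ρs k x) atTop (𝓝 (ρ x)))
    (h1 : ∀ k, ∫⁻ x, ENNReal.ofReal (ρs k x) = 1) {C : ℝ≥0∞} (hC : C ≠ ⊤)
    (hM : ∀ k, ∫⁻ x, ‖x‖ₑ ^ 2 * ENNReal.ofReal (ρs k x) ≤ C) :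
    ∫⁻ x, ENNReal.ofReal (ρ x) = 1 := by
  have hmeas : ∀ f : Lp ℝ (ENNReal.ofReal m) (volume : Measure (Rn n)),
      Measurable fun x => ENNReal.ofReal (f x) := fun f =>
    (Lp.stronglyMeasurable f).measurable.ennreal_ofReal
  apply le_antisymm
  · calc ∫⁻ x, ENNReal.ofReal (ρ x)
        = ∫⁻ x, liminf (fun k => ENNReal.ofReal (ρs k x)) atTop := by
          apply lintegral_congr_ae
          filter_upwards [hae] with x hx
          exact ((ENNReal.tendsto_ofReal hx).liminf_eq).symm
      _ ≤ liminf (fun k => ∫⁻ x, ENNReal.ofReal (ρs k x)) atTop :=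
          lintegral_liminf_le fun k => hmeas _
      _ = 1 := by simp [h1]
  · have hR : ∀ R : ℝ, 0 < R →
        1 ≤ (∫⁻ x, ENNReal.ofReal (ρ x)) + (ENNReal.ofReal R ^ 2)⁻¹ * C := by
      intro R hR
      set B := Metric.ball (0 : Rn n) R
      have hBm : MeasurableSet B := Metric.isOpen_ball.measurableSet
      obtain ⟨c, hc, hbd⟩ : ∃ c : ℝ≥0∞, c ≠ ⊤ ∧ ∀ k, ∫⁻ x in B, ‖ρs k x - ρ x‖ₑ ≤
          edist (ρs k) ρ * c := by
        refine ⟨(volume.restrict B) univ ^ (1 / (1 : ℝ≥0∞).toReal - 1 / (ENNReal.ofReal m).toReal),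
          ?_, fun k => ?_⟩
        · refine ENNReal.rpow_ne_top_of_nonneg ?_ (by simp [B, measure_ball_lt_top.ne])
          have h1m : 1 ≤ m := by simpa using (Fact.out : 1 ≤ ENNReal.ofReal m)
          rw [ENNReal.toReal_ofReal (by linarith)]
          simpa using inv_le_one_of_one_le₀ h1m
        · rw [← eLpNorm_one_eq_lintegral_enorm]
          refine (eLpNorm_le_eLpNorm_mul_rpow_measure_univ (Fact.out : 1 ≤ ENNReal.ofReal m)
            ((Lp.stronglyMeasurable _).sub (Lp.stronglyMeasurable _)).aestronglyMeasurable).trans ?_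
          gcongr
          rw [Lp.edist_def]
          exact eLpNorm_mono_measure _ Measure.restrict_le_self
      have hk : ∀ k, 1 ≤ ((∫⁻ x, ENNReal.ofReal (ρ x)) + (ENNReal.ofReal R ^ 2)⁻¹ * C) +
          edist (ρs k) ρ * c := by
        intro k
        calc 1 = (∫⁻ x in B, ENNReal.ofReal (ρs k x)) + ∫⁻ x in Bᶜ, ENNReal.ofReal (ρs k x) := by
              rw [lintegral_add_compl _ hBm, h1]
          _ ≤ (∫⁻ x in B, (ENNReal.ofReal (ρ x) + ‖ρs k x - ρ x‖ₑ)) +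
                (ENNReal.ofReal R ^ 2)⁻¹ * C := by
              refine add_le_add (lintegral_mono fun x => ?_) (lintegral_compl_ball_le (hM k) hR)
              calc ENNReal.ofReal (ρs k x) = ENNReal.ofReal (ρ x + (ρs k x - ρ x)) := by ring_nf
                _ ≤ ENNReal.ofReal (ρ x) + ENNReal.ofReal (ρs k x - ρ x) :=
                    ENNReal.ofReal_add_le
                _ ≤ _ := by gcongr; exact Real.ofReal_le_enorm _
          _ ≤ ((∫⁻ x, ENNReal.ofReal (ρ x)) + edist (ρs k) ρ * c) +
                (ENNReal.ofReal R ^ 2)⁻¹ * C := by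
              rw [lintegral_add_left (hmeas ρ)]
              gcongr
              · exact Measure.restrict_le_self
              · exact hbd k
          _ = _ := by ring
      have hlim' : Tendsto (fun k => ((∫⁻ x, ENNReal.ofReal (ρ x)) + (ENNReal.ofReal R ^ 2)⁻¹ * C) +
          edist (ρs k) ρ * c) atTop
          (𝓝 ((∫⁻ x, ENNReal.ofReal (ρ x)) + (ENNReal.ofReal R ^ 2)⁻¹ * C)) := by
        have := (ENNReal.Tendsto.mul_const (b := c) (tendsto_iff_edist_tendsto_0.1 hlim)
          (Or.inr hc)).const_add ((∫⁻ x, ENNReal.ofReal (ρ x)) + (ENNReal.ofReal R ^ 2)⁻¹ * C)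
        simpa using this
      exact ge_of_tendsto' hlim' hk
    have hlim' : Tendsto (fun R : ℝ => (∫⁻ x, ENNReal.ofReal (ρ x)) +
        (ENNReal.ofReal R ^ 2)⁻¹ * C) atTop (𝓝 (∫⁻ x, ENNReal.ofReal (ρ x))) := by
      have h2 : Tendsto (fun R : ℝ => (ENNReal.ofReal R ^ 2)⁻¹) atTop (𝓝 0) := by
        have := ((ENNReal.continuous_pow 2).tendsto ⊤).comp ENNReal.tendsto_ofReal_atTop
        have h3 := ((continuous_inv (G := ℝ≥0∞)).tendsto _).comp this
        simpa [Function.comp_def] using h3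
      have := (ENNReal.Tendsto.mul_const (b := C) h2 (Or.inr hC)).const_add
        (∫⁻ x, ENNReal.ofReal (ρ x))
      simpa using this
    exact ge_of_tendsto hlim' ((eventually_gt_atTop 0).mono hR)

end Density

section Semicontinuity

variable {m : ℝ} {ρ : Lp ℝ (ENNReal.ofReal m) (volume : Measure (Rn n))}

theorem enorm_le_of_tendsto_inner {H : Type*} [NormedAddCommGroup H] [InnerProductSpace ℝ H]
    {g : ℕ → H} {a : H} {N : ℝ≥0∞} (h : Tendsto (fun k => ⟪g k, a⟫) atTop (𝓝 ⟪a, a⟫))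
    (hN : Tendsto (fun k => ‖g k‖ₑ) atTop (𝓝 N)) : ‖a‖ₑ ≤ N := by
  rcases eq_or_ne N ⊤ with rfl | hN'
  · exact le_top
  have h1 : Tendsto (fun k => ‖g k‖ * ‖a‖) atTop (𝓝 (N.toReal * ‖a‖)) := by
    have := (ENNReal.tendsto_toReal hN').comp hN
    simpa [Function.comp_def] using this.mul_const ‖a‖
  have h2 : ‖a‖ * ‖a‖ ≤ N.toReal * ‖a‖ := by
    rw [← real_inner_self_eq_norm_mul_norm]
    exact le_of_tendsto_of_tendsto' h h1 fun k => real_inner_le_norm _ _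
  rw [← ofReal_norm]
  refine ENNReal.ofReal_le_of_le_toReal ?_
  rcases (norm_nonneg a).eq_or_lt with h0 | h0
  · rw [← h0]; exact ENNReal.toReal_nonneg
  · exact le_of_mul_le_mul_right h2 h0

theorem tendsto_integral_mul_of_tendsto_eLpNorm {α : Type*} [MeasurableSpace α] {μ : Measure α}
    {u : ℕ → α → ℝ} {v w : α → ℝ} (hu : ∀ k, MemLp (u k) 2 μ) (hv : MemLp v 2 μ)
    (hw : MemLp w 2 μ)
    (huv : Tendsto (fun k => eLpNorm (fun x => u k x - v x) 2 μ) atTop (𝓝 0)) :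
    Tendsto (fun k => ∫ x, u k x * w x ∂μ) atTop (𝓝 (∫ x, v x * w x ∂μ)) := by
  rw [tendsto_iff_norm_sub_tendsto_zero]
  have h0 : Tendsto (fun k => (eLpNorm (fun x => u k x - v x) 2 μ).toReal *
      (eLpNorm w 2 μ).toReal) atTop (𝓝 0) := by
    simpa using ((ENNReal.tendsto_toReal ENNReal.zero_ne_top).comp huv).mul_const
      (eLpNorm w 2 μ).toReal
  refine squeeze_zero (fun _ => norm_nonneg _) (fun k => ?_) h0
  have hsub := integral_sub ((hu k).integrable_mul hw) (hv.integrable_mul hw)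
  simp only [Pi.mul_apply] at hsub
  rw [← hsub]
  simpa only [sub_mul] using! abs_integral_mul_le (f := fun x => u k x - v x) ((hu k).sub hv) hw

theorem HasWeakGradient.of_tendsto {u : ℕ → Rn n → ℝ} {g : ℕ → Rn n → Rn n} {v : Rn n → ℝ}
    {a : Lp (Rn n) 2 (volume : Measure (Rn n))} (h : ∀ k, HasWeakGradient (u k) (g k))
    (hu : ∀ k, MemLp (u k) 2 volume) (hv : MemLp v 2 volume) (hg : ∀ k, MemLp (g k) 2 volume)
    (huv : Tendsto (fun k => eLpNorm (fun x => u k x - v x) 2 volume) atTop (𝓝 0))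
    (hga : ∀ b, Tendsto (fun k => ⟪(hg k).toLp (g k), b⟫) atTop (𝓝 ⟪a, b⟫)) :
    HasWeakGradient v a := by
  refine ⟨hv.locallyIntegrable (by norm_num), (Lp.memLp a).locallyIntegrable (by norm_num),
    fun φ hφ hφc j => ?_⟩
  have hdφ : MemLp (fun x => fderiv ℝ φ x (EuclideanSpace.single j 1)) 2 volume :=
    ((hφ.continuous_fderiv (by simp)).clm_apply continuous_const).memLp_of_hasCompactSupport
      (hφc.fderiv_apply ℝ _)
  have hφe : MemLp (fun x => φ x • (EuclideanSpace.single j (1 : ℝ) : Rn n)) 2 volume :=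
    (hφ.continuous.smul continuous_const).memLp_of_hasCompactSupport hφc.smul_right
  have hl := tendsto_integral_mul_of_tendsto_eLpNorm hu hv hdφ huv
  have hr := (hga (hφe.toLp _)).neg
  have e : ∀ {f : Rn n → Rn n} (hf : MemLp f 2 volume),
      ⟪hf.toLp f, hφe.toLp _⟫ = ∫ x, ⟪f x, EuclideanSpace.single j 1⟫ * φ x := fun hf => by
    rw [← integral_inner_eq_inner_toLp hf hφe]
    simp only [real_inner_smul_right, mul_comm]
  have ea := e (Lp.memLp a)
  rw [Lp.toLp_coeFn] at ea
  simp only [e, ea] at hr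
  refine tendsto_nhds_unique hl (hr.congr fun k => ?_)
  exact ((h k).2.2 φ hφ hφc j).symm

theorem tendsto_eLpNorm_two_of_tendsto_lintegral {α ι : Type*} [MeasurableSpace α] {μ : Measure α}
    {l : Filter ι} {f : ι → α → ℝ} (h : Tendsto (fun k => ∫⁻ x, ‖f k x‖ₑ ^ 2 ∂μ) l (𝓝 0)) :
    Tendsto (fun k => eLpNorm (f k) 2 μ) l (𝓝 0) := by
  have := (ENNReal.continuous_rpow_const (y := (1 : ℝ) / 2)).tendsto 0 |>.comp h
  rw [ENNReal.zero_rpow_of_pos (by norm_num)] at this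
  refine this.congr fun k => ?_
  rw [Function.comp_apply, ← eLpNorm_two_sq, ← ENNReal.rpow_two, ← ENNReal.rpow_mul]
  simp

theorem tendsto_eLpNorm_rpow_half_sub [Fact (1 ≤ ENNReal.ofReal m)] (hm : 0 < m)
    {ρs : ℕ → Lp ℝ (ENNReal.ofReal m) (volume : Measure (Rn n))}
    (hlim : Tendsto ρs atTop (𝓝 ρ)) (h0s : ∀ k, 0 ≤ᵐ[volume] fun x => ρs k x)
    (h0 : 0 ≤ᵐ[volume] fun x => ρ x) {C : ℝ≥0∞} (hC : C ≠ ⊤)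
    (hA : ∀ k, eLpNorm (fun x => ρs k x ^ (m / 2)) 2 volume ≤ C) :
    Tendsto (fun k => eLpNorm (fun x => ρs k x ^ (m / 2) - ρ x ^ (m / 2)) 2 volume) atTop
      (𝓝 0) := by
  have hroot : ∀ {t : ℝ}, 0 ≤ t → (t ^ (m / 2)) ^ (2 / m) = t := fun {t} ht => by
    rw [← Real.rpow_mul ht, div_mul_div_comm, mul_comm m 2, div_self (by positivity),
      Real.rpow_one]
  set B := eLpNorm (fun x => ρ x ^ (m / 2)) 2 volume
  have hB : B ≠ ⊤ := (memLp_rpow_half hm h0).2.ne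
  have hnn : ∀ σ : Lp ℝ (ENNReal.ofReal m) (volume : Measure (Rn n)),
      (0 ≤ᵐ[volume] fun x => σ x) → 0 ≤ᵐ[volume] fun x => σ x ^ (m / 2) := fun σ hσ => by
    filter_upwards [hσ] with x hx using Real.rpow_nonneg hx _
  have key := tendsto_lintegral_sub_of_tendsto_rpow_sub (μ := volume) (l := atTop) (p := 2) (q := m)
    two_pos hm (f := fun k x => ρs k x ^ (m / 2)) (g := fun _ x => ρ x ^ (m / 2))
    (M := C ^ 2 + B ^ 2) (by finiteness)
    (fun k => (stronglyMeasurable_rpow _ _).measurable.aemeasurable)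
    (fun k => (stronglyMeasurable_rpow _ _).measurable.aemeasurable)
    (fun k => hnn _ (h0s k)) (fun _ => hnn _ h0)
    (fun k => by
      simp only [ENNReal.rpow_two, ← eLpNorm_two_sq]
      exact le_add_right (by gcongr; exact hA k))
    (fun k => by
      simp only [ENNReal.rpow_two, ← eLpNorm_two_sq]
      exact le_add_self)
    (by
      have h1 : Tendsto (fun k => edist (ρs k) ρ ^ m) atTop (𝓝 0) := by
        have := ((ENNReal.continuous_rpow_const (y := m)).tendsto 0).comp
          (tendsto_iff_edist_tendsto_0.1 hlim)
        simpa [ENNReal.zero_rpow_of_pos hm, Function.comp_def] using this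
      refine h1.congr fun k => ?_
      rw [Lp.edist_def, ← lintegral_enorm_rpow_eq hm]
      apply lintegral_congr_ae
      filter_upwards [h0, h0s k] with x hx hx'
      rw [hroot hx, hroot hx']
      rfl)
  apply tendsto_eLpNorm_two_of_tendsto_lintegral
  simpa using key

theorem sobolevMomentG_le_of_tendsto [Fact (1 ≤ ENNReal.ofReal m)] (hm : 0 < m)
    {ρs : ℕ → Lp ℝ (ENNReal.ofReal m) (volume : Measure (Rn n))} {g : ℕ → Rn n → Rn n}
    {C A N M : ℝ≥0∞} (hC : C ≠ ⊤) (hlim : Tendsto ρs atTop (𝓝 ρ))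
    (hae : ∀ᵐ x, Tendsto (fun k => ρs k x) atTop (𝓝 (ρ x)))
    (h0 : ∀ k, 0 ≤ᵐ[volume] fun x => ρs k x) (h1 : ∀ k, ∫⁻ x, ENNReal.ofReal (ρs k x) = 1)
    (hw : ∀ k, HasWeakGradient (fun x => ρs k x ^ (m / 2)) (g k))
    (hval : ∀ k, sobolevMomentValue (ρs k) (g k) ≤ C)
    (hA : Tendsto (fun k => eLpNorm (fun x => ρs k x ^ (m / 2)) 2 volume) atTop (𝓝 A))
    (hN : Tendsto (fun k => eLpNorm (g k) 2 volume) atTop (𝓝 N))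
    (hM : Tendsto (fun k => ∫⁻ x, ‖x‖ₑ ^ 2 * ENNReal.ofReal (ρs k x)) atTop (𝓝 M))
    (hg : ∀ k, MemLp (g k) 2 volume) {a : Lp (Rn n) 2 (volume : Measure (Rn n))}
    (hga : ∀ b, Tendsto (fun k => ⟪(hg k).toLp (g k), b⟫) atTop (𝓝 ⟪a, b⟫)) :
    sobolevMomentG n m ρ ≤ (A ^ 2 + N ^ 2) ^ ((1 : ℝ) / 2) + M := by
  have h0' : 0 ≤ᵐ[volume] fun x => ρ x := by
    filter_upwards [hae, ae_all_iff.2 h0] with x hx hx0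
    exact ge_of_tendsto' hx hx0
  have hbd := fun k => bounds_of_sobolevMomentValue_le (hval k)
  have huv := tendsto_eLpNorm_rpow_half_sub hm hlim h0 h0' hC fun k => (hbd k).1
  refine (sobolevMomentG_le_sobolevMomentValue h0'
    (lintegral_eq_one_of_tendsto hlim hae h1 hC fun k => (hbd k).2.2)
    (HasWeakGradient.of_tendsto hw (fun k => memLp_rpow_half hm (h0 k)) (memLp_rpow_half hm h0')
      hg huv hga)).trans ?_
  have hA' : eLpNorm (fun x => ρ x ^ (m / 2)) 2 volume ≤ A := by
    rw [← hA.liminf_eq]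
    refine Lp.eLpNorm_lim_le_liminf_eLpNorm
      (fun k => (stronglyMeasurable_rpow _ _).aestronglyMeasurable) _ ?_
    filter_upwards [hae] with x hx
    exact hx.rpow_const (Or.inr (by positivity))
  have hN' : eLpNorm a 2 volume ≤ N := by
    rw [← Lp.enorm_def]
    refine enorm_le_of_tendsto_inner (hga a) ?_
    simpa only [Lp.enorm_toLp] using hN
  have hM' : ∫⁻ x, ‖x‖ₑ ^ 2 * ENNReal.ofReal (ρ x) ≤ M := by
    calc ∫⁻ x, ‖x‖ₑ ^ 2 * ENNReal.ofReal (ρ x)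
        = ∫⁻ x, liminf (fun k => ‖x‖ₑ ^ 2 * ENNReal.ofReal (ρs k x)) atTop := by
          apply lintegral_congr_ae
          filter_upwards [hae] with x hx
          exact ((ENNReal.Tendsto.const_mul (ENNReal.tendsto_ofReal hx)
            (Or.inr (by finiteness))).liminf_eq).symm
      _ ≤ liminf (fun k => ∫⁻ x, ‖x‖ₑ ^ 2 * ENNReal.ofReal (ρs k x)) atTop :=
          lintegral_liminf_le fun k => (measurable_enorm.pow_const 2).mul
            (Lp.stronglyMeasurable (ρs k)).measurable.ennreal_ofReal
      _ = M := hM.liminf_eq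
  unfold sobolevMomentValue
  gcongr

theorem isClosed_sobolevMomentG_le [Fact (1 ≤ ENNReal.ofReal m)] (hm : 0 < m) (y : ℝ≥0∞) :
    IsClosed {ρ : Lp ℝ (ENNReal.ofReal m) (volume : Measure (Rn n)) |
      sobolevMomentG n m ρ ≤ y} := by
  rcases eq_or_ne y ⊤ with rfl | hy
  · simp
  refine IsSeqClosed.isClosed fun ρs ρ hρs hlim => ?_
  set δ : ℕ → ℝ≥0∞ := fun k => ((k : ℝ≥0∞) + 1)⁻¹
  have hδ1 : ∀ k, δ k ≤ 1 := fun k => ENNReal.inv_le_one.2 le_add_self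
  have hδ0 : Tendsto δ atTop (𝓝 0) := by
    have := (tendsto_add_atTop_iff_nat 1).2 ENNReal.tendsto_inv_nat_nhds_zero
    simpa [δ] using this
  have hlt : ∀ k, sobolevMomentG n m (ρs k) < y + δ k := fun k =>
    lt_of_le_of_lt (hρs k) (ENNReal.lt_add_right hy (by simp [δ]))
  choose h0 h1 g hw hval using fun k => exists_hasWeakGradient_of_sobolevMomentG_lt (hlt k)
  have hC : y + 1 ≠ ⊤ := by finiteness
  have hvalC : ∀ k, sobolevMomentValue (ρs k) (g k) ≤ y + 1 := fun k =>
    (hval k).le.trans (by gcongr; exact hδ1 k)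
  have hbd := fun k => bounds_of_sobolevMomentValue_le (hvalC k)
  have hg := fun k => (hw k).memLp hC (hbd k).2.1
  have : Fact ((2 : ℝ≥0∞) ≠ ⊤) := ⟨by simp⟩
  obtain ⟨a, φ, hφ, hga⟩ := exists_subseq_tendsto_inner (g := fun k => (hg k).toLp (g k))
    (C := (y + 1).toReal) fun k => by
      rw [Lp.norm_toLp]; exact ENNReal.toReal_mono hC (hbd k).2.1
  obtain ⟨ψ, hψ, hae⟩ := (tendstoInMeasure_of_tendsto_Lp
    (hlim.comp hφ.tendsto_atTop)).exists_seq_tendsto_ae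
  obtain ⟨⟨A, N, M⟩, χ, hχ, hANM⟩ := CompactSpace.tendsto_subseq fun k =>
    (eLpNorm (fun x => ρs (φ (ψ k)) x ^ (m / 2)) 2 volume, eLpNorm (g (φ (ψ k))) 2 volume,
      ∫⁻ x, ‖x‖ₑ ^ 2 * ENNReal.ofReal (ρs (φ (ψ k)) x))
  have hA := (continuous_fst.tendsto _).comp hANM
  have hN := ((continuous_fst.comp continuous_snd).tendsto _).comp hANM
  have hM := ((continuous_snd.comp continuous_snd).tendsto _).comp hANM
  have hsub : Tendsto (fun k => φ (ψ (χ k))) atTop atTop :=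
    hφ.tendsto_atTop.comp (hψ.tendsto_atTop.comp hχ.tendsto_atTop)
  refine (sobolevMomentG_le_of_tendsto hm hC (hlim.comp hsub) ?_ (fun k => h0 _) (fun k => h1 _)
    (fun k => hw _) (fun k => hvalC _) hA hN hM (fun k => hg _) (a := a) fun b =>
      (hga b).comp (hψ.tendsto_atTop.comp hχ.tendsto_atTop)).trans ?_
  · filter_upwards [hae] with x hx using hx.comp hχ.tendsto_atTop
  · have hl : Tendsto (fun k => sobolevMomentValue (ρs (φ (ψ (χ k)))) (g (φ (ψ (χ k))))) atTop
        (𝓝 ((A ^ 2 + N ^ 2) ^ ((1 : ℝ) / 2) + M)) :=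
      Tendsto.add (((ENNReal.continuous_rpow_const (y := (1 : ℝ) / 2)).tendsto _).comp
        ((((ENNReal.continuous_pow 2).tendsto _).comp hA).add
          (((ENNReal.continuous_pow 2).tendsto _).comp hN))) hM
    have hr : Tendsto (fun k => y + δ (φ (ψ (χ k)))) atTop (𝓝 y) := by
      simpa using (hδ0.comp hsub).const_add y
    exact le_of_tendsto_of_tendsto' hl hr fun k => (hval _).le

end Semicontinuity

section Compactness

variable {m : ℝ} {ρ : Lp ℝ (ENNReal.ofReal m) (volume : Measure (Rn n))}

theorem rpow_half_sq_le (hm : 1 < m) {t v K : ℝ} (ht : 0 ≤ t) (hv : |v| ≤ K) :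
    (t ^ (m / 2)) ^ 2 ≤ 4 * (t ^ (m / 2) - v) ^ 2 + (2 * K) ^ (2 * (m - 1) / m) * t := by
  have hm0 : 0 < m := by linarith
  have hu : 0 ≤ t ^ (m / 2) := Real.rpow_nonneg ht _
  have hK : 0 ≤ K := (abs_nonneg v).trans hv
  rcases le_total (t ^ (m / 2)) (2 * K) with h | h
  · have h1 : (t ^ (m / 2)) ^ 2 = (t ^ (m / 2)) ^ (2 * (m - 1) / m) * t := by
      rw [← Real.rpow_mul ht, ← Real.rpow_natCast, ← Real.rpow_mul ht]
      rcases ht.eq_or_lt with rfl | ht'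
      · rw [mul_zero, Real.zero_rpow (by positivity)]
      · conv_rhs => rw [← Real.rpow_one t, ← Real.rpow_mul ht, ← Real.rpow_add ht']
        congr 1
        field_simp
        push_cast
        ring
    rw [h1]
    have h2 : (t ^ (m / 2)) ^ (2 * (m - 1) / m) ≤ (2 * K) ^ (2 * (m - 1) / m) :=
      Real.rpow_le_rpow hu h (div_nonneg (by linarith) hm0.le)
    have h3 := mul_le_mul_of_nonneg_right h2 ht
    nlinarith [sq_nonneg (t ^ (m / 2) - v)]
  · have h1 := (abs_le.1 hv).2
    have h2 : 0 ≤ (2 * K) ^ (2 * (m - 1) / m) * t := by positivity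
    nlinarith

theorem lintegral_rpow_half_sub_indicator_le (hm : 1 < m) (h0 : 0 ≤ᵐ[volume] fun x => ρ x)
    {C : ℝ≥0∞} (hM : ∫⁻ x, ‖x‖ₑ ^ 2 * ENNReal.ofReal (ρ x) ≤ C) {v : Rn n → ℝ}
    (hvm : Measurable v) {K : ℝ} (hv : ∀ x, |v x| ≤ K) {R : ℝ} (hR : 0 < R) :
    ∫⁻ x, ‖ρ x ^ (m / 2) - (Metric.ball 0 R).indicator v x‖ₑ ^ 2 ≤
      4 * (∫⁻ x, ‖ρ x ^ (m / 2) - v x‖ₑ ^ 2) +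
        ENNReal.ofReal ((2 * K) ^ (2 * (m - 1) / m)) * ((ENNReal.ofReal R ^ 2)⁻¹ * C) := by
  set B := Metric.ball (0 : Rn n) R
  set L := ENNReal.ofReal ((2 * K) ^ (2 * (m - 1) / m))
  have hB : MeasurableSet B := Metric.isOpen_ball.measurableSet
  have hsq : ∀ t : ℝ, ENNReal.ofReal (t ^ 2) = ‖t‖ₑ ^ 2 := fun t => by
    rw [← ofReal_norm, ← ENNReal.ofReal_pow (norm_nonneg _), Real.norm_eq_abs, sq_abs]
  calc ∫⁻ x, ‖ρ x ^ (m / 2) - B.indicator v x‖ₑ ^ 2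
      ≤ ∫⁻ x, (4 * ‖ρ x ^ (m / 2) - v x‖ₑ ^ 2 +
          L * Bᶜ.indicator (fun x => ENNReal.ofReal (ρ x)) x) := by
        apply lintegral_mono_ae
        filter_upwards [h0] with x hx
        by_cases hxB : x ∈ B
        · rw [indicator_of_mem hxB]
          refine le_add_right ?_
          calc ‖ρ x ^ (m / 2) - v x‖ₑ ^ 2 = 1 * ‖ρ x ^ (m / 2) - v x‖ₑ ^ 2 := (one_mul _).symm
            _ ≤ _ := by gcongr; norm_num
        · rw [indicator_of_notMem hxB, indicator_of_mem (mem_compl hxB), sub_zero, ← hsq, ← hsq]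
          have h4 : (4 : ℝ≥0∞) = ENNReal.ofReal 4 := by simp
          rw [h4, ← ENNReal.ofReal_mul (by norm_num), ← ENNReal.ofReal_mul
            (Real.rpow_nonneg (by linarith [(abs_nonneg (v x)).trans (hv x)]) _)]
          refine (ENNReal.ofReal_le_ofReal (rpow_half_sq_le hm hx (hv x))).trans
            ENNReal.ofReal_add_le
    _ = 4 * (∫⁻ x, ‖ρ x ^ (m / 2) - v x‖ₑ ^ 2) + L * ∫⁻ x in Bᶜ, ENNReal.ofReal (ρ x) := by
        have hm1 : Measurable fun x => ‖ρ x ^ (m / 2) - v x‖ₑ ^ 2 :=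
          (((stronglyMeasurable_rpow ρ _).measurable.sub hvm).enorm).pow_const 2
        rw [lintegral_add_left (hm1.const_mul 4), lintegral_const_mul _ hm1,
          lintegral_const_mul' _ _ ENNReal.ofReal_ne_top, lintegral_indicator hB.compl]
    _ ≤ _ := by gcongr; exact lintegral_compl_ball_le hM hR

theorem cauchySeq_of_forall_exists_cauchySeq {X : Type*} [PseudoEMetricSpace X] {u : ℕ → X}
    (h : ∀ δ : ℝ≥0∞, 0 < δ → ∃ w : ℕ → X, CauchySeq w ∧ ∀ k, edist (u k) (w k) ≤ δ) :
    CauchySeq u := by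
  rw [EMetric.cauchySeq_iff_NNReal]
  intro ε hε
  have hε4 : (0 : ℝ≥0∞) < ε / 4 := ENNReal.div_pos (by simpa using hε.ne') (by simp)
  obtain ⟨w, hw, huw⟩ := h (ε / 4) hε4
  obtain ⟨N, hN⟩ := EMetric.cauchySeq_iff.1 hw (ε / 4) hε4
  refine ⟨N, fun i hi => ?_⟩
  calc edist (u i) (u N) ≤ edist (u i) (w i) + edist (w i) (w N) + edist (w N) (u N) :=
        edist_triangle4 _ _ _ _
    _ ≤ ε / 4 + ε / 4 + ε / 4 := by
        gcongr
        · exact huw i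
        · exact (hN i hi N le_rfl).le
        · rw [edist_comm]; exact huw N
    _ < ε := by
        have h4 : (ε : ℝ≥0∞) / 4 = ((ε / 4 : ℝ≥0) : ℝ≥0∞) := by simp [ENNReal.coe_div]
        rw [h4]
        norm_cast
        have : (0 : ℝ) < ε := hε
        rw [← NNReal.coe_lt_coe]
        push_cast
        linarith

theorem tendsto_eLpNorm_indicator_sub {α : Type*} [MeasurableSpace α] {μ : Measure α} {B : Set α}
    (hB : MeasurableSet B) (hBμ : μ B ≠ ⊤) {v : ℕ → α → ℝ} {v' : α → ℝ}
    (hvm : ∀ k, Measurable (v k)) (hvm' : Measurable v') {K : ℝ} (hK : ∀ k x, |v k x| ≤ K)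
    (hlim : ∀ x, Tendsto (fun k => v k x) atTop (𝓝 (v' x))) :
    Tendsto (fun k => eLpNorm (B.indicator (v k) - B.indicator v') 2 μ) atTop (𝓝 0) := by
  apply tendsto_eLpNorm_two_of_tendsto_lintegral
  have hK' : ∀ x, |v' x| ≤ K := fun x => le_of_tendsto' (hlim x).abs fun k => hK k x
  have := tendsto_lintegral_of_dominated_convergence
    (μ := μ) (F := fun k x => ‖(B.indicator (v k) - B.indicator v') x‖ₑ ^ 2) (f := fun _ => 0)
    (B.indicator fun _ => ENNReal.ofReal (2 * K) ^ 2)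
    (fun k => (((hvm k).indicator hB).sub (hvm'.indicator hB)).enorm.pow_const 2)
    (fun k => ae_of_all _ fun x => ?_) ?_ (ae_of_all _ fun x => ?_)
  · simpa using this
  · by_cases hx : x ∈ B
    · simp only [Pi.sub_apply, indicator_of_mem hx]
      gcongr
      rw [← ofReal_norm, Real.norm_eq_abs]
      refine ENNReal.ofReal_le_ofReal ((abs_sub _ _).trans ?_)
      linarith [hK k x, hK' x]
    · simp [indicator_of_notMem hx]
  · rw [lintegral_indicator hB, setLIntegral_const]
    finiteness
  · by_cases hx : x ∈ B
    · simp only [Pi.sub_apply, indicator_of_mem hx]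
      have h := (((hlim x).sub_const (v' x)).enorm)
      simpa [Function.comp_def] using ((ENNReal.continuous_pow 2).tendsto _).comp h
    · simp [indicator_of_notMem hx]

theorem cauchySeq_toLp_rpow_half (hm : 1 < m)
    {ρs : ℕ → Lp ℝ (ENNReal.ofReal m) (volume : Measure (Rn n))} {g : ℕ → Rn n → Rn n}
    {C : ℝ≥0∞} (hC : C ≠ ⊤) (h0 : ∀ k, 0 ≤ᵐ[volume] fun x => ρs k x)
    (hw : ∀ k, HasWeakGradient (fun x => ρs k x ^ (m / 2)) (g k))
    (hval : ∀ k, sobolevMomentValue (ρs k) (g k) ≤ C)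
    (hu : ∀ k, MemLp (fun x => ρs k x ^ (m / 2)) 2 volume)
    {a : Lp ℝ 2 (volume : Measure (Rn n))}
    (ha : ∀ b, Tendsto (fun k => ⟪(hu k).toLp _, b⟫) atTop (𝓝 ⟪a, b⟫)) :
    CauchySeq fun k => (hu k).toLp _ := by
  have hbd := fun k => bounds_of_sobolevMomentValue_le (hval k)
  refine cauchySeq_of_forall_exists_cauchySeq fun δ hδ => ?_
  have hδ2 : 0 < δ ^ 2 / 2 := ENNReal.div_pos (by simpa using hδ.ne') (by simp)
  obtain ⟨ε, hεδ, hε⟩ : ∃ ε : ℝ, 4 * (ENNReal.ofReal ε * C) ^ 2 < δ ^ 2 / 2 ∧ 0 < ε := by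
    have h1 : Tendsto (fun ε : ℝ => 4 * (ENNReal.ofReal ε * C) ^ 2) (𝓝[>] 0) (𝓝 0) := by
      have h2 : Tendsto (fun ε : ℝ => ENNReal.ofReal ε * C) (𝓝[>] 0) (𝓝 0) := by
        have := ENNReal.Tendsto.mul_const (b := C)
          ((ENNReal.continuous_ofReal.tendsto 0).mono_left (nhdsWithin_le_nhds (s := Ioi 0)))
          (Or.inr hC)
        simpa using this
      have := ENNReal.Tendsto.const_mul (a := 4) (((ENNReal.continuous_pow 2).tendsto 0).comp h2)
        (Or.inr (by simp))
      simpa [Function.comp_def] using this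
    exact ((h1.eventually_lt_const hδ2).and self_mem_nhdsWithin).exists
  obtain ⟨I, K, hIK, hI⟩ := exists_ballAverage_eq_inner (n := n) ε
  set v : ℕ → Rn n → ℝ := fun k => ballAverage ε fun x => ρs k x ^ (m / 2)
  have hvm : ∀ k, Measurable (v k) := fun k =>
    (stronglyMeasurable_ballAverage ε (stronglyMeasurable_rpow _ _)).measurable
  have hvK : ∀ k x, |v k x| ≤ C.toReal * K := fun k x => by
    simp only [v]
    rw [hI _ (hu k)]
    refine (abs_real_inner_le_norm _ _).trans ?_
    rw [Lp.norm_toLp]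
    exact mul_le_mul (ENNReal.toReal_mono hC (hbd k).1) (hIK x) (norm_nonneg _)
      ENNReal.toReal_nonneg
  set L := ENNReal.ofReal ((2 * (C.toReal * K)) ^ (2 * (m - 1) / m))
  obtain ⟨R, hRδ, hR⟩ : ∃ R : ℝ, L * ((ENNReal.ofReal R ^ 2)⁻¹ * C) < δ ^ 2 / 2 ∧ 0 < R := by
    have h2 : Tendsto (fun R : ℝ => (ENNReal.ofReal R ^ 2)⁻¹) atTop (𝓝 0) := by
      have := ((ENNReal.continuous_pow 2).tendsto ⊤).comp ENNReal.tendsto_ofReal_atTop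
      have h3 := ((continuous_inv (G := ℝ≥0∞)).tendsto _).comp this
      simpa [Function.comp_def] using h3
    have h1 : Tendsto (fun R : ℝ => L * ((ENNReal.ofReal R ^ 2)⁻¹ * C)) atTop (𝓝 0) := by
      have := ENNReal.Tendsto.const_mul (a := L)
        (ENNReal.Tendsto.mul_const (b := C) h2 (Or.inr hC)) (Or.inr ENNReal.ofReal_ne_top)
      simpa using this
    exact ((h1.eventually_lt_const hδ2).and (eventually_gt_atTop 0)).exists
  set B := Metric.ball (0 : Rn n) R
  have hB : MeasurableSet B := Metric.isOpen_ball.measurableSet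
  have hBμ : volume B ≠ ⊤ := measure_ball_lt_top.ne
  have hind : ∀ f : Rn n → ℝ, Measurable f → (∀ x, |f x| ≤ C.toReal * K) →
      MemLp (B.indicator f) 2 volume := fun f hf hfK => by
    have : IsFiniteMeasure (volume.restrict B) := ⟨by simpa using hBμ.lt_top⟩
    rw [memLp_indicator_iff_restrict hB]
    exact MemLp.of_bound hf.aestronglyMeasurable _ (ae_of_all _ hfK)
  have hlim : ∀ x, Tendsto (fun k => v k x) atTop (𝓝 (ballAverage ε a x)) := fun x => by
    simp only [v]
    rw [hI a (Lp.memLp a), Lp.toLp_coeFn]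
    simp only [hI _ (hu _)]
    exact ha (I x)
  have hv'm : Measurable (ballAverage ε a) :=
    (stronglyMeasurable_ballAverage ε (Lp.stronglyMeasurable a)).measurable
  have hv'K : ∀ x, |ballAverage ε a x| ≤ C.toReal * K := fun x =>
    le_of_tendsto' (hlim x).abs fun k => hvK k x
  refine ⟨fun k => (hind (v k) (hvm k) (hvK k)).toLp _, ?_, fun k => ?_⟩
  · refine Tendsto.cauchySeq (x := (hind _ hv'm hv'K).toLp _) ?_
    exact (Lp.tendsto_Lp_iff_tendsto_eLpNorm'' _ _ _ _).2
      (tendsto_eLpNorm_indicator_sub hB hBμ hvm hv'm hvK hlim)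
  · rw [Lp.edist_toLp_toLp, ← ENNReal.pow_le_pow_left_iff (two_ne_zero), eLpNorm_two_sq]
    refine (lintegral_rpow_half_sub_indicator_le hm (h0 k) (hbd k).2.2 (hvm k) (hvK k) hR).trans ?_
    rw [← ENNReal.add_halves (δ ^ 2)]
    refine add_le_add ?_ hRδ.le
    refine le_trans ?_ hεδ.le
    gcongr 4 * ?_
    refine ((hw k).lintegral_sub_ballAverage_le (stronglyMeasurable_rpow _ _) (hu k)
      ((hw k).memLp hC (hbd k).2.1) hε).trans ?_
    gcongr
    exact (hbd k).2.1

theorem cauchySeq_of_cauchySeq_toLp_rpow_half [Fact (1 ≤ ENNReal.ofReal m)] (hm : 0 < m)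
    {ρs : ℕ → Lp ℝ (ENNReal.ofReal m) (volume : Measure (Rn n))}
    (h0 : ∀ k, 0 ≤ᵐ[volume] fun x => ρs k x) {C : ℝ≥0∞} (hC : C ≠ ⊤)
    (hA : ∀ k, eLpNorm (fun x => ρs k x ^ (m / 2)) 2 volume ≤ C)
    (hu : ∀ k, MemLp (fun x => ρs k x ^ (m / 2)) 2 volume)
    (hcau : CauchySeq fun k => (hu k).toLp _) : CauchySeq ρs := by
  have hM : ∀ k, ∫⁻ x, ‖ρs k x‖ₑ ^ m ≤ C ^ 2 := fun k => by
    rw [← eLpNorm_rpow_half_sq hm (h0 k)]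
    gcongr
    exact hA k
  have key := tendsto_lintegral_sub_of_tendsto_rpow_sub (μ := volume) (l := (atTop : Filter (ℕ × ℕ)))
    (p := m) (q := 2) hm two_pos (f := fun i x => ρs i.1 x) (g := fun i x => ρs i.2 x)
    (M := C ^ 2) (by finiteness)
    (fun i => (Lp.stronglyMeasurable _).measurable.aemeasurable)
    (fun i => (Lp.stronglyMeasurable _).measurable.aemeasurable)
    (fun i => h0 _) (fun i => h0 _) (fun i => hM _) (fun i => hM _)
    (by
      have h1 := ENNReal.tendsto_ofReal (cauchySeq_iff_tendsto_dist_atTop_0.1 hcau)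
      have h2 := ((ENNReal.continuous_pow 2).tendsto _).comp h1
      simp only [Function.comp_def, ← edist_dist, Lp.edist_toLp_toLp, eLpNorm_two_sq] at h2
      simpa using h2)
  rw [cauchySeq_iff_tendsto_dist_atTop_0]
  have h1 := ((ENNReal.continuous_rpow_const (y := m⁻¹)).tendsto 0).comp key
  rw [ENNReal.zero_rpow_of_pos (by positivity)] at h1
  have h2 := (ENNReal.tendsto_toReal ENNReal.zero_ne_top).comp h1
  refine h2.congr fun i => ?_
  rw [dist_edist, Lp.edist_def]
  simp only [Function.comp_apply]
  congr 1
  exact (congrArg (· ^ m⁻¹) (lintegral_enorm_rpow_eq hm (⇑(ρs i.1) - ⇑(ρs i.2)))).trans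
    (ENNReal.rpow_rpow_inv hm.ne' _)

theorem isCompact_sobolevMomentG_le [Fact (1 ≤ ENNReal.ofReal m)] (hm : 1 < m) {y : ℝ≥0∞}
    (hy : y ≠ ⊤) :
    IsCompact {ρ : Lp ℝ (ENNReal.ofReal m) (volume : Measure (Rn n)) |
      sobolevMomentG n m ρ ≤ y} := by
  have hm0 : 0 < m := by linarith
  refine isCompact_iff_isSeqCompact.2 fun ρs hρs => ?_
  have hlt : ∀ k, sobolevMomentG n m (ρs k) < y + 1 := fun k =>
    lt_of_le_of_lt (hρs k) (ENNReal.lt_add_right hy one_ne_zero)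
  choose h0 h1 g hw hval using fun k => exists_hasWeakGradient_of_sobolevMomentG_lt (hlt k)
  have hC : y + 1 ≠ ⊤ := by finiteness
  have hbd := fun k => bounds_of_sobolevMomentValue_le (hval k).le
  have hu := fun k => memLp_rpow_half hm0 (h0 k)
  have : Fact ((2 : ℝ≥0∞) ≠ ⊤) := ⟨by simp⟩
  obtain ⟨a, φ, hφ, ha⟩ := exists_subseq_tendsto_inner (g := fun k => (hu k).toLp _)
    (C := (y + 1).toReal) fun k => by
      rw [Lp.norm_toLp]; exact ENNReal.toReal_mono hC (hbd k).1
  have hcau : CauchySeq (ρs ∘ φ) :=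
    cauchySeq_of_cauchySeq_toLp_rpow_half hm0 (fun k => h0 (φ k)) hC (fun k => (hbd (φ k)).1)
      (fun k => hu (φ k))
      (cauchySeq_toLp_rpow_half hm hC (fun k => h0 (φ k)) (fun k => hw (φ k))
        (fun k => (hval (φ k)).le) (fun k => hu (φ k)) ha)
  obtain ⟨ρ, hρ⟩ := cauchySeq_tendsto_of_complete hcau
  exact ⟨ρ, (isClosed_sobolevMomentG_le hm0 y).mem_of_tendsto hρ
    (Eventually.of_forall fun k => hρs (φ k)), φ, hφ, hρ⟩

end Compactness

/-- Lemma 5.3: the Sobolev–moment functional is lower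
semicontinuous on `L^m(ℝⁿ)` and its sublevels are relatively compact in
`L^m(ℝⁿ)`, for `m > 1`. -/
theorem sobolev_moment_coercive (n : ℕ) (m : ℝ) (hm : 1 < m)
    [Fact (1 ≤ ENNReal.ofReal m)] :
    LowerSemicontinuous (sobolevMomentG n m) ∧
    ∀ c : ℝ,
      IsCompact (closure
        {ρ : Lp ℝ (ENNReal.ofReal m) (volume : Measure (Rn n)) |
          sobolevMomentG n m ρ ≤ ENNReal.ofReal c}) := by
  refine ⟨lowerSemicontinuous_iff_isClosed_preimage.2 fun y =>
    isClosed_sobolevMomentG_le (by linarith) y, fun c => ?_⟩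
  rw [(isClosed_sobolevMomentG_le (by linarith) _).closure_eq]
  exact isCompact_sobolevMomentG_le hm ENNReal.ofReal_ne_top

end Paper
end
end
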